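/- arXiv:1708.06815 — 3 statements merged into one kernel-verified Lean document; each statement's English description precedes it below -/
import Mathlib

section
/- Let G be a connected loopless graph with root vertex g, let q ∈ K with q ≠ 0, and take Hecke parameters q_e = q for all edges e. Then: (i) for every k ∈ ℕ, the K-linear span of all products (X_1^{In})^{α_1}⋯(X_n^{In})^{α_n} with α_1 + … + α_n ≤ k equals the intersection of Ψ^{In}_{G,q} with the image in Φ^{In}_{G,q} of the polynomials of total degree ≤ k in the u_e; and (ii) for every k ∈ ℕ, dim_K F_k(Ψ^{In}_{G,q}) = dim_K F_k(C^{In}_G), i.e., the Hilbert polynomial of Ψ^{In}_{G,q} coincides with that of the undeformed internal algebra C^{In}_G. -/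
open MvPolynomial

set_option synthInstance.maxHeartbeats 1000000
set_option maxHeartbeats 1000000

noncomputable section

/-- The edges of the cut oriented out of `I` (small endpoint in `I`). -/
def cutOut {n : ℕ} {E : Type*} [Fintype E] (a b : E → Fin n) (I : Finset (Fin n)) :
    Finset E :=
  Finset.univ.filter fun e => a e ∈ I ∧ b e ∉ I

/-- The edges of the cut oriented into `I` (large endpoint in `I`). -/
def cutIn {n : ℕ} {E : Type*} [Fintype E] (a b : E → Fin n) (I : Finset (Fin n)) :
    Finset E :=
  Finset.univ.filter fun e => b e ∈ I ∧ a e ∉ I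

/-- The cut polynomial `f_I`. -/
def fI {K : Type*} [Field K] {n : ℕ} {E : Type*} [Fintype E]
    (a b : E → Fin n) (q : E → K) (I : Finset (Fin n)) : MvPolynomial E K :=
  (∏ e ∈ cutOut a b I, X e) * ∏ e ∈ cutIn a b I, (X e - C (q e))

/-- The graph `G` is connected. -/
def IsConnectedGraph {n : ℕ} {E : Type*} (a b : E → Fin n) : Prop :=
  ∀ x y : Fin n,
    Relation.ReflTransGen (fun u w => ∃ e, (a e = u ∧ b e = w) ∨ (a e = w ∧ b e = u)) x y

/-- The ideal of relations of `Φ^{In}_{G,Q}`: the relations `u_e^2 = q_e u_e` together with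
the cut relations `f_I = 0` for all proper nonempty subsets `I`. -/
def relIdealIn (K : Type*) [Field K] {n : ℕ} (E : Type*) [Fintype E]
    (a b : E → Fin n) (q : E → K) : Ideal (MvPolynomial E K) :=
  Ideal.span ((Set.range fun e : E => (X e) ^ 2 - C (q e) * X e) ∪
    {p | ∃ I : Finset (Fin n), I.Nonempty ∧ I ≠ Finset.univ ∧ p = fI a b q I})

/-- The algebra `Φ^{In}_{G,Q}`. -/
abbrev PhiIn (K : Type*) [Field K] {n : ℕ} (E : Type*) [Fintype E]
    (a b : E → Fin n) (q : E → K) : Type _ :=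
  MvPolynomial E K ⧸ relIdealIn K E a b q

/-- The generator `X_i^{In}`. -/
def XIn (K : Type*) [Field K] {n : ℕ} {E : Type*} [Fintype E]
    (a b : E → Fin n) (q : E → K) (i : Fin n) : PhiIn K E a b q :=
  Ideal.Quotient.mk _
    ((∑ e ∈ Finset.univ.filter fun e => a e = i, X e) -
      ∑ e ∈ Finset.univ.filter fun e => b e = i, X e)

/-- The `Q`-deformation `Ψ^{In}_{G,Q}` of the internal algebra. -/
def PsiIn (K : Type*) [Field K] {n : ℕ} {E : Type*} [Fintype E]
    (a b : E → Fin n) (q : E → K) : Subalgebra K (PhiIn K E a b q) :=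
  Algebra.adjoin K (Set.range (XIn K a b q))

/-- The square-free internal relation `g_I = (f_I - f_Ī)/q |_{q = 0}`. -/
def gI (K : Type*) [Field K] {n : ℕ} {E : Type*} [Fintype E] [DecidableEq E]
    (a b : E → Fin n) (I : Finset (Fin n)) : MvPolynomial E K :=
  (∑ e' ∈ cutOut a b I, ∏ e ∈ (cutOut a b I ∪ cutIn a b I).erase e', X e) -
    ∑ e' ∈ cutIn a b I, ∏ e ∈ (cutOut a b I ∪ cutIn a b I).erase e', X e

/-- The ideal of relations of the square-free internal algebra `Φ^{In}_{G,0}`: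
the relations `φ_e^2 = 0` together with `g_I = 0` for subsets `I` containing the root. -/
def relIdealIn0 (K : Type*) [Field K] {n : ℕ} (E : Type*) [Fintype E] [DecidableEq E]
    (a b : E → Fin n) (g : Fin n) : Ideal (MvPolynomial E K) :=
  Ideal.span ((Set.range fun e : E => (X e : MvPolynomial E K) ^ 2) ∪
    {p | ∃ I : Finset (Fin n), g ∈ I ∧ p = gI K a b I})

/-- The square-free internal algebra `Φ^{In}_{G,0}`. -/
abbrev PhiIn0 (K : Type*) [Field K] {n : ℕ} (E : Type*) [Fintype E] [DecidableEq E]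
    (a b : E → Fin n) (g : Fin n) : Type _ :=
  MvPolynomial E K ⧸ relIdealIn0 K E a b g

/-- The generator `X_i^{In}` of the square-free internal algebra. -/
def XIn0 (K : Type*) [Field K] {n : ℕ} {E : Type*} [Fintype E] [DecidableEq E]
    (a b : E → Fin n) (g : Fin n) (i : Fin n) : PhiIn0 K E a b g :=
  Ideal.Quotient.mk _
    ((∑ e ∈ Finset.univ.filter fun e => a e = i, X e) -
      ∑ e ∈ Finset.univ.filter fun e => b e = i, X e)

/-- The undeformed internal algebra `C^{In}_G`. -/
def CIn (K : Type*) [Field K] {n : ℕ} {E : Type*} [Fintype E] [DecidableEq E]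
    (a b : E → Fin n) (g : Fin n) : Subalgebra K (PhiIn0 K E a b g) :=
  Algebra.adjoin K (Set.range (XIn0 K a b g))

/-- The `k`-th piece of the filtration of `Ψ^{In}_{G,Q}` induced by the generators `X_i^{In}`. -/
def FkIn (K : Type*) [Field K] {n : ℕ} {E : Type*} [Fintype E]
    (a b : E → Fin n) (q : E → K) (k : ℕ) : Submodule K (PhiIn K E a b q) :=
  Submodule.span K
    {y | ∃ α : Fin n → ℕ, (∑ i, α i) ≤ k ∧ y = ∏ i, (XIn K a b q i) ^ (α i)}

/-- The `k`-th piece of the filtration of the undeformed internal algebra `C^{In}_G`. -/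
def FkIn0 (K : Type*) [Field K] {n : ℕ} {E : Type*} [Fintype E] [DecidableEq E]
    (a b : E → Fin n) (g : Fin n) (k : ℕ) : Submodule K (PhiIn0 K E a b g) :=
  Submodule.span K
    {y | ∃ α : Fin n → ℕ, (∑ i, α i) ≤ k ∧ y = ∏ i, (XIn0 K a b g i) ^ (α i)}

namespace HeckeAux

set_option linter.unusedSectionVars false

section comb

variable {K : Type*} [Field K] {n : ℕ} {E : Type*} [DecidableEq E]
  (a b : E → Fin n)

/-- `f` separates `I` from its complement. -/
abbrev Sep (f : E) (I : Finset (Fin n)) : Prop := ¬ (a f ∈ I ↔ b f ∈ I)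

/-- number of edges of `S` in the cut -/
def cS (S : Finset E) (I : Finset (Fin n)) : ℕ := (S.filter fun f => Sep a b f I).card

/-- proper nonempty vertex subsets not separated by `T` -/
def Adm (T : Finset E) (I : Finset (Fin n)) : Prop :=
  I.Nonempty ∧ I ≠ Finset.univ ∧ ∀ f ∈ T, ¬ Sep a b f I

/-- all cut edges directed out of `I` -/
abbrev dI (S : Finset E) (I : Finset (Fin n)) (A : Finset E) : Prop :=
  ∀ f ∈ S, Sep a b f I → (f ∈ A ↔ a f ∈ I)

/-- strongly connected orientations of the minor -/
def SC (S T : Finset E) (A : Finset E) : Prop := ∀ I, Adm a b T I → ¬ dI a b S I A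

/-- the minor is connected -/
def Con (S T : Finset E) : Prop := ∀ I, Adm a b T I → 1 ≤ cS a b S I

/-- monomial functions -/
def mon (K : Type*) [Field K] (B : Finset E) : Finset E → K := fun A => if B ⊆ A then 1 else 0

/-- functions on `Finset E` of degree `< k` in the variables of `S` -/
def Fl (K : Type*) [Field K] (S : Finset E) (k : ℕ) : Submodule K (Finset E → K) :=
  Submodule.span K (Set.image (mon K) {B | B ⊆ S ∧ B.card < k})

/-- indicator -/
def delta (K : Type*) [Field K] (S : Finset E) (I : Finset (Fin n)) : Finset E → K :=
  fun A => if dI a b S I A then 1 else 0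

/-- deformed cut relation -/
def sig (K : Type*) [Field K] (S : Finset E) (I : Finset (Fin n)) : Finset E → K :=
  delta a b K S I - (-1 : K) ^ (cS a b S I) • delta a b K S Iᶜ

/-- strictly generated relations -/
def Str (K : Type*) [Field K] (S T : Finset E) (k : ℕ) : Submodule K (Finset E → K) :=
  Submodule.span K {h | ∃ (I : Finset (Fin n)) (l : ℕ) (r : Finset E → K), Adm a b T I ∧
    r ∈ Fl K S l ∧ l + cS a b S I ≤ k + 1 ∧ h = r * sig a b K S I}

lemma mon_mul (B B' : Finset E) : mon K B * mon K B' = mon K (B ∪ B') := by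
  funext A
  simp only [mon, Pi.mul_apply, Finset.union_subset_iff]
  by_cases h : B ⊆ A <;> by_cases h' : B' ⊆ A <;> simp [h, h']

lemma mon_mem {S B : Finset E} {k : ℕ} (h : B ⊆ S) (hk : B.card < k) : mon K B ∈ Fl K S k :=
  Submodule.subset_span ⟨B, ⟨h, hk⟩, rfl⟩

lemma Fl_mono {S S' : Finset E} {k k' : ℕ} (h : S ⊆ S') (hk : k ≤ k') : Fl K S k ≤ Fl K S' k' := by
  apply Submodule.span_mono
  rintro _ ⟨B, ⟨h1, h2⟩, rfl⟩
  exact ⟨B, ⟨h1.trans h, by omega⟩, rfl⟩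

lemma Fl_mul {S : Finset E} {k l m : ℕ} {f g : Finset E → K} (hf : f ∈ Fl K S k)
    (hg : g ∈ Fl K S l) (h : k + l ≤ m + 1) : f * g ∈ Fl K S m := by
  have := Submodule.mul_mem_mul hf hg
  rw [Fl, Fl, Submodule.span_mul_span] at this
  refine Submodule.span_le.2 ?_ this
  rintro _ ⟨_, ⟨B, ⟨h1, h2⟩, rfl⟩, _, ⟨B', ⟨h3, h4⟩, rfl⟩, rfl⟩
  simp only [mon_mul]
  apply mon_mem (Finset.union_subset h1 h3)
  have := Finset.card_union_le B B'
  omega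

lemma mon_empty : mon K (∅ : Finset E) = 1 := by
  funext A; simp [mon]

lemma one_mem_Fl {S : Finset E} : (1 : Finset E → K) ∈ Fl K S 1 := by
  rw [← mon_empty]; exact mon_mem (by simp) (by simp)

lemma Fl_zero (S : Finset E) : Fl K S 0 = ⊥ := by
  rw [Fl, Submodule.span_eq_bot]; rintro _ ⟨B, ⟨_, h⟩, rfl⟩; omega

lemma mon_single_mem {S : Finset E} {e : E} (he : e ∈ S) : mon K {e} ∈ Fl K S 2 :=
  mon_mem (by simpa using he) (by simp)

lemma Fl_congr {S : Finset E} {k : ℕ} {f : Finset E → K} (hf : f ∈ Fl K S k) {A A' : Finset E}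
    (h : ∀ e ∈ S, e ∈ A ↔ e ∈ A') : f A = f A' := by
  induction hf using Submodule.span_induction with
  | mem x hx =>
    obtain ⟨B, ⟨h1, _⟩, rfl⟩ := hx
    have : B ⊆ A ↔ B ⊆ A' := by
      constructor <;> intro hh e he <;> have := h e (h1 he) <;> have := hh he <;> tauto
    simp [mon, this]
  | zero => rfl
  | add x y _ _ hx hy => simp [hx, hy]
  | smul c x _ hx => simp [hx]

/-- decomposition along a variable -/
lemma Fl_split {S : Finset E} {e : E} (he : e ∉ S) {k : ℕ} {f : Finset E → K}
    (hf : f ∈ Fl K (insert e S) k) : ∃ f0 ∈ Fl K S k, ∃ f1 ∈ Fl K S (k - 1),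
      f = f0 + mon K {e} * f1 := by
  induction hf using Submodule.span_induction with
  | mem x hx =>
    obtain ⟨B, ⟨h1, h2⟩, rfl⟩ := hx
    by_cases hB : e ∈ B
    · refine ⟨0, zero_mem _, mon K (B.erase e), mon_mem ?_ ?_, ?_⟩
      · intro x hx; have := h1 (Finset.mem_of_mem_erase hx); simp at this hx; tauto
      · have := Finset.card_erase_of_mem hB
        have : 0 < B.card := Finset.card_pos.2 ⟨e, hB⟩
        omega
      · rw [mon_mul, zero_add]; congr 1; ext x; simp; by_cases x = e <;> simp_all
    · refine ⟨mon K B, mon_mem ?_ h2, 0, zero_mem _, by simp⟩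
      intro x hx; have := h1 hx; simp at this; rcases this with rfl | h <;> tauto
  | zero => exact ⟨0, zero_mem _, 0, zero_mem _, by simp⟩
  | add x y _ _ hx hy =>
    obtain ⟨x0, h1, x1, h2, rfl⟩ := hx
    obtain ⟨y0, h3, y1, h4, rfl⟩ := hy
    exact ⟨x0 + y0, add_mem h1 h3, x1 + y1, add_mem h2 h4, by ring⟩
  | smul c x _ hx =>
    obtain ⟨x0, h1, x1, h2, rfl⟩ := hx
    exact ⟨c • x0, Submodule.smul_mem _ _ h1, c • x1, Submodule.smul_mem _ _ h2, by
      rw [smul_add, mul_smul_comm]⟩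

variable {a b}

lemma Adm.compl {T : Finset E} {I : Finset (Fin n)} (h : Adm a b T I) : Adm a b T Iᶜ := by
  obtain ⟨h1, h2, h3⟩ := h
  refine ⟨?_, ?_, ?_⟩
  · rw [Finset.nonempty_iff_ne_empty]; simpa using h2
  · rw [Ne, Finset.compl_eq_univ_iff]; exact h1.ne_empty
  · intro f hf; have := h3 f hf; simp [Sep] at this ⊢; tauto

lemma cS_compl (S : Finset E) (I : Finset (Fin n)) : cS a b S Iᶜ = cS a b S I := by
  unfold cS; congr 1; ext f; simp [Sep]; tauto

lemma cS_insert_sep {S : Finset E} {e : E} (he : e ∉ S) {I : Finset (Fin n)} (h : Sep a b e I) :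
    cS a b (insert e S) I = cS a b S I + 1 := by
  unfold cS; rw [Finset.filter_insert, if_pos h, Finset.card_insert_of_notMem (by simp [he])]

lemma cS_insert_nsep {S : Finset E} {e : E} {I : Finset (Fin n)} (h : ¬ Sep a b e I) :
    cS a b (insert e S) I = cS a b S I := by
  unfold cS; rw [Finset.filter_insert, if_neg h]

lemma delta_nsep {S : Finset E} {e : E} {I : Finset (Fin n)} (h : ¬ Sep a b e I) :
    delta a b K (insert e S) I = delta a b K S I := by
  funext A
  have : dI a b (insert e S) I A ↔ dI a b S I A := by
    simp only [dI, Finset.forall_mem_insert]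
    exact ⟨fun h' => h'.2, fun h' => ⟨fun hs => absurd hs h, h'⟩⟩
  unfold delta
  exact if_congr this rfl rfl

lemma delta_sep1 {S : Finset E} {e : E} {I : Finset (Fin n)} (h : Sep a b e I) (h1 : a e ∈ I) :
    delta a b K (insert e S) I = mon K {e} * delta a b K S I := by
  funext A
  have : dI a b (insert e S) I A ↔ (e ∈ A ∧ dI a b S I A) := by
    simp only [dI, Finset.forall_mem_insert]; tauto
  unfold delta
  rw [if_congr this rfl rfl, Pi.mul_apply]
  by_cases h2 : e ∈ A <;> simp [mon, h2]

lemma delta_sep2 {S : Finset E} {e : E} {I : Finset (Fin n)} (h : Sep a b e I) (h1 : a e ∉ I) :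
    delta a b K (insert e S) I = (1 - mon K {e}) * delta a b K S I := by
  funext A
  have : dI a b (insert e S) I A ↔ (e ∉ A ∧ dI a b S I A) := by
    simp only [dI, Finset.forall_mem_insert]; tauto
  unfold delta
  rw [if_congr this rfl rfl, Pi.mul_apply]
  by_cases h2 : e ∈ A <;> simp [mon, h2]

lemma sep_compl {e : E} {I : Finset (Fin n)} : Sep a b e Iᶜ ↔ Sep a b e I := by
  simp [Sep]; tauto

lemma delta_mem (S : Finset E) (I : Finset (Fin n)) :
    delta a b K S I ∈ Fl K S (cS a b S I + 1) := by
  induction S using Finset.induction_on with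
  | empty =>
    have : delta a b K ∅ I = 1 := by funext A; simp [delta]
    rw [this]; exact Fl_mono (le_refl _) (by omega) one_mem_Fl
  | insert e S he ih =>
    by_cases h : Sep a b e I
    · rw [cS_insert_sep he h]
      have ih' := Fl_mono (Finset.subset_insert e S) le_rfl ih
      have hm : mon K {e} * delta a b K S I ∈ Fl K (insert e S) (cS a b S I + 1 + 1) :=
        Fl_mul (mon_single_mem (by simp)) ih' (by omega)
      by_cases h1 : a e ∈ I
      · rwa [delta_sep1 h h1]
      · rw [delta_sep2 h h1, sub_mul, one_mul]
        exact sub_mem (Fl_mono le_rfl (by omega) ih') hm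
    · rw [cS_insert_nsep h, delta_nsep h]
      exact Fl_mono (Finset.subset_insert e S) le_rfl ih

lemma sig_nsep {S : Finset E} {e : E} {I : Finset (Fin n)} (h : ¬ Sep a b e I) :
    sig a b K (insert e S) I = sig a b K S I := by
  rw [sig, sig, cS_insert_nsep h, delta_nsep h, delta_nsep (by rwa [sep_compl])]

lemma sig_sep {S : Finset E} {e : E} (he : e ∉ S) {I : Finset (Fin n)} (h : Sep a b e I) :
    ∃ (ε η : K) (J : Finset (Fin n)), cS a b S J = cS a b S I ∧
      mon K {e} * sig a b K S I = ε • sig a b K (insert e S) I + η • delta a b K S J := by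
  have h' : Sep a b e Iᶜ := sep_compl.2 h
  by_cases h1 : a e ∈ I
  · refine ⟨1, -(-1) ^ (cS a b S I), Iᶜ, cS_compl _ _, ?_⟩
    rw [sig, sig, cS_insert_sep he h, delta_sep1 h h1, delta_sep2 h' (by simpa using h1)]
    funext A
    simp [pow_succ]; ring
  · refine ⟨-1, 1, I, rfl, ?_⟩
    rw [sig, sig, cS_insert_sep he h, delta_sep2 h h1, delta_sep1 h' (by simpa using h1)]
    funext A
    simp [pow_succ]; ring

lemma sig_one {S : Finset E} {I : Finset (Fin n)} (h : cS a b S I = 1) :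
    sig a b K S I = 1 := by
  obtain ⟨e, he⟩ := Finset.card_eq_one.1 h
  have hm : ∀ f, (f ∈ S ∧ Sep a b f I) ↔ f = e := by
    intro f; rw [← Finset.mem_filter (p := fun f => Sep a b f I), he]; simp
  have h1 : ∀ A, dI a b S I A ↔ (e ∈ A ↔ a e ∈ I) := by
    intro A
    constructor
    · intro hd; have := (hm e).2 rfl; exact hd e this.1 this.2
    · intro hd f hf hs; have := (hm f).1 ⟨hf, hs⟩; subst this; exact hd
  have h2 : ∀ A, dI a b S Iᶜ A ↔ (e ∈ A ↔ a e ∈ Iᶜ) := by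
    intro A
    constructor
    · intro hd; have := (hm e).2 rfl; exact hd e this.1 (sep_compl.2 this.2)
    · intro hd f hf hs; have := (hm f).1 ⟨hf, sep_compl.1 hs⟩; subst this; exact hd
  funext A
  simp only [sig, delta, h, Pi.sub_apply, Pi.smul_apply]
  rw [if_congr (h1 A) rfl rfl, if_congr (h2 A) rfl rfl]
  by_cases h3 : e ∈ A <;> by_cases h4 : a e ∈ I <;> simp [h3, h4]

lemma sig_vanish {S T : Finset E} {I : Finset (Fin n)} (hI : Adm a b T I) {A : Finset E}
    (hA : SC a b S T A) : sig a b K S I A = 0 := by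
  simp only [sig, delta, Pi.sub_apply, Pi.smul_apply]
  rw [if_neg (hA I hI), if_neg (hA _ hI.compl)]; simp

lemma Str_vanish {S T : Finset E} {k : ℕ} {h : Finset E → K} (hh : h ∈ Str a b K S T k)
    {A : Finset E} (hA : SC a b S T A) : h A = 0 := by
  induction hh using Submodule.span_induction with
  | mem x hx =>
    obtain ⟨I, l, r, hI, _, _, rfl⟩ := hx
    simp [sig_vanish hI hA]
  | zero => rfl
  | add x y _ _ hx hy => simp [hx, hy]
  | smul c x _ hx => simp [hx]

lemma Adm.of_insert {T : Finset E} {e : E} {I : Finset (Fin n)} (h : Adm a b (insert e T) I) :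
    Adm a b T I ∧ ¬ Sep a b e I :=
  ⟨⟨h.1, h.2.1, fun f hf => h.2.2 f (by simp [hf])⟩, h.2.2 e (by simp)⟩

lemma Adm.insert {T : Finset E} {e : E} {I : Finset (Fin n)} (h : Adm a b T I)
    (h' : ¬ Sep a b e I) : Adm a b (insert e T) I :=
  ⟨h.1, h.2.1, by simp only [Finset.forall_mem_insert]; exact ⟨h', h.2.2⟩⟩

/-- multiplication by a new variable -/
lemma Str_mul {S T : Finset E} {e : E} (he : e ∉ S) {k : ℕ} {h : Finset E → K}
    (hh : h ∈ Str a b K S T k) : ∃ s ∈ Str a b K (insert e S) T (k + 1), ∃ r ∈ Fl K S (k + 1),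
      mon K {e} * h = s + r := by
  induction hh using Submodule.span_induction with
  | mem x hx =>
    obtain ⟨I, l, r, hI, hr, hl, rfl⟩ := hx
    by_cases hs : Sep a b e I
    · obtain ⟨ε, η, J, hJ, heq⟩ := sig_sep (K := K) he hs
      refine ⟨ε • (r * sig a b K (insert e S) I), Submodule.smul_mem _ _ (Submodule.subset_span
        ⟨I, l, r, hI, Fl_mono (Finset.subset_insert e S) le_rfl hr, ?_, rfl⟩),
        η • (r * delta a b K S J), Submodule.smul_mem _ _ (Fl_mul hr (delta_mem S J) ?_), ?_⟩
      · rw [cS_insert_sep he hs]; omega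
      · omega
      · rw [mul_left_comm, heq, mul_add, mul_smul_comm, mul_smul_comm]
    · refine ⟨mon K {e} * r * sig a b K (insert e S) I, Submodule.subset_span
        ⟨I, l + 1, _, hI, Fl_mul (mon_single_mem (by simp))
          (Fl_mono (Finset.subset_insert e S) le_rfl hr) (by omega), ?_, rfl⟩, 0, zero_mem _, ?_⟩
      · rw [cS_insert_nsep hs]; omega
      · rw [sig_nsep hs]; ring
  | zero => exact ⟨0, zero_mem _, 0, zero_mem _, by simp⟩
  | add x y _ _ hx hy =>
    obtain ⟨x0, h1, x1, h2, hx⟩ := hx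
    obtain ⟨y0, h3, y1, h4, hy⟩ := hy
    exact ⟨x0 + y0, add_mem h1 h3, x1 + y1, add_mem h2 h4, by rw [mul_add, hx, hy]; ring⟩
  | smul c x _ hx =>
    obtain ⟨x0, h1, x1, h2, hx⟩ := hx
    exact ⟨c • x0, Submodule.smul_mem _ _ h1, c • x1, Submodule.smul_mem _ _ h2, by
      rw [mul_smul_comm, hx, smul_add]⟩

lemma Str_contract {S T : Finset E} {e : E} {k : ℕ} :
    Str a b K S (insert e T) k ≤ Str a b K (insert e S) T k := by
  apply Submodule.span_mono
  rintro _ ⟨I, l, r, hI, hr, hl, rfl⟩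
  obtain ⟨hI, hs⟩ := hI.of_insert
  exact ⟨I, l, r, hI, Fl_mono (Finset.subset_insert e S) le_rfl hr, by rwa [cS_insert_nsep hs],
    by rw [sig_nsep hs]⟩

lemma SC_congr {S T : Finset E} {A A' : Finset E} (h : ∀ e ∈ S, e ∈ A ↔ e ∈ A')
    (hA : SC a b S T A) : SC a b S T A' := by
  intro I hI hd
  exact hA I hI fun f hf hs => (h f hf).trans (hd f hf hs)

/-- `A` strongly connected after deletion: both lifts are strongly connected. -/
lemma SC_delete {S T : Finset E} {e : E} {A : Finset E}
    (hA : SC a b S T A) : SC a b (insert e S) T A := by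
  intro I hI hd
  exact hA I hI fun f hf hs => hd f (by simp [hf]) hs

/-- lifting from the contraction -/
lemma SC_lift {S T : Finset E} {e : E} (he : e ∉ S) (hc : Con a b S T) {A : Finset E}
    (hA : SC a b S (insert e T) A) :
    ∃ A', (∀ f ∈ S, f ∈ A ↔ f ∈ A') ∧ SC a b (insert e S) T A' := by
  by_contra hcon
  push Not at hcon
  have hne : ∀ f ∈ S, f ≠ e := fun f hf h => he (h ▸ hf)
  have H1 := hcon (insert e A) (fun f hf => by simp [hne f hf])
  have H2 := hcon (A.erase e) (fun f hf => by simp [hne f hf])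
  simp only [SC] at H1 H2
  push Not at H1 H2
  obtain ⟨I, hI, hdI⟩ := H1
  obtain ⟨J, hJ, hdJ⟩ := H2
  have hdI' : dI a b S I A := fun f hf hs => by
    have := hdI f (by simp [hf]) hs; simpa [hne f hf] using this
  have hdJ' : dI a b S J A := fun f hf hs => by
    have := hdJ f (by simp [hf]) hs; simpa [hne f hf] using this
  have hsI : Sep a b e I := by
    by_contra hs; exact hA I (hI.insert (not_not_intro hs)) hdI'
  have hsJ : Sep a b e J := by
    by_contra hs; exact hA J (hJ.insert (not_not_intro hs)) hdJ'
  have haI : a e ∈ I := (hdI e (by simp) hsI).1 (by simp)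
  have haJ : a e ∉ J := fun h => by simpa using (hdJ e (by simp) hsJ).2 h
  have hbI : b e ∉ I := by simp only [Sep] at hsI; tauto
  have hbJ : b e ∈ J := by simp only [Sep] at hsJ; tauto
  have hU : I ∪ J = Finset.univ := by
    by_contra hU
    refine hA (I ∪ J) ⟨⟨a e, by simp [haI]⟩, hU, ?_⟩ ?_
    · simp only [Finset.forall_mem_insert]
      refine ⟨by simp [Sep, haI, hbJ], fun f hf => ?_⟩
      have h1 := hI.2.2 f hf
      have h2 := hJ.2.2 f hf
      simp only [Sep, Finset.mem_union] at *; tauto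
    · intro f hf hs
      have h1 := hdI' f hf
      have h2 := hdJ' f hf
      simp only [Sep, Finset.mem_union] at *; tauto
  have hN : I ∩ J = ∅ := by
    by_contra hU
    refine hA (I ∩ J) ⟨Finset.nonempty_iff_ne_empty.2 hU, fun h => ?_, ?_⟩ ?_
    · have : a e ∈ I ∩ J := by rw [h]; simp
      simp [haJ] at this
    · simp only [Finset.forall_mem_insert]
      refine ⟨by simp [Sep, haJ, hbI], fun f hf => ?_⟩
      have h1 := hI.2.2 f hf
      have h2 := hJ.2.2 f hf
      simp only [Sep, Finset.mem_inter] at *; tauto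
    · intro f hf hs
      have h1 := hdI' f hf
      have h2 := hdJ' f hf
      simp only [Sep, Finset.mem_inter] at *; tauto
  obtain ⟨f, hf⟩ := Finset.card_pos.1 (hc I hI)
  rw [Finset.mem_filter] at hf
  have key : ∀ x, x ∈ J ↔ x ∉ I := by
    intro x
    have h1 : x ∈ I ∪ J := by rw [hU]; simp
    have h2 : x ∉ I ∩ J := by rw [hN]; simp
    simp only [Finset.mem_union, Finset.mem_inter] at h1 h2; tauto
  have h1 := hdI' f hf.1 hf.2
  have h2 := hdJ' f hf.1 (by have := hf.2; simp only [Sep, key] at *; tauto)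
  rw [key] at h2
  tauto

lemma Con_contract {S T : Finset E} {e : E} (h : Con a b (insert e S) T) :
    Con a b S (insert e T) := by
  intro I hI
  obtain ⟨hI, hs⟩ := hI.of_insert
  rw [← cS_insert_nsep (S := S) hs]; exact h I hI

lemma Con_delete {S T : Finset E} {e : E} (he : e ∉ S) (h : Con a b (insert e S) T)
    (h' : ∀ I, Adm a b T I → cS a b (insert e S) I ≠ 1) : Con a b S T := by
  intro I hI
  have h1 := h I hI
  have h2 := h' I hI
  by_cases hs : Sep a b e I
  · rw [cS_insert_sep he hs] at *; omega
  · rwa [cS_insert_nsep hs] at h1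

lemma SC_empty {T : Finset E} (h : Con a b ∅ T) (A : Finset E) : SC a b ∅ T A := by
  intro I hI; have := h I hI; simp [cS] at this

/-- vanishing of `f1` on the deletion -/
lemma split_vanish {S T : Finset E} {e : E} (he : e ∉ S) {k l : ℕ} {f0 f1 : Finset E → K}
    (h0 : f0 ∈ Fl K S k) (h1 : f1 ∈ Fl K S l)
    (h : ∀ A, SC a b (insert e S) T A → (f0 + mon K {e} * f1) A = 0) :
    ∀ A, SC a b S T A → f1 A = 0 := by
  intro A hA
  have hne : ∀ f ∈ S, f ≠ e := fun f hf h => he (h ▸ hf)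
  have c1 : ∀ f ∈ S, f ∈ insert e A ↔ f ∈ A := fun f hf => by simp [hne f hf]
  have c2 : ∀ f ∈ S, f ∈ A.erase e ↔ f ∈ A := fun f hf => by simp [hne f hf]
  have e1 := h _ (SC_delete (e := e) (SC_congr (fun f hf => (c1 f hf).symm) hA))
  have e2 := h _ (SC_delete (e := e) (SC_congr (fun f hf => (c2 f hf).symm) hA))
  simp only [Pi.add_apply, Pi.mul_apply, Fl_congr h0 c1, Fl_congr h1 c1, Fl_congr h0 c2,
    Fl_congr h1 c2] at e1 e2
  simp [mon] at e1 e2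
  rw [e2, zero_add] at e1
  exact e1

/-- The ideal of strongly connected orientations is strictly generated. -/
theorem strict_gen (S : Finset E) : ∀ (T : Finset E), Con a b S T → ∀ (k : ℕ) (f : Finset E → K),
    f ∈ Fl K S k → (∀ A, SC a b S T A → f A = 0) → f ∈ Str a b K S T k := by
  induction S using Finset.induction_on with
  | empty =>
    intro T hc k f hf hv
    have : f = 0 := by
      funext A; exact hv A (SC_empty hc A)
    rw [this]; exact zero_mem _
  | insert e S he ih =>
    intro T hc k f hf hv
    by_cases hb : ∃ I, Adm a b T I ∧ cS a b (insert e S) I = 1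
    · obtain ⟨I, hI, h1⟩ := hb
      exact Submodule.subset_span ⟨I, k, f, hI, hf, by omega, by rw [sig_one h1, mul_one]⟩
    push Not at hb
    have hcd := Con_delete he hc hb
    rcases k with _ | k
    · rw [Fl_zero] at hf
      rw [(Submodule.mem_bot K).1 hf]; exact zero_mem _
    obtain ⟨f0, h0, f1, h1, rfl⟩ := Fl_split he hf
    have hv1 := split_vanish he h0 h1 hv
    obtain ⟨s, hs, r, hr, heq⟩ := Str_mul he (ih T hcd _ f1 h1 hv1)
    simp only [Nat.add_sub_cancel] at hs hr
    have h2 : f0 + r ∈ Str a b K S (insert e T) (k + 1) := by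
      refine ih _ (Con_contract hc) _ _ (add_mem h0 hr) ?_
      intro A hA
      obtain ⟨A', hAA, hA'⟩ := SC_lift he hcd hA
      rw [Fl_congr (add_mem h0 hr) hAA]
      have := hv A' hA'
      rw [heq] at this
      have hs0 := Str_vanish hs hA'
      simp only [Pi.add_apply, hs0] at this ⊢
      simpa using this
    rw [heq]
    have : f0 + (s + r) = s + (f0 + r) := by ring
    rw [this]
    exact add_mem hs (Str_contract h2)

end comb

section poly

variable {K : Type*} [Field K]

/-- induction principle for homogeneous polynomials -/
lemma hom_induct {σ : Type*} {motive : ℕ → MvPolynomial σ K → Prop}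
    (zero : ∀ m, motive m 0) (add : ∀ m p p', motive m p → motive m p' → motive m (p + p'))
    (const : ∀ c, motive 0 (C c)) (mulX : ∀ m i p, motive m p → motive (m + 1) (X i * p))
    (m : ℕ) (p : MvPolynomial σ K) (hp : p.IsHomogeneous m) : motive m p := by
  classical
  have key : ∀ m (s : σ →₀ ℕ) (c : K), s.degree = m → motive m (monomial s c) := by
    intro m
    induction m with
    | zero =>
      intro s c hs
      rw [Finsupp.degree_eq_zero_iff] at hs
      subst hs
      exact const c
    | succ m ih =>
      intro s c hs
      have hne : s ≠ 0 := by rintro rfl; simp at hs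
      obtain ⟨i, hi⟩ := Finsupp.ne_iff.1 hne
      simp at hi
      have hle : Finsupp.single i 1 ≤ s := by
        rw [Finsupp.single_le_iff]; omega
      have hd : (s - Finsupp.single i 1).degree = m := by
        have h1 : (s - Finsupp.single i 1) + Finsupp.single i 1 = s := tsub_add_cancel_of_le hle
        have h2 := congrArg Finsupp.degree h1
        rw [map_add, Finsupp.degree_single] at h2
        omega
      have := mulX m i _ (ih _ c hd)
      rw [X, monomial_mul, one_mul, add_tsub_cancel_of_le hle] at this
      exact this
  rw [p.as_sum]
  refine Finset.sum_induction _ (motive m) (add m) (zero m) ?_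
  intro s hs
  exact key m s _ (hp.degree_eq_sum_deg_support hs).symm

/-- polynomials of degree `< m` -/
def PL (σ : Type*) (K : Type*) [Field K] (m : ℕ) : Submodule K (MvPolynomial σ K) :=
  Submodule.span K {p | ∃ l, l < m ∧ p.IsHomogeneous l}

lemma PL_hom {σ : Type*} {l m : ℕ} {p : MvPolynomial σ K} (hp : p.IsHomogeneous l) (h : l < m) :
    p ∈ PL σ K m := Submodule.subset_span ⟨l, h, hp⟩

lemma PL_mono {σ : Type*} {l m : ℕ} (h : l ≤ m) : PL σ K l ≤ PL σ K m :=
  Submodule.span_mono fun _ ⟨k, hk, hp⟩ => ⟨k, by omega, hp⟩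

lemma PL_mul {σ : Type*} {l m : ℕ} {p r : MvPolynomial σ K} (hp : p.IsHomogeneous l)
    (hr : r ∈ PL σ K m) : p * r ∈ PL σ K (l + m) := by
  induction hr using Submodule.span_induction with
  | mem x hx =>
    obtain ⟨k, hk, hx⟩ := hx
    exact PL_hom (hp.mul hx) (by omega)
  | zero => simp
  | add x y _ _ hx hy => rw [mul_add]; exact add_mem hx hy
  | smul c x _ hx => rw [mul_smul_comm]; exact Submodule.smul_mem _ _ hx

lemma PL_prod {σ ι : Type*} [DecidableEq ι] (x : MvPolynomial σ K) (hx : x.IsHomogeneous 1)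
    (F : Finset ι) (γ : ι → K) :
    x ^ F.card - ∏ j ∈ F, (x - C (γ j)) ∈ PL σ K F.card := by
  induction F using Finset.induction_on with
  | empty => simp
  | insert i F hi ih =>
    rw [Finset.prod_insert hi, Finset.card_insert_of_notMem hi]
    set R := x ^ F.card - ∏ j ∈ F, (x - C (γ j)) with hR
    have hP : ∏ j ∈ F, (x - C (γ j)) = x ^ F.card - R := by rw [hR]; ring
    have : x ^ (F.card + 1) - (x - C (γ i)) * (x ^ F.card - R) =
      x * R + C (γ i) * x ^ F.card - C (γ i) * R := by ring
    rw [hP, this]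
    refine sub_mem (add_mem ?_ ?_) ?_
    · have := PL_mul hx ih; rwa [add_comm] at this
    · refine PL_hom ((isHomogeneous_C _ _).mul (hx.pow F.card)) (by omega)
    · exact PL_mono (by omega) (PL_mul (isHomogeneous_C σ (γ i)) ih)

variable {n : ℕ} {E : Type*} [DecidableEq E] (a b : E → Fin n)

/-- the linear form of a vertex subset -/
def xI (K : Type*) [Field K] (I : Finset (Fin n)) : MvPolynomial (Fin n) K := ∑ i ∈ I, X i

/-- the derivation of an edge -/
def De (K : Type*) [Field K] (e : E) :
    Derivation K (MvPolynomial (Fin n) K) (MvPolynomial (Fin n) K) :=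
  pderiv (a e) - pderiv (b e)

/-- coefficient of the edge at a vertex -/
def vc (K : Type*) [Field K] (e : E) (i : Fin n) : K :=
  (if a e = i then 1 else 0) - (if b e = i then 1 else 0)

/-- the score functions -/
def xfun (q : K) (S : Finset E) (i : Fin n) : Finset E → K :=
  q • ∑ e ∈ S, vc a b K e i • mon K {e}

/-- evaluation of polynomials at score functions -/
def phi (q : K) (S : Finset E) : MvPolynomial (Fin n) K →ₐ[K] (Finset E → K) :=
  aeval (xfun a b q S)

/-- contracted coordinates -/
def AT (K : Type*) [Field K] (T : Finset E) : Subalgebra K (MvPolynomial (Fin n) K) where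
  carrier := {p | ∀ f ∈ T, De a b K f p = 0}
  mul_mem' := by
    intro p p' hp hp' f hf
    simp [hp f hf, hp' f hf]
  add_mem' := by
    intro p p' hp hp' f hf
    simp [hp f hf, hp' f hf]
  algebraMap_mem' := by
    intro r f hf
    simp

/-- power ideal, graded piece -/
def JJ (K : Type*) [Field K] (S T : Finset E) (m : ℕ) : Submodule K (MvPolynomial (Fin n) K) :=
  Submodule.span K {h | ∃ (s : MvPolynomial (Fin n) K) (l k : ℕ) (I : Finset (Fin n)),
    s ∈ AT a b K T ∧ s.IsHomogeneous l ∧ l + k = m ∧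
    ((Adm a b T I ∧ cS a b S I ≤ k + 1) ∨ (I = Finset.univ ∧ k = 1)) ∧ h = s * xI K I ^ k}

variable {a b}

lemma xI_hom (I : Finset (Fin n)) : (xI K I).IsHomogeneous 1 :=
  IsHomogeneous.sum _ _ _ fun i _ => isHomogeneous_X K i

lemma De_X (e : E) (i : Fin n) : De a b K e (X i) = C (vc a b K e i) := by
  simp only [De, Derivation.sub_apply, pderiv_X, vc, Pi.single_apply, @eq_comm _ i]
  by_cases h1 : a e = i <;> by_cases h2 : b e = i <;> simp [h1, h2]

lemma De_xI (e : E) (I : Finset (Fin n)) : De a b K e (xI K I) =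
    C ((if a e ∈ I then 1 else 0) - (if b e ∈ I then 1 else 0)) := by
  rw [xI, map_sum]
  simp only [De_X, vc]
  rw [← map_sum, Finset.sum_sub_distrib]
  simp [Finset.sum_ite_eq]

lemma De_xI_nsep {e : E} {I : Finset (Fin n)} (h : ¬ Sep a b e I) : De a b K e (xI K I) = 0 := by
  have h := not_not.1 h
  rw [De_xI]; simp [h]

lemma De_xI_sep {e : E} {I : Finset (Fin n)} (h : Sep a b e I) :
    ∃ ε : K, ε ≠ 0 ∧ De a b K e (xI K I) = C ε := by
  refine ⟨_, ?_, De_xI e I⟩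
  by_cases h1 : a e ∈ I <;> by_cases h2 : b e ∈ I <;> simp_all [Sep]

lemma De_hom {e : E} {m : ℕ} {p : MvPolynomial (Fin n) K} (hp : p.IsHomogeneous m) :
    (De a b K e p).IsHomogeneous (m - 1) := hp.pderiv.sub hp.pderiv

lemma De_comm (e f : E) (p : MvPolynomial (Fin n) K) :
    De a b K e (De a b K f p) = De a b K f (De a b K e p) := by
  have : ⁅De a b K e, De a b K f⁆ = 0 := by
    apply MvPolynomial.derivation_ext
    intro i
    simp [Derivation.commutator_apply, De_X]
  have h := congrArg (fun D => D p) this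
  simp only [Derivation.commutator_apply, Derivation.zero_apply] at h
  exact sub_eq_zero.1 h

lemma pderiv_De (i : Fin n) (f : E) (p : MvPolynomial (Fin n) K) :
    De a b K f (pderiv i p) = pderiv i (De a b K f p) := by
  have : ⁅De a b K f,
      (pderiv i : Derivation K (MvPolynomial (Fin n) K) (MvPolynomial (Fin n) K))⁆ = 0 := by
    apply MvPolynomial.derivation_ext
    intro j
    simp [Derivation.commutator_apply, De_X, pderiv_X, Pi.single_apply, apply_ite]
  have h := congrArg (fun D => D p) this
  simp only [Derivation.commutator_apply, Derivation.zero_apply] at h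
  exact sub_eq_zero.1 h

lemma De_AT {T : Finset E} {e : E} {p : MvPolynomial (Fin n) K} (hp : p ∈ AT a b K T) :
    De a b K e p ∈ AT a b K T := by
  intro f hf
  rw [De_comm, hp f hf, map_zero]

lemma xI_AT {T : Finset E} {I : Finset (Fin n)} (h : ∀ f ∈ T, ¬ Sep a b f I) :
    xI K I ∈ AT a b K T := fun f hf => De_xI_nsep (h f hf)

lemma xfun_mem (q : K) (S : Finset E) (i : Fin n) : xfun a b q S i ∈ Fl K S 2 := by
  refine Submodule.smul_mem _ _ (Submodule.sum_mem _ fun e he => Submodule.smul_mem _ _ ?_)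
  exact mon_single_mem he

lemma xfun_insert (q : K) {S : Finset E} {e : E} (he : e ∉ S) (i : Fin n) :
    xfun a b q (insert e S) i = xfun a b q S i + mon K {e} * (fun _ => q * vc a b K e i) := by
  rw [xfun, xfun, Finset.sum_insert he, smul_add, add_comm]
  congr 1
  funext A
  simp; ring

lemma phi_mem (q : K) (S : Finset E) (m : ℕ) (p : MvPolynomial (Fin n) K)
    (hp : p.IsHomogeneous m) : phi a b q S p ∈ Fl K S (m + 1) := by
  refine hom_induct (motive := fun m p => phi a b q S p ∈ Fl K S (m + 1)) ?_ ?_ ?_ ?_ m p hp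
  · intro m; simp
  · intro m p p' h h'; rw [map_add]; exact add_mem h h'
  · intro c
    rw [← MvPolynomial.algebraMap_eq, AlgHom.commutes, Algebra.algebraMap_eq_smul_one]
    exact Submodule.smul_mem _ _ one_mem_Fl
  · intro m i p h
    rw [map_mul]
    refine Fl_mul (k := 2) (l := m + 1) ?_ h (by omega)
    rw [phi, aeval_X]
    exact xfun_mem q S i

lemma phi_PL (q : K) (S : Finset E) (m : ℕ) (p : MvPolynomial (Fin n) K)
    (hp : p ∈ PL (Fin n) K m) : phi a b q S p ∈ Fl K S m := by
  induction hp using Submodule.span_induction with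
  | mem x hx =>
    obtain ⟨l, hl, hx⟩ := hx
    exact Fl_mono le_rfl (by omega) (phi_mem q S l x hx)
  | zero => simp
  | add x y _ _ hx hy => rw [map_add]; exact add_mem hx hy
  | smul c x _ hx => rw [map_smul]; exact Submodule.smul_mem _ _ hx

lemma phi_De_mem (q : K) (S : Finset E) (e : E) (m : ℕ) (p : MvPolynomial (Fin n) K)
    (hp : p.IsHomogeneous m) : phi a b q S (De a b K e p) ∈ Fl K S m := by
  rcases m with _ | m
  · rw [← totalDegree_zero_iff_isHomogeneous, totalDegree_eq_zero_iff_eq_C] at hp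
    rw [hp]; simp
  · exact phi_mem q S m _ (De_hom hp)

lemma mon_idem (e : E) : mon K {e} * mon K {e} = mon K {e} := by
  rw [mon_mul, Finset.union_idempotent]

/-- first-order expansion along an edge -/
lemma phi_insert (q : K) {S : Finset E} {e : E} (he : e ∉ S) (m : ℕ)
    (p : MvPolynomial (Fin n) K) (hp : p.IsHomogeneous m) :
    ∃ ρ ∈ Fl K S (m - 1), phi a b q (insert e S) p =
      phi a b q S p + mon K {e} * (q • phi a b q S (De a b K e p) + ρ) := by
  suffices h : p.IsHomogeneous m ∧ ∃ ρ ∈ Fl K S (m - 1), phi a b q (insert e S) p =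
      phi a b q S p + mon K {e} * (q • phi a b q S (De a b K e p) + ρ) from h.2
  refine hom_induct (motive := fun m p => p.IsHomogeneous m ∧ ∃ ρ ∈ Fl K S (m - 1),
      phi a b q (insert e S) p =
      phi a b q S p + mon K {e} * (q • phi a b q S (De a b K e p) + ρ)) ?_ ?_ ?_ ?_ m p hp
  · intro m; exact ⟨isHomogeneous_zero _ _ _, 0, zero_mem _, by simp⟩
  · rintro m p p' ⟨hp, ρ, hρ, h⟩ ⟨hp', ρ', hρ', h'⟩
    refine ⟨hp.add hp', ρ + ρ', add_mem hρ hρ', ?_⟩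
    simp only [map_add, h, h', smul_add]; ring
  · intro c
    refine ⟨isHomogeneous_C _ _, 0, zero_mem _, ?_⟩
    simp [← MvPolynomial.algebraMap_eq]
  · rintro m i p ⟨hp, ρ, hρ, h⟩
    refine ⟨by rw [add_comm]; exact (isHomogeneous_X K i).mul hp, xfun a b q S i * ρ +
      (q * vc a b K e i) • (q • phi a b q S (De a b K e p) + ρ), ?_, ?_⟩
    · have hρ' : ρ ∈ Fl K S m := Fl_mono le_rfl (by omega) hρ
      refine add_mem ?_ (Submodule.smul_mem _ _ (add_mem (Submodule.smul_mem _ _ ?_) hρ'))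
      · rcases m with _ | m
        · simp only [Nat.zero_sub, Fl_zero, Submodule.mem_bot] at hρ; rw [hρ]; simp
        · exact Fl_mul (xfun_mem q S i) hρ (by omega)
      · exact phi_De_mem q S e m p hp
    · have hX : ∀ S : Finset E, phi a b q S (X i) = xfun a b q S i := fun S => by
        rw [phi, aeval_X]
      have hC : phi a b q S (C (vc a b K e i)) = fun _ => vc a b K e i := by
        rw [← MvPolynomial.algebraMap_eq, AlgHom.commutes]; rfl
      rw [map_mul, map_mul, h, hX, hX, xfun_insert q he, Derivation.leibniz, De_X, smul_eq_mul,
        smul_eq_mul, map_add, map_mul, map_mul, hX, hC]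
      funext A
      have hi := congrFun (mon_idem (K := K) e) A
      simp only [Pi.add_apply, Pi.mul_apply, Pi.smul_apply, smul_eq_mul] at hi ⊢
      linear_combination (q * vc a b K e i) * (q * phi a b q S (De a b K e p) A + ρ A) * hi

lemma phi_xI_apply (q : K) (S : Finset E) (I : Finset (Fin n)) (A : Finset E) :
    phi a b q S (xI K I) A = q * ∑ e ∈ S, (if e ∈ A then
      ((if a e ∈ I then 1 else 0) - (if b e ∈ I then 1 else 0)) else 0) := by
  rw [xI, map_sum, Finset.sum_apply]
  simp only [phi, aeval_X, xfun, Pi.smul_apply, Finset.sum_apply, smul_eq_mul, mon, vc]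
  rw [← Finset.mul_sum, Finset.sum_comm]
  congr 1
  refine Finset.sum_congr rfl fun e _ => ?_
  rw [← Finset.sum_mul, Finset.sum_sub_distrib]
  simp [Finset.sum_ite_eq]

lemma phi_xI_univ (q : K) (S : Finset E) : phi a b q S (xI K Finset.univ) = 0 := by
  funext A; rw [phi_xI_apply]; simp

lemma phi_xI_SC (q : K) {S T : Finset E} {I : Finset (Fin n)} (hI : Adm a b T I) {A : Finset E}
    (hA : SC a b S T A) : ∃ j ∈ Finset.Icc 1 (cS a b S I - 1), phi a b q S (xI K I) A =
      q * ((j : K) - ((S.filter fun e => Sep a b e I ∧ a e ∉ I).card : K)) := by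
  have hsub : (S.filter fun e => Sep a b e I ∧ (e ∈ A ↔ a e ∈ I)) ⊆ S.filter fun e => Sep a b e I := by
    intro x hx; simp only [Finset.mem_filter] at hx ⊢; tauto
  refine ⟨(S.filter fun e => Sep a b e I ∧ (e ∈ A ↔ a e ∈ I)).card, ?_, ?_⟩
  · rw [Finset.mem_Icc]
    constructor
    · rw [Nat.one_le_iff_ne_zero]
      intro h0
      rw [Finset.card_eq_zero] at h0
      refine hA _ hI.compl fun f hf hs => ?_
      have hs := sep_compl.1 hs
      have : f ∉ S.filter fun e => Sep a b e I ∧ (e ∈ A ↔ a e ∈ I) := by rw [h0]; simp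
      simp only [Finset.mem_filter, not_and] at this
      have := this hf hs
      simp only [Finset.mem_compl]; tauto
    · have : (S.filter fun e => Sep a b e I ∧ (e ∈ A ↔ a e ∈ I)).card < cS a b S I := by
        refine Finset.card_lt_card (Finset.ssubset_iff_subset_ne.2 ⟨hsub, fun h0 => ?_⟩)
        refine hA _ hI fun f hf hs => ?_
        have : f ∈ S.filter fun e => Sep a b e I ∧ (e ∈ A ↔ a e ∈ I) := by
          rw [h0]; exact Finset.mem_filter.2 ⟨hf, hs⟩
        exact (Finset.mem_filter.1 this).2.2
      omega
  · rw [phi_xI_apply, Finset.card_filter, Finset.card_filter]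
    push_cast
    rw [← Finset.sum_sub_distrib]
    congr 1
    refine Finset.sum_congr rfl fun e _ => ?_
    by_cases h1 : a e ∈ I <;> by_cases h2 : b e ∈ I <;> by_cases h3 : e ∈ A <;> simp [h1, h2, h3, Sep]

/-- leading forms -/
lemma JJ_lower (q : K) {S T : Finset E} (hc : Con a b S T) {m : ℕ} {j : MvPolynomial (Fin n) K}
    (hj : j ∈ JJ a b K S T m) : ∃ p' ∈ PL (Fin n) K m, ∀ A, SC a b S T A →
      phi a b q S j A = phi a b q S p' A := by
  induction hj using Submodule.span_induction with
  | mem x hx =>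
    obtain ⟨s, l, k, I, hs, hl, rfl, h, rfl⟩ := hx
    rcases h with ⟨hI, hk⟩ | ⟨rfl, rfl⟩
    · set c := cS a b S I with hcdef
      have hc1 : 1 ≤ c := hc I hI
      set N : K := ((S.filter fun e => Sep a b e I ∧ a e ∉ I).card : K)
      have hP := PL_prod (xI K I) (xI_hom I) (Finset.Icc 1 (c - 1)) (fun j => q * ((j : K) - N))
      set G := ∏ j ∈ Finset.Icc 1 (c - 1), (xI K I - C (q * ((j : K) - N))) with hG
      simp only [Nat.card_Icc, Nat.add_sub_cancel] at hP
      refine ⟨s * xI K I ^ (k + 1 - c) * (xI K I ^ (c - 1) - G), ?_, ?_⟩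
      · have := PL_mul (hl.mul ((xI_hom (K := K) I).pow (k + 1 - c))) hP
        refine PL_mono ?_ this
        omega
      · intro A hA
        have hG0 : phi a b q S G A = 0 := by
          obtain ⟨j, hj, hjx⟩ := phi_xI_SC q hI hA
          rw [hG, map_prod, Finset.prod_apply]
          refine Finset.prod_eq_zero hj ?_
          have hC : phi a b q S (C (q * ((j : K) - N))) = fun _ => q * ((j : K) - N) := by
            rw [← MvPolynomial.algebraMap_eq, AlgHom.commutes]; rfl
          rw [map_sub, hC, Pi.sub_apply, hjx, sub_self]
        have hpow : xI K I ^ k = xI K I ^ (k + 1 - c) * xI K I ^ (c - 1) := by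
          rw [← pow_add]; congr 1; omega
        rw [hpow]
        simp only [map_mul, map_sub, Pi.mul_apply, Pi.sub_apply, hG0]
        ring
    · refine ⟨0, zero_mem _, fun A _ => ?_⟩
      rw [pow_one, map_mul, phi_xI_univ]; simp
  | zero => exact ⟨0, zero_mem _, by simp⟩
  | add x y _ _ hx hy =>
    obtain ⟨p1, h1, hx⟩ := hx
    obtain ⟨p2, h2, hy⟩ := hy
    refine ⟨p1 + p2, add_mem h1 h2, fun A hA => ?_⟩
    simp [hx A hA, hy A hA]
  | smul c x _ hx =>
    obtain ⟨p1, h1, hx⟩ := hx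
    refine ⟨c • p1, Submodule.smul_mem _ _ h1, fun A hA => ?_⟩
    simp [hx A hA]

variable [CharZero K]

/-- integration by parts -/
lemma primitive {T : Finset E} {e : E} {I : Finset (Fin n)} (hI : ∀ f ∈ T, ¬ Sep a b f I)
    (hs : Sep a b e I) (l : ℕ) : ∀ (r : MvPolynomial (Fin n) K), r ∈ AT a b K T →
    r.IsHomogeneous l → ∀ k : ℕ, ∃ s ∈ AT a b K T, s.IsHomogeneous l ∧
      De a b K e (s * xI K I ^ (k + 1)) = r * xI K I ^ k := by
  obtain ⟨ε, hε, hD⟩ := De_xI_sep (K := K) hs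
  have main : ∀ (r : MvPolynomial (Fin n) K) (k : ℕ), De a b K e (r * xI K I ^ (k + 1)) =
      De a b K e r * xI K I ^ (k + 1) + C (((k : K) + 1) * ε) * (r * xI K I ^ k) := by
    intro r k
    rw [Derivation.leibniz, Derivation.leibniz_pow, hD]
    simp only [smul_eq_mul, nsmul_eq_mul, Nat.add_sub_cancel, map_mul, map_add, map_one]
    push_cast
    rw [show (C (k : K) : MvPolynomial (Fin n) K) = (k : MvPolynomial (Fin n) K) by simp]
    ring
  have hne : ∀ k : ℕ, ((k : K) + 1) * ε ≠ 0 := fun k => mul_ne_zero (Nat.cast_add_one_ne_zero k) hε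
  have hCC : ∀ k : ℕ, (C ((((k : K) + 1) * ε)⁻¹) * C (((k : K) + 1) * ε) :
      MvPolynomial (Fin n) K) = 1 := by
    intro k; rw [← C_mul, inv_mul_cancel₀ (hne k), C_1]
  induction l with
  | zero =>
    intro r hr hl k
    refine ⟨C ((((k : K) + 1) * ε)⁻¹) * r, ?_, hl.C_mul _, ?_⟩
    · exact mul_mem (Subalgebra.algebraMap_mem _ _) hr
    · have h0 : De a b K e r = 0 := by
        rw [← totalDegree_zero_iff_isHomogeneous, totalDegree_eq_zero_iff_eq_C] at hl
        rw [hl]; simp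
      rw [mul_assoc, ← MvPolynomial.smul_eq_C_mul, Derivation.map_smul, main, h0,
        MvPolynomial.smul_eq_C_mul]
      linear_combination (r * xI K I ^ k) * hCC k
  | succ l ih =>
    intro r hr hl k
    obtain ⟨s, hs1, hs2, hs3⟩ := ih _ (De_AT (e := e) hr) (De_hom hl) (k + 1)
    refine ⟨C ((((k : K) + 1) * ε)⁻¹) * (r - s * xI K I), ?_, ?_, ?_⟩
    · exact mul_mem (Subalgebra.algebraMap_mem _ _) (sub_mem hr (mul_mem hs1 (xI_AT hI)))
    · exact (hl.sub (hs2.mul (xI_hom I))).C_mul _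
    · have h1 : C ((((k : K) + 1) * ε)⁻¹) * (r - s * xI K I) * xI K I ^ (k + 1) =
        C ((((k : K) + 1) * ε)⁻¹) * (r * xI K I ^ (k + 1) - s * xI K I ^ (k + 1 + 1)) := by ring
      rw [h1, ← MvPolynomial.smul_eq_C_mul, Derivation.map_smul, Derivation.map_sub, main, hs3,
        MvPolynomial.smul_eq_C_mul]
      linear_combination (r * xI K I ^ k) * hCC k

lemma JJ_AT {S T : Finset E} {m : ℕ} {j : MvPolynomial (Fin n) K} (hj : j ∈ JJ a b K S T m) :
    j ∈ AT a b K T ∧ j.IsHomogeneous m := by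
  induction hj using Submodule.span_induction with
  | mem x hx =>
    obtain ⟨s, l, k, I, hs, hl, rfl, h, rfl⟩ := hx
    constructor
    · refine mul_mem hs (pow_mem (xI_AT ?_) _)
      rcases h with ⟨hI, _⟩ | ⟨rfl, _⟩
      · exact hI.2.2
      · intro f _; simp [Sep]
    · have := hl.mul ((xI_hom (K := K) I).pow k)
      rwa [one_mul] at this
  | zero => exact ⟨zero_mem _, isHomogeneous_zero _ _ _⟩
  | add x y _ _ hx hy => exact ⟨add_mem hx.1 hy.1, hx.2.add hy.2⟩
  | smul c x _ hx =>
    refine ⟨Subalgebra.smul_mem _ hx.1 c, ?_⟩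
    rw [MvPolynomial.smul_eq_C_mul]; exact hx.2.C_mul c

lemma JJ_contract {S T : Finset E} {e : E} {m : ℕ} :
    JJ a b K S (insert e T) m ≤ JJ a b K (insert e S) T m := by
  apply Submodule.span_mono
  rintro _ ⟨s, l, k, I, hs, hl, hm, h, rfl⟩
  refine ⟨s, l, k, I, fun f hf => hs f (by simp [hf]), hl, hm, ?_, rfl⟩
  rcases h with ⟨hI, hk⟩ | h
  · obtain ⟨hI, hs⟩ := hI.of_insert
    exact Or.inl ⟨hI, by rwa [cS_insert_nsep hs]⟩
  · exact Or.inr h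

/-- primitives of elements of the power ideal of the deletion -/
lemma JJ_primitive {S T : Finset E} {e : E} (he : e ∉ S) {I0 : Finset (Fin n)}
    (hI0 : Adm a b T I0) (hs0 : Sep a b e I0) {m : ℕ} {j : MvPolynomial (Fin n) K}
    (hj : j ∈ JJ a b K S T m) :
    ∃ j' ∈ JJ a b K (insert e S) T (m + 1), De a b K e j' = j := by
  induction hj using Submodule.span_induction with
  | mem x hx =>
    obtain ⟨s, l, k, I, hs, hl, rfl, h, rfl⟩ := hx
    by_cases hse : Sep a b e I
    · rcases h with ⟨hI, hk⟩ | ⟨rfl, _⟩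
      · obtain ⟨s', h1, h2, h3⟩ := primitive hI.2.2 hse l s hs hl k
        refine ⟨_, Submodule.subset_span ⟨s', l, k + 1, I, h1, h2, by omega, Or.inl ⟨hI, ?_⟩, rfl⟩,
          h3⟩
        rw [cS_insert_sep he hse]; omega
      · simp [Sep] at hse
    · obtain ⟨s', h1, h2, h3⟩ := primitive hI0.2.2 hs0 l s hs hl 0
      refine ⟨_, Submodule.subset_span ⟨s' * xI K I0, l + 1, k, I, mul_mem h1 (xI_AT hI0.2.2),
        h2.mul (xI_hom I0), by omega, ?_, rfl⟩, ?_⟩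
      · rcases h with ⟨hI, hk⟩ | h
        · exact Or.inl ⟨hI, by rwa [cS_insert_nsep hse]⟩
        · exact Or.inr h
      · rw [Derivation.leibniz, Derivation.leibniz_pow, De_xI_nsep hse]
        simp only [zero_add, pow_one, pow_zero, mul_one] at h3
        rw [h3]; simp [mul_comm]
  | zero => exact ⟨0, zero_mem _, by simp⟩
  | add x y _ _ hx hy =>
    obtain ⟨p1, h1, hx⟩ := hx
    obtain ⟨p2, h2, hy⟩ := hy
    exact ⟨p1 + p2, add_mem h1 h2, by rw [map_add, hx, hy]⟩
  | smul c x _ hx =>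
    obtain ⟨p1, h1, hx⟩ := hx
    exact ⟨c • p1, Submodule.smul_mem _ _ h1, by rw [Derivation.map_smul, hx]⟩

lemma De_loop {T : Finset E} {e : E} (h : ∀ I, Adm a b T I → ¬ Sep a b e I)
    {p : MvPolynomial (Fin n) K} (hp : p ∈ AT a b K T) : De a b K e p = 0 := by
  classical
  set I : Finset (Fin n) := Finset.univ.filter fun i => pderiv i p = pderiv (a e) p with hI
  have ha : a e ∈ I := by simp [hI]
  have hb : b e ∈ I := by
    by_cases hU : I = Finset.univ
    · rw [hU]; simp
    · have := h I ⟨⟨_, ha⟩, hU, ?_⟩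
      · simp only [Sep, not_not] at this; exact this.1 ha
      · intro f hf
        have := hp f hf
        simp only [De, Derivation.sub_apply, sub_eq_zero] at this
        simp [Sep, hI, this]
  simp only [hI, Finset.mem_filter, Finset.mem_univ, true_and] at hb
  simp [De, hb]

/-- The main algebraic statement: leading forms lie in the power ideal. -/
theorem main_claim (g : Fin n) (q : K) (hq : q ≠ 0) (S : Finset E) : ∀ (T : Finset E),
    Con a b S T → ∀ (m : ℕ) (p : MvPolynomial (Fin n) K), p ∈ AT a b K T → p.IsHomogeneous m →
    ∀ r ∈ Fl K S m, (∀ A, SC a b S T A → phi a b q S p A = r A) → p ∈ JJ a b K S T m := by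
  classical
  induction S using Finset.induction_on with
  | empty =>
    intro T hc m p hp hm r hr hv
    rcases m with _ | m
    · rw [Fl_zero, Submodule.mem_bot] at hr
      subst hr
      have h1 := hm
      rw [← totalDegree_zero_iff_isHomogeneous, totalDegree_eq_zero_iff_eq_C] at h1
      have h2 := hv ∅ (SC_empty hc ∅)
      rw [h1, ← MvPolynomial.algebraMap_eq, AlgHom.commutes] at h2
      have h3 : coeff 0 p = 0 := h2
      rw [h1, h3, C_0]; exact zero_mem _
    · have hall : ∀ i, pderiv i p = pderiv g p := by
        by_contra hcon
        push Not at hcon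
        obtain ⟨i, hi⟩ := hcon
        have hAdm : Adm a b T (Finset.univ.filter fun i => pderiv i p = pderiv g p) := by
          refine ⟨⟨g, by simp⟩, fun h => ?_, ?_⟩
          · have : i ∈ Finset.univ.filter fun i => pderiv i p = pderiv g p := by rw [h]; simp
            simp at this; exact hi this
          · intro f hf
            have := hp f hf
            simp only [De, Derivation.sub_apply, sub_eq_zero] at this
            simp [Sep, this]
        have := hc _ hAdm
        simp [cS] at this
      have heu := hm.sum_X_mul_pderiv
      simp only [hall] at heu
      rw [← Finset.sum_mul] at heu
      have hpe : p = ((m + 1 : ℕ) : K)⁻¹ • (pderiv g p * xI K Finset.univ ^ 1) := by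
        rw [pow_one, xI, mul_comm, heu, ← Nat.cast_smul_eq_nsmul K, smul_smul, inv_mul_cancel₀,
          one_smul]
        exact Nat.cast_ne_zero.2 (by omega)
      rw [hpe]
      refine Submodule.smul_mem _ _ (Submodule.subset_span ⟨pderiv g p, m, 1, Finset.univ, ?_,
        hm.pderiv, rfl, Or.inr ⟨rfl, rfl⟩, rfl⟩)
      intro f hf
      rw [pderiv_De, hp f hf, map_zero]
  | insert e S he ih =>
    intro T hc m p hp hm r hr hv
    by_cases hb : ∃ I, Adm a b T I ∧ cS a b (insert e S) I = 1
    · obtain ⟨I, hI, h1⟩ := hb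
      exact Submodule.subset_span ⟨p, m, 0, I, hp, hm, rfl, Or.inl ⟨hI, by omega⟩, by simp⟩
    push Not at hb
    have hcd := Con_delete he hc hb
    -- find `j`
    have hj : ∃ j ∈ JJ a b K (insert e S) T m, De a b K e j = De a b K e p := by
      by_cases hD : De a b K e p = 0
      · exact ⟨0, zero_mem _, by rw [hD, map_zero]⟩
      have hI0 : ∃ I0, Adm a b T I0 ∧ Sep a b e I0 := by
        by_contra hcon
        push Not at hcon
        exact hD (De_loop (fun I hI => not_not_intro (hcon I hI)) hp)
      obtain ⟨I0, hI0, hs0⟩ := hI0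
      rcases m with _ | m
      · exfalso; apply hD
        rw [← totalDegree_zero_iff_isHomogeneous, totalDegree_eq_zero_iff_eq_C] at hm
        rw [hm]; simp
      obtain ⟨ρ, hρ, hexp⟩ := phi_insert (a := a) (b := b) q he (m + 1) p hm
      obtain ⟨r0, hr0, r1, hr1, rfl⟩ := Fl_split he hr
      simp only [Nat.add_sub_cancel] at hρ hr1
      have hv1 := split_vanish (T := T) he (f0 := phi a b q S p - r0)
        (f1 := q • phi a b q S (De a b K e p) + ρ - r1) (k := m + 2) (l := m + 1)
        (sub_mem (phi_mem q S _ p hm) (Fl_mono le_rfl (by omega) hr0))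
        (sub_mem (add_mem (Submodule.smul_mem _ _ (phi_De_mem q S e _ p hm))
          (Fl_mono le_rfl (by omega) hρ)) (Fl_mono le_rfl (by omega) hr1)) (by
            intro A hA
            have := hv A hA
            rw [hexp] at this
            simp only [Pi.add_apply, Pi.sub_apply, Pi.mul_apply] at this ⊢
            linear_combination this)
      have hDJ : De a b K e p ∈ JJ a b K S T m := by
        refine ih T hcd m _ (De_AT hp) (De_hom hm) (q⁻¹ • (r1 - ρ))
          (Submodule.smul_mem _ _ (sub_mem hr1 hρ)) ?_
        intro A hA
        have := hv1 A hA
        simp only [Pi.add_apply, Pi.sub_apply, Pi.smul_apply, smul_eq_mul] at this ⊢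
        rw [eq_comm, inv_mul_eq_iff_eq_mul₀ hq]
        linear_combination -this
      exact JJ_primitive he hI0 hs0 hDJ
    obtain ⟨j, hjJ, hjD⟩ := hj
    obtain ⟨hjA, hjH⟩ := JJ_AT hjJ
    set p' := p - j with hp'
    have hpD : De a b K e p' = 0 := by rw [hp', map_sub, hjD, sub_self]
    have hpH : p'.IsHomogeneous m := hm.sub hjH
    have hpA : p' ∈ AT a b K (insert e T) := by
      intro f hf
      rcases Finset.mem_insert.1 hf with rfl | hf
      · exact hpD
      · rw [hp', map_sub, hp f hf, hjA f hf, sub_zero]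
    suffices h : p' ∈ JJ a b K (insert e S) T m by
      have : p = p' + j := by rw [hp']; ring
      rw [this]; exact add_mem h hjJ
    apply JJ_contract
    -- lower order terms
    obtain ⟨w, hw, hwv⟩ := JJ_lower q hc hjJ
    obtain ⟨ρ, hρ, hexp⟩ := phi_insert (a := a) (b := b) q he m p' hpH
    rw [hpD, map_zero, smul_zero, zero_add] at hexp
    obtain ⟨r0, hr0, r1, hr1, hreq⟩ := Fl_split he (sub_mem hr (phi_PL q _ _ w hw))
    have hv2 : ∀ A, SC a b (insert e S) T A →
        ((phi a b q S p' - r0) + mon K {e} * (ρ - r1)) A = 0 := by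
      intro A hA
      have h1 := hv A hA
      have h2 := hwv A hA
      have h3 := congrFun hreq A
      have h4 := congrFun hexp A
      rw [hp', map_sub, ← hp'] at h4
      simp only [Pi.add_apply, Pi.sub_apply, Pi.mul_apply] at h3 h4 ⊢
      linear_combination h1 - h2 + h3 - h4
    have hb0 : phi a b q S p' - r0 ∈ Fl K S (m + 1) :=
      sub_mem (phi_mem q S _ p' hpH) (Fl_mono le_rfl (by omega) hr0)
    have hv3 := split_vanish he hb0 (sub_mem hρ hr1) hv2
    rcases m with _ | m
    · refine ih _ (Con_contract hc) 0 _ hpA hpH r0 hr0 ?_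
      intro A hA
      obtain ⟨A', hAA, hA'⟩ := SC_lift he hcd hA
      have := hv2 A' hA'
      have h0 : ρ - r1 = 0 := by
        have := sub_mem hρ hr1
        simpa [Fl_zero] using this
      rw [h0, mul_zero, add_zero, ← Fl_congr hb0 hAA] at this
      exact sub_eq_zero.1 this
    · obtain ⟨s, hs, t, ht, heq⟩ := Str_mul he (strict_gen S T hcd _ _ (sub_mem hρ hr1) hv3)
      simp only [Nat.add_sub_cancel] at hs ht
      refine ih _ (Con_contract hc) (m + 1) _ hpA hpH (r0 - t) (sub_mem hr0 ht) ?_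
      intro A hA
      obtain ⟨A', hAA, hA'⟩ := SC_lift he hcd hA
      have h1 := hv2 A' hA'
      rw [heq] at h1
      have h2 := Str_vanish hs hA'
      have h3 := Fl_congr hb0 hAA
      have h4 := Fl_congr ht hAA
      simp only [Pi.add_apply, Pi.sub_apply] at h1 h2 h3 h4 ⊢
      linear_combination h1 - h2 + h3 + h4

end poly

section fin

variable {K : Type*} [Field K] {n : ℕ} {E : Type*} [Fintype E] [DecidableEq E] (a b : E → Fin n)

lemma con_of_connected (hconn : IsConnectedGraph a b) : Con a b (Finset.univ : Finset E) ∅ := by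
  rintro I ⟨⟨x, hx⟩, hI, -⟩
  obtain ⟨y, hy⟩ : ∃ y, y ∉ I := by
    by_contra! h
    exact hI (Finset.eq_univ_iff_forall.2 h)
  rw [cS, Nat.one_le_iff_ne_zero, ← Nat.pos_iff_ne_zero, Finset.card_pos]
  by_contra hne
  rw [Finset.not_nonempty_iff_eq_empty, Finset.filter_eq_empty_iff] at hne
  apply hy
  have h := hconn x y
  induction h with
  | refl => exact hx
  | tail _ h ih =>
    obtain ⟨e, ⟨rfl, rfl⟩ | ⟨rfl, rfl⟩⟩ := h
    · have := not_not.1 (hne (Finset.mem_univ e)); tauto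
    · have := not_not.1 (hne (Finset.mem_univ e)); tauto

/-- the linear forms -/
def lin (K : Type*) [Field K] (i : Fin n) : MvPolynomial E K :=
  (∑ e ∈ Finset.univ.filter fun e => a e = i, X e) -
      ∑ e ∈ Finset.univ.filter fun e => b e = i, X e

/-- substitution of the linear forms -/
def linMap (K : Type*) [Field K] : MvPolynomial (Fin n) K →ₐ[K] MvPolynomial E K := aeval (lin a b K)

/-- evaluation at the vertices of the cube -/
def ev (E : Type*) [Fintype E] [DecidableEq E] (q : K) : MvPolynomial E K →ₐ[K] (Finset E → K) :=
  aeval fun e => q • mon K {e}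

variable {a b}

lemma lin_eq (i : Fin n) : lin a b K i = ∑ e, C (vc a b K e i) * X e := by
  rw [lin, Finset.sum_filter, Finset.sum_filter, ← Finset.sum_sub_distrib]
  refine Finset.sum_congr rfl fun e _ => ?_
  simp only [vc]
  by_cases h1 : a e = i <;> by_cases h2 : b e = i <;> simp [h1, h2]

lemma lin_hom (i : Fin n) : (lin a b K i).IsHomogeneous 1 := by
  refine IsHomogeneous.sub ?_ ?_ <;>
  exact IsHomogeneous.sum _ _ _ fun e _ => isHomogeneous_X K e

lemma ev_lin (q : K) (i : Fin n) : ev E q (lin a b K i) = xfun a b q Finset.univ i := by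
  rw [lin_eq, map_sum, xfun, Finset.smul_sum]
  refine Finset.sum_congr rfl fun e _ => ?_
  rw [map_mul, ← MvPolynomial.algebraMap_eq, AlgHom.commutes, ev, aeval_X]
  funext A
  simp [Algebra.algebraMap_eq_smul_one]
  ring

lemma ev_linMap (q : K) (p : MvPolynomial (Fin n) K) :
    ev E q (linMap a b K p) = phi a b q Finset.univ p := by
  have : (ev E q).comp (linMap a b K) = phi a b q Finset.univ := by
    apply MvPolynomial.algHom_ext
    intro i
    simp [linMap, ev_lin, phi]
  rw [← this]; rfl

lemma linMap_hom {m : ℕ} {p : MvPolynomial (Fin n) K} (hp : p.IsHomogeneous m) :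
    (linMap a b K p).IsHomogeneous m := by
  have := hp.aeval (lin a b K) (fun i => lin_hom i)
  rw [one_mul] at this
  exact this

lemma ev_X_apply (q : K) (e : E) (A : Finset E) : ev E q (X e) A = if e ∈ A then q else 0 := by
  simp [ev, mon]

lemma ev_C (q c : K) : ev E q (C c) = c • 1 := by
  rw [← MvPolynomial.algebraMap_eq, AlgHom.commutes, Algebra.algebraMap_eq_smul_one]

lemma ev_fI (q : K) (I : Finset (Fin n)) (A : Finset E)
    (h : ¬ dI a b Finset.univ I A) : ev E q (fI a b (fun _ => q) I) A = 0 := by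
  simp only [dI, not_forall] at h
  obtain ⟨e, -, hs, h⟩ := h
  rw [fI, map_mul, Pi.mul_apply, map_prod, map_prod, Finset.prod_apply, Finset.prod_apply]
  by_cases ha : a e ∈ I
  · have hb : b e ∉ I := by simp only [Sep] at hs; tauto
    rw [Finset.prod_eq_zero (i := e), zero_mul]
    · simp [cutOut, ha, hb]
    · rw [ev_X_apply, if_neg (by tauto)]
  · have hb : b e ∈ I := by simp only [Sep] at hs; tauto
    rw [mul_comm, Finset.prod_eq_zero (i := e), zero_mul]
    · simp [cutIn, ha, hb]
    · rw [map_sub, Pi.sub_apply, ev_X_apply, if_pos (by tauto), ev_C]; simp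

lemma ev_rel (q : K) {p : MvPolynomial E K} (hp : p ∈ relIdealIn K E a b (fun _ => q))
    {A : Finset E} (hA : SC a b Finset.univ ∅ A) : ev E q p A = 0 := by
  induction hp using Submodule.span_induction with
  | mem x hx =>
    rcases hx with ⟨e, rfl⟩ | ⟨I, h1, h2, rfl⟩
    · simp only [map_sub, map_mul, map_pow, Pi.sub_apply, Pi.mul_apply, Pi.pow_apply, ev_X_apply,
        ev_C]
      by_cases h : e ∈ A <;> simp [h]; ring
    · exact ev_fI q I A (hA I ⟨h1, h2, by simp⟩)
  | zero => simp
  | add x y _ _ hx hy => rw [map_add, Pi.add_apply, hx, hy, add_zero]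
  | smul c x _ hx => rw [smul_eq_mul, map_mul, Pi.mul_apply, hx, mul_zero]

/-- idempotent of a vertex of the cube -/
def chi (q : K) (A : Finset E) : MvPolynomial E K :=
  (∏ e ∈ A, C q⁻¹ * X e) * ∏ e ∈ Finset.univ \ A, (1 - C q⁻¹ * X e)

lemma chi_sum (q : K) : ∑ A : Finset E, chi q A = 1 := by
  have := Finset.prod_add (fun e : E => (C q⁻¹ * X e : MvPolynomial E K))
    (fun e => 1 - C q⁻¹ * X e) Finset.univ
  rw [Finset.powerset_univ] at this
  simp only [chi]
  rw [← this]
  simp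

lemma chi_mul (q : K) (hq : q ≠ 0) (A : Finset E) (p : MvPolynomial E K) :
    p * chi q A - C (ev E q p A) * chi q A ∈ relIdealIn K E a b (fun _ => q) := by
  have hsq : ∀ e : E, (X e) ^ 2 - C q * X e ∈ relIdealIn K E a b (fun _ => q) := fun e =>
    Ideal.subset_span (Or.inl ⟨e, rfl⟩)
  have hCC : (C q * C q⁻¹ : MvPolynomial E K) = 1 := by rw [← C_mul, mul_inv_cancel₀ hq, C_1]
  induction p using MvPolynomial.induction_on with
  | C c => simp [ev_C]
  | add p p' h h' =>
    convert add_mem h h' using 1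
    rw [map_add, Pi.add_apply, C_add]; ring
  | mul_X p e h =>
    rw [map_mul, Pi.mul_apply, ev_X_apply]
    have h2 : X e * chi q A - C (if e ∈ A then q else 0) * chi q A ∈
        relIdealIn K E a b (fun _ => q) := by
      by_cases he : e ∈ A
      · rw [if_pos he, chi, ← Finset.mul_prod_erase A _ he]
        convert Ideal.mul_mem_left _ (C q⁻¹ * (∏ e ∈ A.erase e, C q⁻¹ * X e) *
          ∏ e ∈ Finset.univ \ A, (1 - C q⁻¹ * X e)) (hsq e) using 1
        ring
      · rw [if_neg he, chi, ← Finset.mul_prod_erase (Finset.univ \ A) _ (a := e) (by simp [he])]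
        convert Ideal.mul_mem_left _ (-C q⁻¹ * (∏ e ∈ A, C q⁻¹ * X e) *
          ∏ e ∈ (Finset.univ \ A).erase e, (1 - C q⁻¹ * X e)) (hsq e) using 1
        rw [C_0]
        linear_combination (- X e * (∏ e ∈ A, C q⁻¹ * X e) *
          ∏ e ∈ (Finset.univ \ A).erase e, (1 - C q⁻¹ * X e)) * hCC
    convert add_mem (Ideal.mul_mem_left _ (X e) h) (Ideal.mul_mem_left _ (C (ev E q p A)) h2) using 1
    rw [C_mul]; ring

lemma chi_rel (q : K) (hq : q ≠ 0) (A : Finset E) (hA : ¬ SC a b Finset.univ ∅ A) :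
    chi q A ∈ relIdealIn K E a b (fun _ => q) := by
  obtain ⟨I, hI, hd⟩ : ∃ I, Adm a b ∅ I ∧ dI a b Finset.univ I A := by
    by_contra! h
    exact hA h
  have h1 : fI a b (fun _ => q) I ∣ chi q A := by
    rw [fI, chi]
    apply mul_dvd_mul
    · refine dvd_trans (Finset.prod_dvd_prod_of_subset _ A _ ?_)
        (Finset.prod_dvd_prod_of_dvd _ _ fun e _ => Dvd.intro_left _ rfl)
      intro e he
      simp only [cutOut, Finset.mem_filter] at he
      exact (hd e (by simp) (by simp only [Sep]; tauto)).2 he.2.1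
    · refine dvd_trans (Finset.prod_dvd_prod_of_subset _ (Finset.univ \ A) _ ?_)
        (Finset.prod_dvd_prod_of_dvd _ _ fun e _ => ⟨- C q⁻¹, ?_⟩)
      · intro e he
        simp only [cutIn, Finset.mem_filter] at he
        have := (hd e (by simp) (by simp only [Sep]; tauto)).not.2 he.2.2
        simpa using this
      · have hCC : (C q * C q⁻¹ : MvPolynomial E K) = 1 := by rw [← C_mul, mul_inv_cancel₀ hq, C_1]
        linear_combination - hCC
  exact Ideal.mem_of_dvd _ h1 (Ideal.subset_span (Or.inr ⟨I, hI.1, hI.2.1, rfl⟩))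

lemma rel_iff (q : K) (hq : q ≠ 0) (p : MvPolynomial E K) :
    p ∈ relIdealIn K E a b (fun _ => q) ↔ ∀ A, SC a b Finset.univ ∅ A → ev E q p A = 0 := by
  refine ⟨fun hp A hA => ev_rel q hp hA, fun h => ?_⟩
  rw [← mul_one p, ← chi_sum q, Finset.mul_sum]
  refine Ideal.sum_mem _ fun A _ => ?_
  by_cases hA : SC a b Finset.univ ∅ A
  · have := chi_mul (a := a) (b := b) q hq A p
    rw [h A hA] at this
    simpa using this
  · exact Ideal.mul_mem_left _ _ (chi_rel q hq A hA)

lemma ev_mem (q : K) (m : ℕ) (p : MvPolynomial E K)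
    (hp : p.IsHomogeneous m) : ev E q p ∈ Fl K Finset.univ (m + 1) := by
  refine hom_induct (motive := fun m p => ev E q p ∈ Fl K Finset.univ (m + 1)) ?_ ?_ ?_ ?_ m p hp
  · intro m; simp
  · intro m p p' h h'; rw [map_add]; exact add_mem h h'
  · intro c
    rw [ev_C]; exact Submodule.smul_mem _ _ one_mem_Fl
  · intro m e p h
    rw [map_mul]
    refine Fl_mul (k := 2) ?_ h (by omega)
    rw [ev, aeval_X]
    exact Submodule.smul_mem _ _ (mon_single_mem (by simp))

lemma ev_PL (q : K) (m : ℕ) (p : MvPolynomial E K)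
    (hp : p ∈ PL E K m) : ev E q p ∈ Fl K Finset.univ m := by
  induction hp using Submodule.span_induction with
  | mem x hx =>
    obtain ⟨l, hl, hx⟩ := hx
    exact Fl_mono le_rfl (by omega) (ev_mem q l x hx)
  | zero => simp
  | add x y _ _ hx hy => rw [map_add]; exact add_mem hx hy
  | smul c x _ hx => rw [map_smul]; exact Submodule.smul_mem _ _ hx

lemma PL_eq {σ : Type*} (m : ℕ) : PL σ K (m + 1) = restrictTotalDegree σ K m := by
  apply le_antisymm
  · refine Submodule.span_le.2 ?_
    rintro p ⟨l, hl, hp⟩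
    rw [SetLike.mem_coe, mem_restrictTotalDegree]
    exact hp.totalDegree_le.trans (by omega)
  · intro p hp
    rw [mem_restrictTotalDegree] at hp
    rw [← sum_homogeneousComponent p]
    refine Submodule.sum_mem _ fun i hi => PL_hom (homogeneousComponent_isHomogeneous i p) ?_
    rw [Finset.mem_range] at hi; omega

lemma PL_zero {σ : Type*} : PL σ K 0 = ⊥ := by
  rw [PL, Submodule.span_eq_bot]; rintro p ⟨l, hl, _⟩; omega

lemma PL_comp {σ : Type*} {m : ℕ} {p : MvPolynomial σ K} (hp : p ∈ PL σ K m) :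
    homogeneousComponent m p = 0 := by
  rcases m with _ | m
  · rw [PL_zero, Submodule.mem_bot] at hp; rw [hp, map_zero]
  · rw [PL_eq, mem_restrictTotalDegree] at hp
    exact homogeneousComponent_eq_zero _ _ (by omega)

lemma PL_split {σ : Type*} {m : ℕ} {p : MvPolynomial σ K} (hp : p ∈ PL σ K (m + 1)) :
    p - homogeneousComponent m p ∈ PL σ K m := by
  induction hp using Submodule.span_induction with
  | mem x hx =>
    obtain ⟨l, hl, hx⟩ := hx
    rw [homogeneousComponent_of_mem hx]
    split_ifs with h
    · simp
    · rw [sub_zero]; exact PL_hom hx (by omega)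
  | zero => simp
  | add x y _ _ hx hy => rw [map_add, add_sub_add_comm]; exact add_mem hx hy
  | smul c x _ hx => rw [map_smul, ← smul_sub]; exact Submodule.smul_mem _ _ hx

lemma comp_hom {σ : Type*} {m : ℕ} {p : MvPolynomial σ K} (hp : p.IsHomogeneous m) :
    homogeneousComponent m p = p := by
  rw [homogeneousComponent_of_mem hp, if_pos rfl]

instance PL_finite {σ : Type*} [Finite σ] (m : ℕ) : Module.Finite K (PL σ K m) := by
  rcases m with _ | m
  · rw [PL_zero]; infer_instance
  · rw [PL_eq]; infer_instance

lemma finrank_map_aux {V W : Type*} [AddCommGroup V] [Module K V] [AddCommGroup W] [Module K W]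
    (f : V →ₗ[K] W) (N : Submodule K V) [Module.Finite K N] :
    Module.finrank K (N.map f) + Module.finrank K (N ⊓ LinearMap.ker f : Submodule K V) =
      Module.finrank K N := by
  have h := LinearMap.finrank_range_add_finrank_ker (f.domRestrict N)
  rw [LinearMap.range_domRestrict] at h
  rw [← h, LinearMap.ker_domRestrict, ← Submodule.map_comap_subtype,
    Submodule.finrank_map_subtype_eq]

/-- the dimension of the kernel only depends on the leading forms -/
lemma ker_rank {σ V : Type*} [Finite σ] [AddCommGroup V] [Module K V]
    (ρ : MvPolynomial σ K →ₗ[K] V) (L : ℕ → Submodule K (MvPolynomial σ K))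
    (hL : ∀ m, ∀ p ∈ L m, p.IsHomogeneous m)
    (h1 : ∀ m, ∀ p ∈ PL σ K (m + 1), ρ p = 0 → homogeneousComponent m p ∈ L m)
    (h2 : ∀ m, ∀ p ∈ L m, ∃ p' ∈ PL σ K m, ρ p = ρ p') (m : ℕ) :
    Module.finrank K (PL σ K m ⊓ LinearMap.ker ρ : Submodule K _) =
      ∑ i ∈ Finset.range m, Module.finrank K (L i) := by
  induction m with
  | zero => rw [PL_zero]; simp
  | succ m ih =>
    rw [Finset.sum_range_succ, ← ih]
    have : Module.Finite K (PL σ K (m + 1) ⊓ LinearMap.ker ρ : Submodule K _) :=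
      Submodule.finiteDimensional_inf_left _ _
    have e1 : PL σ K (m + 1) ⊓ LinearMap.ker ρ ⊓ LinearMap.ker (homogeneousComponent m) =
        PL σ K m ⊓ LinearMap.ker ρ := by
      ext p
      simp only [Submodule.mem_inf, LinearMap.mem_ker]
      constructor
      · rintro ⟨⟨hp, h⟩, h0⟩
        have := PL_split hp
        rw [h0, sub_zero] at this
        exact ⟨this, h⟩
      · rintro ⟨hp, h⟩
        exact ⟨⟨PL_mono (by omega) hp, h⟩, PL_comp hp⟩
    have e2 : (PL σ K (m + 1) ⊓ LinearMap.ker ρ).map (homogeneousComponent m) = L m := by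
      ext p
      rw [Submodule.mem_map]
      constructor
      · rintro ⟨p, ⟨hp, h⟩, rfl⟩
        exact h1 m p hp h
      · intro hp
        obtain ⟨p', hp', h⟩ := h2 m p hp
        refine ⟨p - p', ⟨sub_mem (PL_hom (hL m p hp) (by omega)) (PL_mono (by omega) hp'), ?_⟩, ?_⟩
        · rw [SetLike.mem_coe, LinearMap.mem_ker, map_sub, h, sub_self]
        · rw [map_sub, comp_hom (hL m p hp), PL_comp hp', sub_zero]
    rw [← finrank_map_aux (homogeneousComponent m) (PL σ K (m + 1) ⊓ LinearMap.ker ρ), e1, e2,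
      add_comm]

lemma map_rank {σ V W : Type*} [Finite σ] [AddCommGroup V] [Module K V] [AddCommGroup W]
    [Module K W]
    (ρ : MvPolynomial σ K →ₗ[K] V) (τ : MvPolynomial σ K →ₗ[K] W)
    (L : ℕ → Submodule K (MvPolynomial σ K))
    (hL : ∀ m, ∀ p ∈ L m, p.IsHomogeneous m)
    (h1 : ∀ m, ∀ p ∈ PL σ K (m + 1), ρ p = 0 → homogeneousComponent m p ∈ L m)
    (h2 : ∀ m, ∀ p ∈ L m, ∃ p' ∈ PL σ K m, ρ p = ρ p')
    (h3 : ∀ m, ∀ p ∈ PL σ K (m + 1), τ p = 0 → homogeneousComponent m p ∈ L m)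
    (h4 : ∀ m, ∀ p ∈ L m, ∃ p' ∈ PL σ K m, τ p = τ p') (m : ℕ) :
    Module.finrank K ((PL σ K m).map ρ) = Module.finrank K ((PL σ K m).map τ) := by
  have e1 := finrank_map_aux ρ (PL σ K m)
  have e2 := finrank_map_aux τ (PL σ K m)
  rw [ker_rank ρ L hL h1 h2] at e1
  rw [ker_rank τ L hL h3 h4] at e2
  omega

end fin

section nil

lemma add_pow_sq_zero {R : Type*} [CommRing R] (y x : R) (hy : y ^ 2 = 0) (k : ℕ) :
    (y + x) ^ (k + 1) = x ^ (k + 1) + (k + 1) * (y * x ^ k) := by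
  induction k with
  | zero => simp; ring
  | succ k ih =>
    rw [pow_succ, ih]
    push_cast
    linear_combination ((k : R) + 1) * x ^ k * hy

lemma nil_pow {R ι : Type*} [CommRing R] [DecidableEq ι] (ψ : ι → R) (h : ∀ e, ψ e ^ 2 = 0)
    (F : Finset ι) : (∑ e ∈ F, ψ e) ^ F.card = (F.card.factorial : R) * ∏ e ∈ F, ψ e ∧
      (∑ e ∈ F, ψ e) ^ (F.card + 1) = 0 ∧
      ∀ k, F.card = k + 1 → (∑ e ∈ F, ψ e) ^ k =
        (k.factorial : R) * ∑ e' ∈ F, ∏ e ∈ F.erase e', ψ e := by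
  induction F using Finset.induction_on with
  | empty => simp
  | insert i F hi ih =>
    obtain ⟨h1, h2, h3⟩ := ih
    have hsum : ∑ e' ∈ insert i F, ∏ e ∈ (insert i F).erase e', ψ e =
        ∏ e ∈ F, ψ e + ψ i * ∑ e' ∈ F, ∏ e ∈ F.erase e', ψ e := by
      rw [Finset.sum_insert hi, Finset.erase_insert hi, Finset.mul_sum]
      congr 1
      refine Finset.sum_congr rfl fun e' he' => ?_
      rw [Finset.erase_insert_of_ne (by rintro rfl; exact hi he'), Finset.prod_insert]
      simp [hi]
    rw [Finset.sum_insert hi, Finset.prod_insert hi, Finset.card_insert_of_notMem hi]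
    refine ⟨?_, ?_, ?_⟩
    · rw [add_pow_sq_zero _ _ (h i), h2, h1, Nat.factorial_succ]
      push_cast; ring
    · rw [add_pow_sq_zero _ _ (h i), pow_succ, h2]; ring
    · intro k hk
      obtain rfl : F.card = k := by omega
      rw [hsum]
      rcases hc : F.card with _ | c
      · rw [Finset.card_eq_zero] at hc
        subst hc; simp
      · rw [add_pow_sq_zero _ _ (h i), ← hc, h1, h3 c hc, hc, Nat.factorial_succ]
        push_cast; ring

end nil

section zero

variable {K : Type*} [Field K] {n : ℕ} {E : Type*} [Fintype E] [DecidableEq E] {a b : E → Fin n}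

/-- sign of an edge in a cut -/
def sg (a b : E → Fin n) (K : Type*) [Field K] (I : Finset (Fin n)) (e : E) : K :=
  (if a e ∈ I then 1 else 0) - (if b e ∈ I then 1 else 0)

lemma sum_vc (I : Finset (Fin n)) (e : E) : ∑ i ∈ I, vc a b K e i = sg a b K I e := by
  simp only [vc, sg]
  rw [Finset.sum_sub_distrib]
  simp [Finset.sum_ite_eq]

lemma linMap_xI (I : Finset (Fin n)) :
    linMap a b K (xI K I) = ∑ e, C (sg a b K I e) * X e := by
  rw [xI, map_sum]
  simp only [linMap, aeval_X, lin_eq]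
  rw [Finset.sum_comm]
  refine Finset.sum_congr rfl fun e _ => ?_
  rw [← Finset.sum_mul, ← map_sum, sum_vc]

lemma cut_eq (I : Finset (Fin n)) : cutOut a b I ∪ cutIn a b I =
    Finset.univ.filter fun e => Sep a b e I := by
  ext e; simp [cutOut, cutIn, Sep]; tauto

lemma linMap_xI_cut (I : Finset (Fin n)) :
    linMap a b K (xI K I) = ∑ e ∈ cutOut a b I ∪ cutIn a b I, C (sg a b K I e) * X e := by
  rw [linMap_xI, cut_eq, Finset.sum_filter]
  refine Finset.sum_congr rfl fun e _ => ?_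
  split_ifs with h
  · rfl
  · have h := not_not.1 h
    simp [sg, h]

lemma sg_sq {I : Finset (Fin n)} {e : E} (h : e ∈ cutOut a b I ∪ cutIn a b I) :
    sg a b K I e * sg a b K I e = 1 := by
  rw [cut_eq, Finset.mem_filter] at h
  have h := h.2
  by_cases h1 : a e ∈ I <;> by_cases h2 : b e ∈ I <;> simp_all [Sep, sg]

/-- ideal of squares -/
def sqI (K : Type*) [Field K] (E : Type*) : Ideal (MvPolynomial E K) :=
  Ideal.span (Set.range fun e : E => (X e : MvPolynomial E K) ^ 2)

lemma gI_eq (I : Finset (Fin n)) : gI K a b I = ∑ e' ∈ cutOut a b I ∪ cutIn a b I,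
    C (sg a b K I e') * ∏ e ∈ (cutOut a b I ∪ cutIn a b I).erase e', X e := by
  rw [gI, Finset.sum_union, sub_eq_add_neg, ← Finset.sum_neg_distrib]
  · congr 1
    · refine Finset.sum_congr rfl fun e he => ?_
      simp only [cutOut, Finset.mem_filter] at he
      simp [sg, he.2.1, he.2.2]
    · refine Finset.sum_congr rfl fun e he => ?_
      simp only [cutIn, Finset.mem_filter] at he
      simp [sg, he.2.1, he.2.2]
  · rw [Finset.disjoint_left]
    intro e he he'
    simp only [cutOut, cutIn, Finset.mem_filter] at he he'
    tauto

/-- the product of all signs -/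
def sgp (a b : E → Fin n) (K : Type*) [Field K] (I : Finset (Fin n)) : K :=
  ∏ e ∈ cutOut a b I ∪ cutIn a b I, sg a b K I e

lemma sgp_ne (I : Finset (Fin n)) : sgp a b K I ≠ 0 := by
  refine Finset.prod_ne_zero_iff.2 fun e he h => ?_
  have := sg_sq (K := K) he
  rw [h] at this; simp at this

/-- powers of the cut form modulo squares -/
lemma xI_pow_gI (I : Finset (Fin n)) (k : ℕ) (hk : cS a b Finset.univ I = k + 1) :
    linMap a b K (xI K I) ^ k - C ((k.factorial : K) * sgp a b K I) * gI K a b I ∈ sqI K E := by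
  rw [← Ideal.Quotient.eq]
  set F := cutOut a b I ∪ cutIn a b I with hF
  have hc : F.card = k + 1 := by rw [hF, cut_eq, ← hk]; rfl
  have hsq : ∀ e : E, (Ideal.Quotient.mk (sqI K E) (C (sg a b K I e) * X e)) ^ 2 = 0 := by
    intro e
    rw [← map_pow, Ideal.Quotient.eq_zero_iff_mem, mul_pow]
    exact Ideal.mul_mem_left _ _ (Ideal.subset_span ⟨e, rfl⟩)
  have h := (nil_pow _ hsq F).2.2 k hc
  rw [linMap_xI_cut, map_pow, map_sum, h, C_mul, gI_eq, ← hF]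
  simp only [← map_prod, ← map_sum]
  rw [← map_natCast (Ideal.Quotient.mk (sqI K E)), ← map_mul, mul_assoc]
  congr 2
  rw [Finset.mul_sum]
  refine Finset.sum_congr rfl fun e' he' => ?_
  rw [Finset.prod_mul_distrib, ← mul_assoc, ← C_mul, ← map_prod]
  congr 2
  rw [sgp, ← hF, ← Finset.mul_prod_erase F _ he', mul_comm (sg a b K I e'), mul_assoc,
      sg_sq he', mul_one]

lemma linMap_xI_univ : linMap a b K (xI K Finset.univ) = 0 := by
  rw [linMap_xI]; simp [sg]

lemma linMap_xI_compl (I : Finset (Fin n)) :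
    linMap a b K (xI K I) = - linMap a b K (xI K Iᶜ) := by
  have : xI K I + xI K Iᶜ = xI K (Finset.univ : Finset (Fin n)) :=
    Finset.sum_add_sum_compl I _
  rw [eq_neg_iff_add_eq_zero, ← map_add, this, linMap_xI_univ]

lemma sqI_le (g : Fin n) : sqI K E ≤ relIdealIn0 K E a b g :=
  Ideal.span_mono Set.subset_union_left

lemma xI_pow_rel (g : Fin n) (I : Finset (Fin n)) (k : ℕ)
    (hk1 : 1 ≤ cS a b Finset.univ I) (hk : cS a b Finset.univ I ≤ k + 1) :
    linMap a b K (xI K I) ^ k ∈ relIdealIn0 K E a b g := by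
  obtain ⟨c, hc⟩ : ∃ c, cS a b Finset.univ I = c + 1 := ⟨_, (Nat.sub_add_cancel hk1).symm⟩
  refine Ideal.mem_of_dvd _ (pow_dvd_pow _ (by omega : c ≤ k)) ?_
  by_cases hg : g ∈ I
  · have h := sqI_le (a := a) (b := b) g (xI_pow_gI (K := K) I c hc)
    have h2 : gI K a b I ∈ relIdealIn0 K E a b g := Ideal.subset_span (Or.inr ⟨I, hg, rfl⟩)
    have := add_mem h (Ideal.mul_mem_left _ (C ((c.factorial : K) * sgp a b K I)) h2)
    rwa [sub_add_cancel] at this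
  · have hc' : cS a b Finset.univ Iᶜ = c + 1 := by rw [cS_compl, hc]
    have h := sqI_le (a := a) (b := b) g (xI_pow_gI (K := K) Iᶜ c hc')
    have h2 : gI K a b Iᶜ ∈ relIdealIn0 K E a b g :=
      Ideal.subset_span (Or.inr ⟨Iᶜ, by simpa using hg, rfl⟩)
    have := add_mem h (Ideal.mul_mem_left _ (C ((c.factorial : K) * sgp a b K Iᶜ)) h2)
    rw [sub_add_cancel] at this
    rw [linMap_xI_compl, neg_pow]
    exact Ideal.mul_mem_left _ _ this

lemma JJ_rel (g : Fin n) (hc : Con a b (Finset.univ : Finset E) ∅) {m : ℕ}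
    {j : MvPolynomial (Fin n) K} (hj : j ∈ JJ a b K Finset.univ ∅ m) :
    linMap a b K j ∈ relIdealIn0 K E a b g := by
  induction hj using Submodule.span_induction with
  | mem x hx =>
    obtain ⟨s, l, k, I, hs, hl, rfl, h, rfl⟩ := hx
    rw [map_mul, map_pow]
    refine Ideal.mul_mem_left _ _ ?_
    rcases h with ⟨hI, hk⟩ | ⟨rfl, rfl⟩
    · exact xI_pow_rel g I k (hc I hI) hk
    · rw [linMap_xI_univ]; simp
  | zero => simp
  | add x y _ _ hx hy => rw [map_add]; exact add_mem hx hy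
  | smul c x _ hx =>
    rw [map_smul, MvPolynomial.smul_eq_C_mul]; exact Ideal.mul_mem_left _ _ hx

/-- leading forms drop degree on strongly connected orientations -/
def Drop (a b : E → Fin n) (q : K) (P : MvPolynomial E K) : Prop :=
  ∀ m, ∃ r ∈ Fl K Finset.univ m, ∀ A, SC a b Finset.univ ∅ A →
    ev E q (homogeneousComponent m P) A = r A

lemma Drop.add {q : K} {P P' : MvPolynomial E K} (h : Drop a b q P) (h' : Drop a b q P') :
    Drop a b q (P + P') := by
  intro m
  obtain ⟨r, hr, h⟩ := h m
  obtain ⟨r', hr', h'⟩ := h' m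
  refine ⟨r + r', add_mem hr hr', fun A hA => ?_⟩
  rw [map_add, map_add, Pi.add_apply, Pi.add_apply, h A hA, h' A hA]

lemma Drop.smul {q : K} {P : MvPolynomial E K} (h : Drop a b q P) (c : K) :
    Drop a b q (C c * P) := by
  intro m
  obtain ⟨r, hr, h⟩ := h m
  refine ⟨c • r, Submodule.smul_mem _ _ hr, fun A hA => ?_⟩
  rw [← smul_eq_C_mul, map_smul, map_smul, Pi.smul_apply, Pi.smul_apply, h A hA]

lemma Drop.zero {q : K} : Drop a b q (0 : MvPolynomial E K) := fun m =>
  ⟨0, zero_mem _, fun A _ => by simp⟩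

lemma comp_mul_X (P : MvPolynomial E K) (e : E) (m : ℕ) :
    homogeneousComponent (m + 1) (P * X e) = homogeneousComponent m P * X e := by
  conv_lhs => rw [← sum_homogeneousComponent P, Finset.sum_mul, map_sum]
  have : ∀ i, homogeneousComponent (m + 1) (homogeneousComponent i P * X e) =
      if i = m then homogeneousComponent i P * X e else 0 := by
    intro i
    rw [homogeneousComponent_of_mem ((homogeneousComponent_isHomogeneous i P).mul
      (isHomogeneous_X K e))]
    simp [eq_comm]
  simp only [this, Finset.sum_ite_eq', Finset.mem_range]
  split_ifs with h
  · rfl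
  · rw [homogeneousComponent_eq_zero _ _ (by omega), zero_mul]

lemma comp_mul_X_zero (P : MvPolynomial E K) (e : E) :
    homogeneousComponent 0 (P * X e) = 0 := by
  rw [homogeneousComponent_zero, coeff_mul_X']; simp

lemma Drop.mulX {q : K} {P : MvPolynomial E K} (h : Drop a b q P) (e : E) :
    Drop a b q (P * X e) := by
  intro m
  rcases m with _ | m
  · rw [comp_mul_X_zero]
    exact ⟨0, zero_mem _, fun A _ => by simp⟩
  · obtain ⟨r, hr, h⟩ := h m
    refine ⟨r * ev E q (X e), Fl_mul hr (ev_mem q 1 _ (isHomogeneous_X K e)) (by omega),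
      fun A hA => ?_⟩
    rw [comp_mul_X, map_mul, Pi.mul_apply, Pi.mul_apply, h A hA]

lemma Drop.mul {q : K} {P : MvPolynomial E K} (h : Drop a b q P) (s : MvPolynomial E K) :
    Drop a b q (s * P) := by
  induction s using MvPolynomial.induction_on with
  | C c => exact h.smul c
  | add s s' hs hs' => rw [add_mul]; exact hs.add hs'
  | mul_X s e hs => rw [mul_right_comm]; exact hs.mulX e

lemma Drop.of_hom {q : K} {P : MvPolynomial E K} {m : ℕ} (hP : P.IsHomogeneous m)
    (h : ∃ r ∈ Fl K Finset.univ m, ∀ A, SC a b Finset.univ ∅ A → ev E q P A = r A) :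
    Drop a b q P := by
  intro k
  rw [homogeneousComponent_of_mem hP]
  split_ifs with hk
  · subst hk; exact h
  · exact ⟨0, zero_mem _, fun A _ => by simp⟩

lemma Drop.span {q : K} {s : Set (MvPolynomial E K)} (h : ∀ P ∈ s, Drop a b q P)
    {P : MvPolynomial E K} (hP : P ∈ Ideal.span s) : Drop a b q P := by
  induction hP using Submodule.span_induction with
  | mem x hx => exact h x hx
  | zero => exact Drop.zero
  | add x y _ _ hx hy => exact hx.add hy
  | smul c x _ hx => exact hx.mul c

lemma Drop.sqI {q : K} {P : MvPolynomial E K} (hP : P ∈ sqI K E) : Drop a b q P := by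
  refine Drop.span ?_ hP
  rintro _ ⟨e, rfl⟩
  refine Drop.of_hom ((isHomogeneous_X K e).pow 2) ⟨q • ev E q (X e),
    Submodule.smul_mem _ _ (ev_mem q 1 _ (isHomogeneous_X K e)), fun A _ => ?_⟩
  rw [map_pow, Pi.pow_apply, Pi.smul_apply, ev_X_apply]
  split_ifs <;> simp [pow_two]

lemma Drop.rel0 [CharZero K] {q : K} (g : Fin n) (hc : Con a b (Finset.univ : Finset E) ∅)
    {P : MvPolynomial E K} (hP : P ∈ relIdealIn0 K E a b g) : Drop a b q P := by
  refine Drop.span ?_ hP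
  rintro _ (⟨e, rfl⟩ | ⟨I, hg, rfl⟩)
  · exact Drop.sqI (Ideal.subset_span ⟨e, rfl⟩)
  · by_cases hU : I = Finset.univ
    · subst hU
      have : gI K a b Finset.univ = 0 := by simp [gI, cutOut, cutIn]
      rw [this]; exact Drop.zero
    have hI : Adm a b ∅ I := ⟨⟨g, hg⟩, hU, by simp⟩
    obtain ⟨c, hcc⟩ : ∃ c, cS a b Finset.univ I = c + 1 :=
      ⟨_, (Nat.sub_add_cancel (hc I hI)).symm⟩
    have h1 := xI_pow_gI (K := K) I c hcc
    set γ : K := (c.factorial : K) * sgp a b K I with hγ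
    have hγ0 : γ ≠ 0 := mul_ne_zero (by exact_mod_cast c.factorial_ne_zero) (sgp_ne I)
    have h2 : Drop a b q (linMap a b K (xI K I) ^ c) := by
      rw [← map_pow]
      have hh : (xI K I ^ c).IsHomogeneous c := by simpa using (xI_hom (K := K) I).pow c
      refine Drop.of_hom (linMap_hom hh) ?_
      have hj : xI K I ^ c ∈ JJ a b K (Finset.univ : Finset E) ∅ c := by
        refine Submodule.subset_span ⟨1, 0, c, I, one_mem _, isHomogeneous_one _ _, by simp,
          Or.inl ⟨hI, by omega⟩, by simp⟩
      obtain ⟨p', hp', h⟩ := JJ_lower q hc hj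
      refine ⟨_, phi_PL (a := a) (b := b) q Finset.univ c p' hp', fun A hA => ?_⟩
      rw [ev_linMap, h A hA]
    have h3 := (h2.add ((Drop.sqI h1).smul (-1))).smul γ⁻¹
    convert h3 using 1
    have : (C γ⁻¹ * C γ : MvPolynomial E K) = 1 := by rw [← C_mul, inv_mul_cancel₀ hγ0, C_1]
    rw [C_neg, C_1]
    linear_combination (- gI K a b I) * this

lemma linMap_comp (p : MvPolynomial (Fin n) K) (m : ℕ) :
    homogeneousComponent m (linMap a b K p) = linMap a b K (homogeneousComponent m p) := by
  conv_lhs => rw [← sum_homogeneousComponent p, map_sum, map_sum]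
  have : ∀ i, homogeneousComponent m (linMap a b K (homogeneousComponent i p)) =
      if i = m then linMap a b K (homogeneousComponent i p) else 0 := by
    intro i
    rw [homogeneousComponent_of_mem (linMap_hom (homogeneousComponent_isHomogeneous i p))]
    simp [eq_comm]
  simp only [this, Finset.sum_ite_eq', Finset.mem_range]
  split_ifs with h
  · rfl
  · rw [homogeneousComponent_eq_zero _ _ (by omega), map_zero]

lemma AT_empty (p : MvPolynomial (Fin n) K) : p ∈ AT a b K (∅ : Finset E) := fun f hf => by
  simp at hf

lemma alpha0 [CharZero K] (g : Fin n) (hc : Con a b (Finset.univ : Finset E) ∅)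
    (m : ℕ) (p : MvPolynomial (Fin n) K) (h : linMap a b K p ∈ relIdealIn0 K E a b g) :
    homogeneousComponent m p ∈ JJ a b K (Finset.univ : Finset E) ∅ m := by
  obtain ⟨r, hr, h⟩ := Drop.rel0 (q := 1) g hc h m
  refine main_claim g 1 one_ne_zero Finset.univ ∅ hc m _ (AT_empty _)
    (homogeneousComponent_isHomogeneous m p) r hr fun A hA => ?_
  rw [← h A hA, linMap_comp, ev_linMap]

lemma alphaq [CharZero K] (g : Fin n) (q : K) (hq : q ≠ 0)
    (hc : Con a b (Finset.univ : Finset E) ∅)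
    (m : ℕ) (p : MvPolynomial (Fin n) K) (hp : p ∈ PL (Fin n) K (m + 1)) (P : MvPolynomial E K)
    (hP : P ∈ PL E K m)
    (h : linMap a b K p - P ∈ relIdealIn K E a b (fun _ => q)) :
    homogeneousComponent m p ∈ JJ a b K (Finset.univ : Finset E) ∅ m := by
  rw [rel_iff q hq] at h
  refine main_claim g q hq Finset.univ ∅ hc m _ (AT_empty _)
    (homogeneousComponent_isHomogeneous m p)
    (ev E q P - phi a b q Finset.univ (p - homogeneousComponent m p))
    (sub_mem (ev_PL q m P hP) (phi_PL q _ m _ (PL_split hp))) fun A hA => ?_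
  have := h A hA
  rw [map_sub, ev_linMap] at this
  rw [map_sub]
  simp only [Pi.sub_apply] at this ⊢
  linear_combination this

lemma betaq (q : K) (hq : q ≠ 0) (hc : Con a b (Finset.univ : Finset E) ∅)
    (m : ℕ) (p : MvPolynomial (Fin n) K) (hp : p ∈ JJ a b K (Finset.univ : Finset E) ∅ m) :
    ∃ p' ∈ PL (Fin n) K m, linMap a b K p - linMap a b K p' ∈ relIdealIn K E a b (fun _ => q) := by
  obtain ⟨p', hp', h⟩ := JJ_lower q hc hp
  refine ⟨p', hp', ?_⟩
  rw [rel_iff q hq]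
  intro A hA
  rw [map_sub, ev_linMap, ev_linMap, Pi.sub_apply, h A hA, sub_self]

lemma span_eq_map {R : Type*} [CommRing R] [Algebra K R] (y : Fin n → R) (k : ℕ) :
    Submodule.span K {z | ∃ α : Fin n → ℕ, (∑ i, α i) ≤ k ∧ z = ∏ i, (y i) ^ (α i)} =
      (PL (Fin n) K (k + 1)).map (aeval y).toLinearMap := by
  apply le_antisymm
  · refine Submodule.span_le.2 ?_
    rintro _ ⟨α, hα, rfl⟩
    refine ⟨∏ i, X i ^ α i, ?_, by simp⟩
    refine PL_hom (l := ∑ i, α i) ?_ (by omega)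
    refine IsHomogeneous.prod _ _ _ fun i _ => ?_
    simpa using (isHomogeneous_X K i).pow (α i)
  · rintro _ ⟨p, hp, rfl⟩
    rw [PL_eq, SetLike.mem_coe, mem_restrictTotalDegree] at hp
    rw [p.as_sum, map_sum]
    refine Submodule.sum_mem _ fun s hs => ?_
    rw [AlgHom.toLinearMap_apply, aeval_monomial, ← Algebra.smul_def]
    refine Submodule.smul_mem _ _ (Submodule.subset_span ⟨s, ?_, ?_⟩)
    · have := (le_totalDegree hs).trans hp
      rwa [Finsupp.sum_fintype _ _ (by simp)] at this
    · rw [Finsupp.prod_fintype _ _ (by simp)]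

end zero

section final

variable {K : Type*} [Field K] [CharZero K] {n : ℕ} {E : Type*} [Fintype E] [DecidableEq E]
  {a b : E → Fin n}

lemma descend (g : Fin n) (q : K) (hq : q ≠ 0)
    (hc : Con a b (Finset.univ : Finset E) ∅) (k : ℕ) (P : MvPolynomial E K)
    (hP : P ∈ PL E K (k + 1)) (m : ℕ) : ∀ p ∈ PL (Fin n) K m,
    linMap a b K p - P ∈ relIdealIn K E a b (fun _ => q) →
    ∃ p' ∈ PL (Fin n) K (k + 1),
      linMap a b K p - linMap a b K p' ∈ relIdealIn K E a b (fun _ => q) := by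
  induction m with
  | zero => exact fun p hp _ => ⟨p, PL_mono (by omega) hp, by simp⟩
  | succ m ih =>
    intro p hp h
    by_cases hm : m ≤ k
    · exact ⟨p, PL_mono (by omega) hp, by simp⟩
    · have hj := alphaq g q hq hc m p hp P (PL_mono (by omega) hP) h
      obtain ⟨p2, hp2, h2⟩ := betaq q hq hc m _ hj
      obtain ⟨p', hp', h3⟩ := ih (p - homogeneousComponent m p + p2) (add_mem (PL_split hp) hp2) (by
        convert sub_mem h h2 using 1
        rw [map_add, map_sub]; ring)
      refine ⟨p', hp', ?_⟩
      convert add_mem h3 h2 using 1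
      rw [map_add, map_sub]; ring

lemma aeval_XIn (q : K) (p : MvPolynomial (Fin n) K) :
    aeval (XIn K a b (fun _ => q)) p =
      Ideal.Quotient.mk (relIdealIn K E a b (fun _ => q)) (linMap a b K p) := by
  have : (aeval (XIn K a b (fun _ => q)) : MvPolynomial (Fin n) K →ₐ[K] _) =
      (Ideal.Quotient.mkₐ K (relIdealIn K E a b (fun _ => q))).comp (linMap a b K) := by
    apply MvPolynomial.algHom_ext
    intro i
    rw [aeval_X, AlgHom.comp_apply, linMap, aeval_X]
    rfl
  rw [this]; rfl

lemma aeval_XIn0 (g : Fin n) (p : MvPolynomial (Fin n) K) :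
    aeval (XIn0 K a b g) p =
      Ideal.Quotient.mk (relIdealIn0 K E a b g) (linMap a b K p) := by
  have : (aeval (XIn0 K a b g) : MvPolynomial (Fin n) K →ₐ[K] _) =
      (Ideal.Quotient.mkₐ K (relIdealIn0 K E a b g)).comp (linMap a b K) := by
    apply MvPolynomial.algHom_ext
    intro i
    rw [aeval_X, AlgHom.comp_apply, linMap, aeval_X]
    rfl
  rw [this]; rfl

lemma linMap_PL {m : ℕ} {p : MvPolynomial (Fin n) K} (hp : p ∈ PL (Fin n) K m) :
    linMap a b K p ∈ PL E K m := by
  induction hp using Submodule.span_induction with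
  | mem x hx =>
    obtain ⟨l, hl, hx⟩ := hx
    exact PL_hom (linMap_hom hx) hl
  | zero => simp
  | add x y _ _ hx hy => rw [map_add]; exact add_mem hx hy
  | smul c x _ hx => rw [map_smul]; exact Submodule.smul_mem _ _ hx

lemma part_one (g : Fin n) (hc : Con a b (Finset.univ : Finset E) ∅) (q : K) (hq : q ≠ 0) (k : ℕ) :
    FkIn K a b (fun _ => q) k =
      (PsiIn K a b (fun _ => q)).toSubmodule ⊓
        Submodule.map (Ideal.Quotient.mkₐ K (relIdealIn K E a b (fun _ => q))).toLinearMap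
          (MvPolynomial.restrictTotalDegree E K k) := by
  rw [FkIn, span_eq_map, PsiIn, Algebra.adjoin_range_eq_range_aeval, ← PL_eq]
  apply le_antisymm
  · rintro _ ⟨p, hp, rfl⟩
    refine ⟨⟨p, rfl⟩, ⟨linMap a b K p, linMap_PL hp, ?_⟩⟩
    exact (aeval_XIn q p).symm
  · rintro _ ⟨⟨p, rfl⟩, ⟨P, hP, hPp⟩⟩
    have hPp : Ideal.Quotient.mk _ P = aeval (XIn K a b (fun _ => q)) p := hPp
    rw [aeval_XIn] at hPp
    have hp : p ∈ PL (Fin n) K (p.totalDegree + 1) := by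
      rw [PL_eq, mem_restrictTotalDegree]
    obtain ⟨p', hp', h⟩ := descend g q hq hc k P hP _ p hp (Ideal.Quotient.eq.1 hPp.symm)
    refine ⟨p', hp', ?_⟩
    have e : aeval (XIn K a b (fun _ => q)) p' = aeval (XIn K a b (fun _ => q)) p := by
      rw [aeval_XIn, aeval_XIn]
      exact (Ideal.Quotient.eq.2 h).symm
    exact e

lemma part_two (g : Fin n) (hc : Con a b (Finset.univ : Finset E) ∅) (q : K) (hq : q ≠ 0) (k : ℕ) :
    Module.finrank K (FkIn K a b (fun _ => q) k) = Module.finrank K (FkIn0 K a b g k) := by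
  rw [FkIn, FkIn0, span_eq_map, span_eq_map]
  refine map_rank _ _ (fun m => JJ a b K (Finset.univ : Finset E) ∅ m)
    (fun m p hp => (JJ_AT hp).2) ?_ ?_ ?_ ?_ (k + 1)
  · intro m p hp h
    rw [AlgHom.toLinearMap_apply, aeval_XIn, Ideal.Quotient.eq_zero_iff_mem] at h
    exact alphaq g q hq hc m p hp 0 (zero_mem _) (by rwa [sub_zero])
  · intro m p hp
    obtain ⟨p', hp', h⟩ := betaq q hq hc m p hp
    refine ⟨p', hp', ?_⟩
    rw [AlgHom.toLinearMap_apply, AlgHom.toLinearMap_apply, aeval_XIn, aeval_XIn]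
    exact Ideal.Quotient.eq.2 h
  · intro m p hp h
    rw [AlgHom.toLinearMap_apply, aeval_XIn0, Ideal.Quotient.eq_zero_iff_mem] at h
    exact alpha0 g hc m p h
  · intro m p hp
    refine ⟨0, zero_mem _, ?_⟩
    rw [map_zero, AlgHom.toLinearMap_apply, aeval_XIn0, Ideal.Quotient.eq_zero_iff_mem]
    exact JJ_rel g hc hp

end final


end HeckeAux

/-- For the Hecke deformation of the internal algebra (`q ≠ 0`): (i) the
filtration induced by the `X_i^{In}` coincides with the one induced from `Φ^{In}_{G,q}` by
total degree, and (ii) its Hilbert polynomial coincides with that of the undeformed internal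
algebra `C^{In}_G`. -/
theorem heckeIn_filtration_and_hilbert
    {K : Type*} [Field K] [CharZero K] {n : ℕ} {E : Type*} [Fintype E] [DecidableEq E]
    (a b : E → Fin n) (g : Fin n)
    (hab : ∀ e, a e < b e) (hconn : IsConnectedGraph a b) (q : K) (hq : q ≠ 0) :
    (∀ k : ℕ, FkIn K a b (fun _ => q) k =
      (PsiIn K a b (fun _ => q)).toSubmodule ⊓
        Submodule.map (Ideal.Quotient.mkₐ K (relIdealIn K E a b (fun _ => q))).toLinearMap
          (MvPolynomial.restrictTotalDegree E K k)) ∧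
    (∀ k : ℕ, Module.finrank K (FkIn K a b (fun _ => q) k) =
      Module.finrank K (FkIn0 K a b g k)) := by
  have hc := HeckeAux.con_of_connected a b hconn
  exact ⟨fun k => HeckeAux.part_one g hc q hq k, fun k => HeckeAux.part_two g hc q hq k⟩

end
end

section
/- For any loopless graph G, the total dimension over K of the Postnikov–Shapiro algebra C_G = Ψ_{G,0} equals the number of spanning forests of G: dim_K Ψ_{G,0} = #{F ⊆ E : F is a forest of G}. -/
open MvPolynomial

set_option synthInstance.maxHeartbeats 1000000
set_option maxHeartbeats 1000000

noncomputable section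

/-- The ideal of relations `u_e ^ 2 = q_e * u_e`. -/
def relIdeal (K : Type*) [Field K] (E : Type*) (q : E → K) :
    Ideal (MvPolynomial E K) :=
  Ideal.span (Set.range fun e : E => (X e) ^ 2 - C (q e) * X e)

/-- The algebra `Φ_{G,Q}`. -/
abbrev PhiAlg (K : Type*) [Field K] (E : Type*) (q : E → K) : Type _ :=
  MvPolynomial E K ⧸ relIdeal K E q

/-- The generator `X_i` of the `Q`-deformation. -/
def XX (K : Type*) [Field K] {n : ℕ} {E : Type*} [Fintype E]
    (a b : E → Fin n) (q : E → K) (i : Fin n) : PhiAlg K E q :=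
  Ideal.Quotient.mk _
    ((∑ e ∈ Finset.univ.filter fun e => a e = i, X e) -
      ∑ e ∈ Finset.univ.filter fun e => b e = i, X e)

/-- The `Q`-deformation `Ψ_{G,Q}` of the Postnikov–Shapiro algebra. -/
def PsiAlg (K : Type*) [Field K] {n : ℕ} {E : Type*} [Fintype E]
    (a b : E → Fin n) (q : E → K) : Subalgebra K (PhiAlg K E q) :=
  Algebra.adjoin K (Set.range (XX K a b q))

/-- The vector `χ_{a e} - χ_{b e}` in `ℚ^n` associated to an edge. -/
def edgeVec {n : ℕ} {E : Type*} (a b : E → Fin n) (e : E) : Fin n → ℚ :=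
  fun i => (if a e = i then 1 else 0) - (if b e = i then 1 else 0)

/-- A subset of the edges is a forest if the associated vectors are linearly independent. -/
def IsForest {n : ℕ} {E : Type*} (a b : E → Fin n) (F : Finset E) : Prop :=
  LinearIndependent ℚ fun e : F => edgeVec a b (e : E)

namespace PS

variable {K : Type*} [Field K] {n : ℕ} {E : Type*}

/-- The linear form with coefficient vector `c`. -/
def lin : (Fin n → K) →ₗ[K] MvPolynomial (Fin n) K :=
  Fintype.linearCombination K (fun i => (X i : MvPolynomial (Fin n) K))

lemma lin_apply (c : Fin n → K) : lin c = ∑ i, C (c i) * X i := by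
  simp [lin, Fintype.linearCombination_apply, C_mul']

lemma lin_single (i : Fin n) : lin (Pi.single i (1 : K)) = X i := by
  simp [lin]

lemma coeff_lin (c : Fin n → K) (i : Fin n) : coeff (Finsupp.single i 1) (lin c) = c i := by
  rw [lin_apply, coeff_sum, Finset.sum_eq_single i]
  · simp
  · intro j _ hj
    rw [coeff_C_mul, coeff_X, if_neg (fun h => hj (Finsupp.single_left_injective one_ne_zero h)), mul_zero]
  · simp

lemma lin_ne_zero {c : Fin n → K} (hc : c ≠ 0) : lin c ≠ 0 := by
  intro h
  apply hc
  ext i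
  rw [← coeff_lin c i, h]
  simp

/-- The directional derivative. -/
def D (η : Fin n → K) : Derivation K (MvPolynomial (Fin n) K) (MvPolynomial (Fin n) K) :=
  mkDerivation K (fun i => C (η i))

lemma D_X (η : Fin n → K) (i : Fin n) : D η (X i) = C (η i) := by
  simp [D, mkDerivation_X]

lemma D_lin (η c : Fin n → K) : D η (lin c) = C (η ⬝ᵥ c) := by
  simp only [lin_apply, map_sum, Derivation.leibniz, derivation_C, D_X, dotProduct]
  simp [mul_comm]

/-- Linear map version. -/
def L (η : Fin n → K) : Module.End K (MvPolynomial (Fin n) K) := (D η).toLinearMap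

lemma L_apply (η : Fin n → K) (f) : L η f = D η f := rfl

lemma L_pow_mul (η c : Fin n → K) (g : MvPolynomial (Fin n) K) (k : ℕ) :
    (L η ^ (k+1)) (lin c * g) =
      lin c * (L η ^ (k+1)) g + ((k : MvPolynomial (Fin n) K)+1) * (C (η ⬝ᵥ c) * (L η ^ k) g) := by
  induction k with
  | zero =>
    simp [L_apply, Derivation.leibniz, D_lin]
    ring
  | succ k ih =>
    rw [pow_succ' _ (k+1), Module.End.mul_apply, ih, map_add]
    simp only [L_apply, Derivation.leibniz, D_lin, smul_eq_mul, derivation_C, map_add,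
      Derivation.map_natCast, Derivation.map_one_eq_zero]
    simp only [← L_apply, ← Module.End.mul_apply, ← pow_succ']
    push_cast
    ring

lemma L_pow_mul_zero {η c : Fin n → K} (h : η ⬝ᵥ c = 0) (g : MvPolynomial (Fin n) K) (k : ℕ) :
    (L η ^ k) (lin c * g) = lin c * (L η ^ k) g := by
  cases k with
  | zero => simp
  | succ k => rw [L_pow_mul, h]; simp

lemma L_pow_zero_of_le {η : Fin n → K} {g : MvPolynomial (Fin n) K} {k l : ℕ} (hkl : k ≤ l)
    (h : (L η ^ k) g = 0) : (L η ^ l) g = 0 := by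
  obtain ⟨j, rfl⟩ := Nat.exists_eq_add_of_le' hkl
  rw [pow_add, Module.End.mul_apply, h, map_zero]

lemma L_nilp (η : Fin n → K) (g : MvPolynomial (Fin n) K) : ∃ k, (L η ^ k) g = 0 := by
  induction g using MvPolynomial.induction_on with
  | C a => exact ⟨1, by simp [L_apply]⟩
  | add p q hp hq =>
    obtain ⟨k, hk⟩ := hp
    obtain ⟨l, hl⟩ := hq
    refine ⟨k + l, ?_⟩
    rw [map_add, L_pow_zero_of_le (by omega) hk, L_pow_zero_of_le (by omega) hl, add_zero]
  | mul_X p i hp =>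
    obtain ⟨k, hk⟩ := hp
    refine ⟨k + 1, ?_⟩
    rw [mul_comm, ← lin_single, L_pow_mul, hk, L_pow_zero_of_le (Nat.le_succ k) hk]
    simp

lemma L_pow_cancel [CharZero K] {η c : Fin n → K} (h : η ⬝ᵥ c ≠ 0) (g : MvPolynomial (Fin n) K)
    (k : ℕ) (hk : (L η ^ (k+1)) (lin c * g) = 0) : (L η ^ k) g = 0 := by
  obtain ⟨l, hl⟩ := L_nilp η g
  have key : ∀ j, (L η ^ (k + j)) g = 0 → (L η ^ k) g = 0 := by
    intro j
    induction j with
    | zero => simp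
    | succ j ih =>
      intro hj
      apply ih
      have h1 := L_pow_mul η c g (k + j)
      rw [L_pow_zero_of_le (by omega) hk, show k + j + 1 = k + (j + 1) by omega, hj, mul_zero,
        zero_add] at h1
      have h2 : ((k + j : ℕ) : MvPolynomial (Fin n) K) + 1 ≠ 0 := Nat.cast_add_one_ne_zero _
      have h3 : (C (η ⬝ᵥ c) : MvPolynomial (Fin n) K) ≠ 0 := by simpa using h
      exact (mul_eq_zero.mp ((mul_eq_zero.mp h1.symm).resolve_left h2)).resolve_left h3
  exact key l (L_pow_zero_of_le (by omega) hl)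

open Classical in
/-- Number of members of the family not killed by `η`. -/
def mult (v : E → Fin n → K) (s : Finset E) (η : Fin n → K) : ℕ :=
  (s.filter (fun e => η ⬝ᵥ v e ≠ 0)).card

/-- The span of products. -/
def P (v : E → Fin n → K) (s : Finset E) : Submodule K (MvPolynomial (Fin n) K) :=
  Submodule.span K ((fun S : Finset E => ∏ e ∈ S, lin (v e)) '' {S | S ⊆ s})

/-- The kernel space. -/
def Q (v : E → Fin n → K) (s : Finset E) : Submodule K (MvPolynomial (Fin n) K) :=
  ⨅ η : Fin n → K, LinearMap.ker (L η ^ (mult v s η + 1))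

lemma mem_Q {v : E → Fin n → K} {s : Finset E} {f} :
    f ∈ Q v s ↔ ∀ η, (L η ^ (mult v s η + 1)) f = 0 := by
  simp [Q]

open Classical in
/-- Number of independent subsets. -/
def N (v : E → Fin n → K) (s : Finset E) : ℕ :=
  (s.powerset.filter (fun F : Finset E => LinearIndepOn K v (F : Set E))).card

lemma mult_mono (v : E → Fin n → K) {S s : Finset E} (h : S ⊆ s) (η) :
    mult v S η ≤ mult v s η := by
  classical
  exact Finset.card_le_card (Finset.filter_subset_filter _ h)

lemma mult_insert [DecidableEq E] (v : E → Fin n → K) {s : Finset E} {e : E} (he : e ∉ s)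
    (η : Fin n → K) (h : η ⬝ᵥ v e ≠ 0) :
    mult v (insert e s) η = mult v s η + 1 := by
  unfold mult
  rw [Finset.filter_insert, if_pos h, Finset.card_insert_of_notMem (by simp [he])]

lemma mult_insert_zero [DecidableEq E] (v : E → Fin n → K) {s : Finset E} {e : E}
    (η : Fin n → K) (h : η ⬝ᵥ v e = 0) :
    mult v (insert e s) η = mult v s η := by
  unfold mult
  rw [Finset.filter_insert, if_neg (by simpa using h)]

lemma P_le_Q (v : E → Fin n → K) (s : Finset E) : P v s ≤ Q v s := by
  classical
  rw [P, Submodule.span_le]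
  rintro _ ⟨S, hS, rfl⟩
  rw [SetLike.mem_coe, mem_Q]
  intro η
  refine L_pow_zero_of_le (Nat.succ_le_succ (mult_mono v hS η)) ?_
  clear hS
  induction S using Finset.induction_on with
  | empty => simp [mult, L_apply]
  | insert e S he ih =>
    simp only [Finset.prod_insert he]
    by_cases h : η ⬝ᵥ v e = 0
    · rw [mult_insert_zero v η h, L_pow_mul_zero h, ih, mul_zero]
    · rw [mult_insert v he η h, L_pow_mul, ih, L_pow_zero_of_le (Nat.le_succ _) ih]
      simp

/-! Projection along a vector -/

/-- Projection along `w` killing coordinate `i₀`. -/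
def proj (w : Fin n → K) (i₀ : Fin n) : (Fin n → K) →ₗ[K] (Fin n → K) :=
  LinearMap.id - (LinearMap.proj i₀ : (Fin n → K) →ₗ[K] K).smulRight ((w i₀)⁻¹ • w)

lemma proj_apply (w : Fin n → K) (i₀ : Fin n) (c) :
    proj w i₀ c = c - (c i₀ * (w i₀)⁻¹) • w := by
  simp [proj, smul_smul]

lemma ker_proj {w : Fin n → K} {i₀ : Fin n} (h : w i₀ ≠ 0) :
    LinearMap.ker (proj w i₀) = Submodule.span K {w} := by
  ext c
  rw [LinearMap.mem_ker, proj_apply, Submodule.mem_span_singleton]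
  constructor
  · intro hc
    exact ⟨_, (sub_eq_zero.mp hc).symm⟩
  · rintro ⟨a, rfl⟩
    simp [h]

/-- Induced algebra map. -/
def pi (w : Fin n → K) (i₀ : Fin n) : MvPolynomial (Fin n) K →ₐ[K] MvPolynomial (Fin n) K :=
  aeval (fun i => lin (proj w i₀ (Pi.single i 1)))

lemma pi_lin (w : Fin n → K) (i₀ : Fin n) (c : Fin n → K) :
    pi w i₀ (lin c) = lin (proj w i₀ c) := by
  have : (pi w i₀).toLinearMap ∘ₗ lin = lin ∘ₗ proj w i₀ := by
    apply LinearMap.pi_ext'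
    intro i
    ext
    simp [lin_single, pi]
  exact LinearMap.congr_fun this c

lemma dvd_sub_pi (w : Fin n → K) (i₀ : Fin n) (f : MvPolynomial (Fin n) K) :
    lin w ∣ f - pi w i₀ f := by
  rw [← Ideal.mem_span_singleton, ← Ideal.Quotient.mk_eq_mk_iff_sub_mem]
  have : Ideal.Quotient.mkₐ K (Ideal.span {lin w}) =
      (Ideal.Quotient.mkₐ K (Ideal.span {lin w})).comp (pi w i₀) := by
    apply MvPolynomial.algHom_ext
    intro i
    rw [AlgHom.comp_apply, ← lin_single, pi_lin, proj_apply]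
    simp only [Ideal.Quotient.mkₐ_eq_mk]
    rw [Ideal.Quotient.mk_eq_mk_iff_sub_mem, map_sub, map_smul, sub_sub_cancel]
    rw [Ideal.mem_span_singleton, smul_eq_C_mul]
    exact dvd_mul_left _ _
  exact AlgHom.congr_fun this f

/-- Transpose of the projection. -/
def tr (w : Fin n → K) (i₀ : Fin n) (η : Fin n → K) : Fin n → K :=
  fun i => η ⬝ᵥ proj w i₀ (Pi.single i 1)

lemma tr_dot (w : Fin n → K) (i₀ : Fin n) (η c : Fin n → K) :
    tr w i₀ η ⬝ᵥ c = η ⬝ᵥ proj w i₀ c := by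
  conv_rhs => rw [← Finset.univ_sum_single c]
  rw [map_sum, dotProduct_sum, dotProduct]
  refine Finset.sum_congr rfl fun i _ => ?_
  rw [show (Pi.single i (c i) : Fin n → K) = c i • Pi.single i 1 by simp [← Pi.single_smul], map_smul,
    dotProduct_smul, tr, smul_eq_mul, mul_comm]

lemma L_pi (w : Fin n → K) (i₀ : Fin n) (η : Fin n → K) (f) :
    L η (pi w i₀ f) = pi w i₀ (L (tr w i₀ η) f) := by
  induction f using MvPolynomial.induction_on with
  | C a => simp [L_apply, pi]
  | add p q hp hq => simp [hp, hq]
  | mul_X p i hp =>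
    simp only [L_apply, map_mul, Derivation.leibniz, smul_eq_mul, map_add, D_X] at hp ⊢
    rw [hp]
    have : D η (pi w i₀ (X i)) = pi w i₀ (C (tr w i₀ η i)) := by
      rw [← lin_single, pi_lin, D_lin]
      simp [pi, tr]
    rw [this]

lemma L_pow_pi (w : Fin n → K) (i₀ : Fin n) (η : Fin n → K) (f) (k : ℕ) :
    (L η ^ k) (pi w i₀ f) = pi w i₀ ((L (tr w i₀ η) ^ k) f) := by
  induction k with
  | zero => simp
  | succ k ih => rw [pow_succ', Module.End.mul_apply, ih, L_pi, pow_succ', Module.End.mul_apply]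

/-! Counting -/

lemma linearIndepOn_insert_proj [DecidableEq E] (v : E → Fin n → K) {e : E} {i₀ : Fin n}
    (h : v e i₀ ≠ 0) {F : Finset E} (he : e ∉ F) :
    LinearIndepOn K v ((insert e F : Finset E) : Set E) ↔
      LinearIndepOn K (proj (v e) i₀ ∘ v) (F : Set E) := by
  have hne : v e ≠ 0 := fun h0 => h (by rw [h0]; rfl)
  rw [Finset.coe_insert, Set.insert_eq,
    linearIndepOn_union_iff_quotient (by simpa using he)]
  have hs : LinearIndepOn K v {e} := by simpa using hne
  simp only [hs, true_and]
  have hk : LinearMap.ker (proj (v e) i₀) = Submodule.span K (v '' {e}) := by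
    rw [ker_proj h, Set.image_singleton]
  rw [← hk]
  have := LinearMap.linearIndependent_iff (v := fun x : (F : Set E) =>
    (LinearMap.ker (proj (v e) i₀)).mkQ (v x))
    ((LinearMap.ker (proj (v e) i₀)).liftQ (proj (v e) i₀) le_rfl)
    (Submodule.ker_liftQ_eq_bot _ _ _ le_rfl)
  exact this.symm

lemma N_insert [DecidableEq E] (v : E → Fin n → K) {s : Finset E} {e : E} (he : e ∉ s) {i₀ : Fin n}
    (h : v e i₀ ≠ 0) : N v (insert e s) = N v s + N (proj (v e) i₀ ∘ v) s := by
  classical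
  unfold N
  rw [Finset.powerset_insert, Finset.filter_union, Finset.card_union_of_disjoint]
  · congr 1
    rw [Finset.filter_image, Finset.card_image_of_injOn]
    · congr 1
      apply Finset.filter_congr
      intro F hF
      exact linearIndepOn_insert_proj v h (fun hc => he (Finset.mem_powerset.mp hF hc))
    · intro F hF F' hF' hFF
      simp only [Finset.coe_filter, Finset.mem_powerset, Set.mem_ofPred_eq] at hF hF'
      have h1 : e ∉ F := fun hc => he (hF.1 hc)
      have h2 : e ∉ F' := fun hc => he (hF'.1 hc)
      rw [← Finset.erase_insert h1, ← Finset.erase_insert h2]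
      exact congrArg (fun A : Finset E => A.erase e) hFF
  · rw [Finset.disjoint_left]
    intro F hF hF'
    simp only [Finset.mem_filter, Finset.mem_powerset, Finset.mem_image] at hF hF'
    obtain ⟨⟨G, _, rfl⟩, _⟩ := hF'
    exact he (hF.1 (Finset.mem_insert_self _ _))

lemma N_insert_zero [DecidableEq E] (v : E → Fin n → K) {s : Finset E} {e : E}
    (h : v e = 0) : N v (insert e s) = N v s := by
  classical
  unfold N
  congr 1
  ext F
  simp only [Finset.mem_filter, Finset.mem_powerset]
  constructor
  · rintro ⟨h1, h2⟩
    refine ⟨?_, h2⟩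
    have : e ∉ F := fun hc => h2.ne_zero hc h
    exact (Finset.subset_insert_iff_of_notMem this).mp h1
  · rintro ⟨h1, h2⟩
    exact ⟨h1.trans (Finset.subset_insert _ _), h2⟩

lemma rank_Q_le [CharZero K] (s : Finset E) :
    ∀ v : E → Fin n → K, Module.rank K (Q v s) ≤ (N v s : Cardinal) := by
  classical
  induction s using Finset.induction_on with
  | empty =>
    intro v
    have hN : N v ∅ = 1 := by
      simp [N, Finset.filter_singleton, linearIndepOn_empty]
    have : Q v ∅ ≤ Submodule.span K {1} := by
      intro f hf
      rw [mem_Q] at hf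
      have hf' : ∀ i, pderiv i f = 0 := by
        intro i
        have := hf (Pi.single i 1)
        have hD : D (Pi.single i (1 : K)) = pderiv i := by
          apply derivation_ext
          intro j
          rw [D_X, pderiv_X]
          by_cases hij : j = i
          · subst hij; simp
          · simp [Pi.single_apply, hij, Ne.symm hij]
        simpa [mult, L_apply, hD] using this
      have : f = C (coeff 0 f) := by
        ext m
        rw [coeff_C]
        split_ifs with hm
        · rw [← hm]
        · obtain ⟨i, hi⟩ : ∃ i, m i ≠ 0 := by
            by_contra hcon
            push Not at hcon
            exact hm (by ext i; simp [hcon i])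
          have h1 := coeff_pderiv (i := i) f (m - Finsupp.single i 1)
          rw [hf', tsub_add_cancel_of_le (by simpa [Nat.one_le_iff_ne_zero] using hi)] at h1
          exact (mul_eq_zero.mp (h1.symm.trans (coeff_zero _))).resolve_right
            (Nat.cast_add_one_ne_zero _)
      rw [Submodule.mem_span_singleton]
      exact ⟨coeff 0 f, by rw [smul_eq_C_mul, mul_one, ← this]⟩
    refine (Submodule.rank_mono this).trans ((rank_span_le _).trans ?_)
    simp [hN]
  | insert e s he ih =>
    intro v
    by_cases h0 : v e = 0
    · have : Q v (insert e s) = Q v s := by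
        unfold Q
        congr 1
        ext1 η
        rw [mult_insert_zero v η (by rw [h0, dotProduct_zero])]
      rw [this, N_insert_zero v h0]
      exact ih v
    · obtain ⟨i₀, hi⟩ : ∃ i, v e i ≠ 0 := by
        by_contra hcon
        push Not at hcon
        exact h0 (funext hcon)
      rw [N_insert v he hi]
      set w := v e with hw
      let φ := (pi w i₀).toLinearMap.domRestrict (Q v (insert e s))
      rw [← LinearMap.rank_range_add_rank_ker φ, add_comm]
      push_cast
      have hker0 : proj w i₀ w = 0 := by
        rw [proj_apply]; simp [hi]
      refine add_le_add ?_ ?_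
      · refine le_trans ?_ (ih v)
        have hle : (LinearMap.ker φ).map (Q v (insert e s)).subtype ≤
            (Q v s).map (LinearMap.mulLeft K (lin w)) := by
          rintro _ ⟨⟨f, hf⟩, hfk, rfl⟩
          have hf0 : pi w i₀ f = 0 := hfk
          have hd := dvd_sub_pi w i₀ f
          rw [hf0, sub_zero] at hd
          obtain ⟨g, rfl⟩ := hd
          refine ⟨g, ?_, rfl⟩
          rw [SetLike.mem_coe, mem_Q]
          rw [mem_Q] at hf
          intro η
          by_cases hη : η ⬝ᵥ w = 0
          · have := hf η
            rw [mult_insert_zero v η hη, L_pow_mul_zero hη] at this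
            exact (mul_eq_zero.mp this).resolve_left (lin_ne_zero h0)
          · have := hf η
            rw [mult_insert v he η hη] at this
            exact L_pow_cancel hη _ _ this
        calc Module.rank K (LinearMap.ker φ)
            = Module.rank K ((LinearMap.ker φ).map (Q v (insert e s)).subtype) :=
              (LinearEquiv.rank_eq (Submodule.equivMapOfInjective _
                (Submodule.injective_subtype _) _))
          _ ≤ _ := Submodule.rank_mono hle
          _ ≤ _ := rank_map_le _ _
      · refine le_trans (Submodule.rank_mono ?_) (ih (proj w i₀ ∘ v))
        rintro _ ⟨⟨f, hf⟩, rfl⟩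
        change pi w i₀ f ∈ _
        rw [mem_Q] at hf ⊢
        intro η
        rw [L_pow_pi]
        have h1 : mult v (insert e s) (tr w i₀ η) = mult (proj w i₀ ∘ v) s η := by
          rw [mult_insert_zero]
          · unfold mult
            simp only [tr_dot, Function.comp]
          · rw [tr_dot, ← hw, hker0, dotProduct_zero]
        rw [← h1, hf, map_zero]

lemma le_rank_P (s : Finset E) :
    ∀ v : E → Fin n → K, (N v s : Cardinal) ≤ Module.rank K (P v s) := by
  classical
  induction s using Finset.induction_on with
  | empty =>
    intro v
    have hN : N v ∅ = 1 := by
      simp [N, Finset.filter_singleton, linearIndepOn_empty]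
    have : P v ∅ = Submodule.span K {1} := by
      simp [P]
    rw [hN, this, Nat.cast_one, Cardinal.one_le_iff_pos]
    have : Nontrivial (Submodule.span K {(1 : MvPolynomial (Fin n) K)}) :=
      ⟨⟨⟨1, Submodule.mem_span_singleton_self _⟩, 0, fun h =>
        one_ne_zero (congrArg Subtype.val h)⟩⟩
    exact rank_pos
  | insert e s he ih =>
    intro v
    have hmono : P v s ≤ P v (insert e s) :=
      Submodule.span_mono (Set.image_mono fun S (hS : S ⊆ s) => hS.trans (Finset.subset_insert _ _))
    by_cases h0 : v e = 0
    · rw [N_insert_zero v h0]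
      exact (ih v).trans (Submodule.rank_mono hmono)
    · obtain ⟨i₀, hi⟩ : ∃ i, v e i ≠ 0 := by
        by_contra hcon
        push Not at hcon
        exact h0 (funext hcon)
      rw [N_insert v he hi]
      set w := v e with hw
      let φ := (pi w i₀).toLinearMap.domRestrict (P v (insert e s))
      rw [← LinearMap.rank_range_add_rank_ker φ, add_comm]
      push_cast
      have hker0 : proj w i₀ w = 0 := by
        rw [proj_apply]; simp [hi]
      refine add_le_add ?_ ?_
      · refine (ih _).trans (Submodule.rank_mono ?_)
        rw [P, Submodule.span_le]
        rintro _ ⟨S, hS, rfl⟩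
        refine ⟨⟨∏ e ∈ S, lin (v e), hmono (Submodule.subset_span ⟨S, hS, rfl⟩)⟩, ?_⟩
        change pi w i₀ (∏ e ∈ S, lin (v e)) = _
        rw [map_prod]
        simp [pi_lin]
      · refine (ih v).trans ?_
        have hle : (P v s).map (LinearMap.mulLeft K (lin w)) ≤
            (LinearMap.ker φ).map (P v (insert e s)).subtype := by
          rintro _ ⟨f, hf, rfl⟩
          have hmem : lin w * f ∈ P v (insert e s) := by
            have : P v s ≤ (P v (insert e s)).comap (LinearMap.mulLeft K (lin w)) := by
              rw [P, Submodule.span_le]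
              rintro _ ⟨S, hS, rfl⟩
              refine Submodule.subset_span ⟨insert e S, Finset.insert_subset_insert _ hS, ?_⟩
              simp only
              rw [Finset.prod_insert (fun hc => he (hS hc))]
              rfl
            exact this hf
          refine ⟨⟨lin w * f, hmem⟩, ?_, rfl⟩
          change pi w i₀ (lin w * f) = 0
          rw [map_mul, pi_lin, hker0, map_zero, zero_mul]
        calc Module.rank K (P v s)
            = Module.rank K ((P v s).map (LinearMap.mulLeft K (lin w))) :=
              (LinearEquiv.rank_eq (Submodule.equivMapOfInjective _
                (mul_right_injective₀ (lin_ne_zero h0)) _))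
          _ ≤ _ := Submodule.rank_mono hle
          _ ≤ _ := rank_map_le _ _

lemma rank_P [CharZero K] (v : E → Fin n → K) (s : Finset E) :
    Module.rank K (P v s) = (N v s : Cardinal) :=
  le_antisymm ((Submodule.rank_mono (P_le_Q v s)).trans (rank_Q_le s v)) (le_rank_P s v)

/-- The apolar pairing. -/
def T : MvPolynomial (Fin n) K →ₗ[K] Module.Dual K (MvPolynomial (Fin n) K) :=
  (basisMonomials (Fin n) K).constr K
    (fun m => ((∏ i, (m i).factorial : ℕ) : K) • lcoeff K m)

lemma T_monomial (m : Fin n →₀ ℕ) (f : MvPolynomial (Fin n) K) :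
    T (monomial m 1) f = ((∏ i, (m i).factorial : ℕ) : K) * coeff m f := by
  have h : T (monomial m (1 : K)) = ((∏ i, (m i).factorial : ℕ) : K) • lcoeff K m := by
    have := (basisMonomials (Fin n) K).constr_basis K
      (fun m => ((∏ i, (m i).factorial : ℕ) : K) • lcoeff K m) m
    rwa [coe_basisMonomials] at this
  rw [h]
  rfl

lemma T_monomial' (m : Fin n →₀ ℕ) (a : K) (f : MvPolynomial (Fin n) K) :
    T (monomial m a) f = a * (((∏ i, (m i).factorial : ℕ) : K) * coeff m f) := by
  rw [← T_monomial, show monomial m a = a • monomial m (1 : K) by simp [smul_monomial], map_smul]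
  rfl

lemma T_one (f : MvPolynomial (Fin n) K) : T 1 f = coeff 0 f := by
  have := T_monomial 0 f
  simpa using this

lemma T_apply_monomial (g : MvPolynomial (Fin n) K) (m : Fin n →₀ ℕ) :
    T g (monomial m 1) = ((∏ i, (m i).factorial : ℕ) : K) * coeff m g := by
  classical
  induction g using MvPolynomial.induction_on' with
  | monomial k a =>
    rw [T_monomial', coeff_monomial, coeff_monomial]
    by_cases h : k = m
    · subst h; simp [mul_comm]
    · rw [if_neg h, if_neg (Ne.symm h)]; simp
  | add p q hp hq => rw [map_add, LinearMap.add_apply, hp, hq, coeff_add, mul_add]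

lemma T_injective [CharZero K] :
    Function.Injective (T : MvPolynomial (Fin n) K →ₗ[K] _) := by
  rw [← LinearMap.ker_eq_bot, LinearMap.ker_eq_bot']
  intro g hg
  ext m
  have h := T_apply_monomial g m
  rw [hg, LinearMap.zero_apply] at h
  refine (mul_eq_zero.mp h.symm).resolve_left ?_
  exact_mod_cast Finset.prod_ne_zero_iff.mpr fun i _ => Nat.factorial_ne_zero _

lemma T_X_mul (i : Fin n) (g f : MvPolynomial (Fin n) K) :
    T (X i * g) f = T g (pderiv i f) := by
  classical
  induction g using MvPolynomial.induction_on' with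
  | monomial m a =>
    rw [X, monomial_mul, one_mul, T_monomial', T_monomial', coeff_pderiv, add_comm]
    have h : (∏ j, ((m + Finsupp.single i 1 : Fin n →₀ ℕ) j).factorial) =
        (m i + 1) * ∏ j, (m j).factorial := by
      rw [← Finset.mul_prod_erase _ _ (Finset.mem_univ i),
        ← Finset.mul_prod_erase _ (fun j => (m j).factorial) (Finset.mem_univ i), ← mul_assoc]
      congr 1
      · simp [Nat.factorial_succ]
      · refine Finset.prod_congr rfl fun j hj => ?_
        have : i ≠ j := fun h => (Finset.mem_erase.mp hj).1 h.symm
        simp [Finsupp.single_apply, this]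
    rw [h]
    push_cast
    ring
  | add p q hp hq => rw [mul_add, map_add, LinearMap.add_apply, hp, hq, map_add, LinearMap.add_apply]

lemma D_eq_sum (c : Fin n → K) (f : MvPolynomial (Fin n) K) :
    D c f = ∑ i, c i • pderiv i f := by
  classical
  have hs : ∀ g : MvPolynomial (Fin n) K, (∑ i, c i • pderiv i :
      Derivation K (MvPolynomial (Fin n) K) (MvPolynomial (Fin n) K)) g =
      ∑ i, c i • pderiv i g := by
    intro g
    have := congrFun (map_sum (Derivation.coeFnAddMonoidHom (R := K)
      (A := MvPolynomial (Fin n) K) (M := MvPolynomial (Fin n) K))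
      (fun i => c i • pderiv i) Finset.univ) g
    rw [Finset.sum_apply] at this
    exact this
  have h : D c = ∑ i, c i • pderiv i := by
    apply derivation_ext
    intro j
    rw [D_X, hs, Finset.sum_eq_single j]
    · simp [smul_eq_C_mul]
    · intro k _ hk
      simp [pderiv_X_of_ne (Ne.symm hk)]
    · simp
  rw [h, hs]

lemma T_lin_mul (c : Fin n → K) (g f : MvPolynomial (Fin n) K) :
    T (lin c * g) f = T g (D c f) := by
  rw [D_eq_sum, lin_apply, Finset.sum_mul, map_sum, map_sum, LinearMap.sum_apply]
  refine Finset.sum_congr rfl fun i _ => ?_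
  rw [mul_assoc, ← smul_eq_C_mul, map_smul, map_smul, LinearMap.smul_apply, T_X_mul]

/-- Substitution of the edge sums for the variables. -/
def subst [Fintype E] (v : E → Fin n → K) : MvPolynomial (Fin n) K →ₐ[K] MvPolynomial E K :=
  aeval (fun i => ∑ e, C (v e i) * X e)

lemma pderiv_subst [Fintype E] (v : E → Fin n → K) (e : E) (f : MvPolynomial (Fin n) K) :
    pderiv e (subst v f) = subst v (D (v e) f) := by
  classical
  induction f using MvPolynomial.induction_on with
  | C a => simp [subst]
  | add p q hp hq => simp [hp, hq]
  | mul_X p i hp =>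
    simp only [map_mul, Derivation.leibniz, smul_eq_mul, map_add, D_X, hp]
    have : pderiv e (subst v (X i)) = subst v (C (v e i)) := by
      simp only [subst, aeval_X, map_sum, pderiv_C_mul, aeval_C]
      rw [Finset.sum_eq_single e]
      · simp [algebraMap_eq]
      · intro j _ hj
        rw [pderiv_X_of_ne hj, mul_zero]
      · simp
    rw [this]

/-- Squarefree exponent. -/
def ind (S : Finset E) : E →₀ ℕ := ∑ e ∈ S, Finsupp.single e 1

lemma ind_apply [DecidableEq E] (S : Finset E) (x : E) : ind S x = if x ∈ S then 1 else 0 := by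
  simp [ind, Finsupp.finsetSum_apply, Finsupp.single_apply]

lemma T_prod [Fintype E] (v : E → Fin n → K) (S : Finset E) :
    ∀ f, T (∏ e ∈ S, lin (v e)) f = coeff (ind S) (subst v f) := by
  classical
  induction S using Finset.induction_on with
  | empty =>
    intro f
    rw [Finset.prod_empty, T_one]
    simp only [ind, Finset.sum_empty]
    rw [← constantCoeff_eq, ← constantCoeff_eq]
    induction f using MvPolynomial.induction_on with
    | C a => simp [subst, algebraMap_eq]
    | add p q hp hq => simp [hp, hq]
    | mul_X p i hp => simp [subst]
  | insert e S he ih =>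
    intro f
    rw [Finset.prod_insert he, T_lin_mul, ih, ← pderiv_subst, coeff_pderiv, ind_apply, if_neg he]
    simp only [Nat.cast_zero, zero_add, mul_one]
    rw [ind, ind, Finset.sum_insert he, add_comm]

lemma mem_rel [Fintype E] (p : MvPolynomial E K) :
    p ∈ relIdeal K E (fun _ => (0 : K)) ↔ ∀ S : Finset E, coeff (ind S) p = 0 := by
  classical
  have h : relIdeal K E (fun _ => (0 : K)) = Ideal.span
      ((fun s => monomial s (1 : K)) '' Set.range (fun e : E => Finsupp.single e 2)) := by
    rw [relIdeal, ← Set.range_comp]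
    congr 1
    congr 1
    ext1 e
    simp [X_pow_eq_monomial]
  rw [h, mem_ideal_span_monomial_image]
  constructor
  · intro hp S
    by_contra hc
    obtain ⟨_, ⟨e, rfl⟩, hle⟩ := hp (ind S) (mem_support_iff.mpr hc)
    have := hle e
    rw [ind_apply] at this
    simp at this
    split_ifs at this <;> omega
  · intro hp m hm
    by_contra hc
    push Not at hc
    have h1 : ∀ e, m e ≤ 1 := by
      intro e
      by_contra hlt
      refine hc _ ⟨e, rfl⟩ ?_
      rw [Finsupp.single_le_iff]
      omega
    have h2 : m = ind m.support := by
      ext e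
      rw [ind_apply]
      have := h1 e
      split_ifs with h3
      · have := Finsupp.mem_support_iff.mp h3
        omega
      · simpa using h3
    rw [mem_support_iff, h2] at hm
    exact hm (hp _)

/-- Evaluation of all the functionals. -/
def rho [Fintype E] (v : E → Fin n → K) : MvPolynomial (Fin n) K →ₗ[K] (Finset E → K) :=
  LinearMap.pi fun S => T (∏ e ∈ S, lin (v e))

lemma finrank_rho [Fintype E] [CharZero K] (v : E → Fin n → K) :
    Module.finrank K (LinearMap.range (rho v)) = N v Finset.univ := by
  classical
  rw [← LinearMap.finrank_range_dualMap_eq_finrank_range]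
  have h : LinearMap.range (rho v).dualMap = (P v Finset.univ).map T := by
    have hb := (Pi.basisFun K (Finset E)).dualBasis.span_eq
    rw [LinearMap.range_eq_map, ← hb, Submodule.map_span, P, Submodule.map_span]
    congr 1
    ext g
    simp only [Set.mem_image, Set.mem_range, Finset.subset_univ]
    constructor
    · rintro ⟨_, ⟨S, rfl⟩, rfl⟩
      refine ⟨_, ⟨S, trivial, rfl⟩, ?_⟩
      ext f
      simp [rho]
    · rintro ⟨_, ⟨S, _, rfl⟩, rfl⟩
      refine ⟨_, ⟨S, rfl⟩, ?_⟩
      ext f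
      simp [rho]
  rw [h, ← (Submodule.equivMapOfInjective _ T_injective (P v Finset.univ)).finrank_eq,
    Module.finrank, rank_P, Cardinal.toNat_natCast]

end PS

/-- The total dimension of the Postnikov–Shapiro algebra `C_G = Ψ_{G,0}`
equals the number of spanning forests of `G`. -/
theorem dim_PS_eq_card_forests
    {K : Type*} [Field K] [CharZero K] {n : ℕ} {E : Type*} [Fintype E] [DecidableEq E]
    (a b : E → Fin n) (hab : ∀ e, a e < b e) :
    Module.finrank K (PsiAlg K a b fun _ => (0 : K)) =
      Set.ncard {F : Finset E | IsForest a b F} := by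
  classical
  let v : E → Fin n → K := fun e => algebraMap ℚ K ∘ edgeVec a b e
  have hX : ∀ i, XX K a b (fun _ => (0 : K)) i =
      Ideal.Quotient.mk _ (∑ e, C (v e i) * X e) := by
    intro i
    unfold XX
    congr 1
    rw [Finset.sum_filter, Finset.sum_filter, ← Finset.sum_sub_distrib]
    refine Finset.sum_congr rfl fun e _ => ?_
    simp only [v, Function.comp, edgeVec]
    split_ifs <;> simp
  have hθ : (aeval (XX K a b (fun _ => (0 : K))) : MvPolynomial (Fin n) K →ₐ[K] _) =
      (Ideal.Quotient.mkₐ K (relIdeal K E (fun _ => (0 : K)))).comp (PS.subst v) := by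
    apply MvPolynomial.algHom_ext
    intro i
    rw [aeval_X, hX]
    simp [PS.subst]
  have hker : LinearMap.ker
      (aeval (XX K a b (fun _ => (0 : K))) : MvPolynomial (Fin n) K →ₐ[K] _).toLinearMap =
      LinearMap.ker (PS.rho v) := by
    ext f
    rw [LinearMap.mem_ker, LinearMap.mem_ker, AlgHom.toLinearMap_apply, hθ, AlgHom.comp_apply,
      Ideal.Quotient.mkₐ_eq_mk, Ideal.Quotient.eq_zero_iff_mem, PS.mem_rel, funext_iff]
    refine forall_congr' fun S => ?_
    rw [← PS.T_prod]
    rfl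
  have h1 : Module.finrank K (PsiAlg K a b fun _ => (0 : K)) =
      Module.finrank K (LinearMap.range
        (aeval (XX K a b (fun _ => (0 : K))) : MvPolynomial (Fin n) K →ₐ[K] _).toLinearMap) := by
    rw [PsiAlg, Algebra.adjoin_range_eq_range_aeval]
    rfl
  rw [h1, ← (LinearMap.quotKerEquivRange _).finrank_eq, hker,
    (LinearMap.quotKerEquivRange _).finrank_eq, PS.finrank_rho, PS.N, Set.ncard_eq_toFinset_card']
  congr 1
  ext F
  simp only [Finset.powerset_univ, Finset.mem_filter, Finset.mem_univ, true_and, Set.mem_toFinset]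
  exact linearIndependent_algebraMap_comp_iff (R := ℚ) (S := K)
    (v := fun e : F => edgeVec a b (e : E))

end
end

section
/- Let G_1 and G_2 be loopless graphs (on n_1 and n_2 vertices, with edge types E_1 and E_2 respectively). Then the algebras C_{G_1} and C_{G_2} are isomorphic as K-algebras if and only if the graphical matroids of G_1 and G_2 coincide, i.e., if and only if there exists a bijection σ : E_1 ≃ E_2 such that for every subset F ⊆ E_1, F is a forest of G_1 if and only if σ(F) is a forest of G_2. -/
open MvPolynomial

set_option synthInstance.maxHeartbeats 1000000
set_option maxHeartbeats 1000000

noncomputable section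

namespace PSIso

section Signs

variable {K V E ι : Type*} [Field K] [AddCommGroup V] [Module K V] [Fintype ι] [DecidableEq ι]

/-- A basis of `span (x '' S)` chosen among the `x f`, `f ∈ S`, with dual functionals. -/
structure Frame (x : E → V) (S : Set E) (b : ι → E) (l : ι → V →ₗ[K] K) : Prop where
  mem : ∀ i, b i ∈ S
  dual : ∀ i j, l i (x (b j)) = if i = j then 1 else 0
  span : ∀ z ∈ Submodule.span K (x '' S), ∑ i, l i z • x (b i) = z

theorem Frame.pivot {x : E → V} {S : Set E} {b : ι → E} {l : ι → V →ₗ[K] K}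
    (h : Frame x S b l) (i₀ : ι) (f₀ : E) (hf : f₀ ∈ S) (hA : l i₀ (x f₀) ≠ 0) :
    Frame x S (Function.update b i₀ f₀)
      (fun i => if i = i₀ then (l i₀ (x f₀))⁻¹ • l i₀
        else l i - (l i (x f₀) * (l i₀ (x f₀))⁻¹) • l i₀) := by
  refine ⟨?_, ?_, ?_⟩
  · intro i
    by_cases hi : i = i₀
    · subst hi; simpa using hf
    · simpa [Function.update_of_ne hi] using h.mem i
  · intro i j
    by_cases hj : j = i₀
    · subst hj
      by_cases hi : i = j
      · subst hi; simp [hA]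
      · simp [hi, hA]
    · by_cases hi : i = i₀
      · subst hi
        simp [Function.update_of_ne hj, h.dual, Ne.symm hj]
      · simp [Function.update_of_ne hj, h.dual, hi, Ne.symm hj]
  · intro z hz
    have h0 := h.span (x f₀) (Submodule.subset_span ⟨f₀, hf, rfl⟩)
    have h1 := h.span z hz
    have key : ∀ i, ((if i = i₀ then (l i₀ (x f₀))⁻¹ • l i₀
        else l i - (l i (x f₀) * (l i₀ (x f₀))⁻¹) • l i₀) z) • x (Function.update b i₀ f₀ i)
        = l i z • x (b i) - ((l i₀ (x f₀))⁻¹ * l i₀ z) • (l i (x f₀) • x (b i))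
          + if i = i₀ then ((l i₀ (x f₀))⁻¹ * l i₀ z) • x f₀ else 0 := by
      intro i
      by_cases hi : i = i₀
      · subst hi
        simp [smul_smul]
        rw [mul_right_comm, inv_mul_cancel₀ hA, one_mul, sub_self]
      · simp only [hi, if_false, Function.update_of_ne hi, LinearMap.sub_apply,
          LinearMap.smul_apply, smul_eq_mul, sub_smul, smul_smul, add_zero]
        congr 2; ring
    rw [Finset.sum_congr rfl fun i _ => key i, Finset.sum_add_distrib, Finset.sum_sub_distrib,
      ← Finset.smul_sum, h0, h1]
    simp

theorem no_walk {x : E → V} {S : Set E} {u t : V}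
    (H : ∀ (b : ι → E) (l : ι → V →ₗ[K] K), Frame x S b l → ∀ i, l i u = 0 ∨ l i t = 0) :
    ∀ (k : ℕ) (b : ι → E) (l : ι → V →ₗ[K] K), Frame x S b l → ∀ (s : ℕ → ι) (f : ℕ → E),
      (∀ j < k, f j ∈ S ∧ l (s j) (x (f j)) ≠ 0 ∧ l (s (j + 1)) (x (f j)) ≠ 0) →
      l (s 0) u ≠ 0 → l (s k) t ≠ 0 → False := by
  intro k
  induction k using Nat.strong_induction_on with
  | _ k ih =>
  intro b l hF s f hw hu ht
  rcases k with _ | k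
  · rcases H b l hF (s 0) with h | h <;> contradiction
  -- u vanishes at s 1
  have hu1 : l (s 1) u = 0 := by
    by_contra hne
    refine ih k (Nat.lt_succ_self k) b l hF (fun j => s (j + 1)) (fun j => f (j + 1)) ?_ hne ht
    intro j hj
    exact hw (j + 1) (by omega)
  have hf0 : ∀ j, 1 ≤ j → j < k + 1 → l (s 0) (x (f j)) = 0 := by
    intro j hj hjk
    by_contra hne
    refine ih (k + 1 - j) (by omega) b l hF (fun m => if m = 0 then s 0 else s (j + m))
      (fun m => f (j + m)) ?_ (by simpa using hu) ?_
    · intro m hm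
      obtain ⟨h1, h2, h3⟩ := hw (j + m) (by omega)
      refine ⟨h1, ?_, ?_⟩
      · by_cases hm0 : m = 0
        · subst hm0; simpa using hne
        · simpa [hm0] using h2
      · simpa [add_assoc] using h3
    · have h1 : k + 1 - j ≠ 0 := by omega
      have h2 : j + (k + 1 - j) = k + 1 := by omega
      simp only [h1, if_false, h2]
      exact ht
  obtain ⟨hfS, hA, hA1⟩ := hw 0 (by omega)
  have hs : ∀ j, 1 ≤ j → j ≤ k + 1 → s j ≠ s 0 := by
    intro j hj hjk he
    rcases Nat.lt_or_ge j (k + 1) with h | h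
    · have := (hw j h).2.1
      rw [he] at this
      exact this (hf0 j hj h)
    · have : j = k + 1 := by omega
      subst this
      rw [he] at ht
      rcases H b l hF (s 0) with h | h <;> contradiction
  have ht0 : l (s 0) t = 0 := (H b l hF (s 0)).resolve_left hu
  refine ih k (Nat.lt_succ_self k) _ _ (hF.pivot (s 0) (f 0) hfS hA) (fun j => s (j + 1))
    (fun j => f (j + 1)) ?_ ?_ ?_
  · intro j hj
    obtain ⟨h1, h2, h3⟩ := hw (j + 1) (by omega)
    refine ⟨h1, ?_, ?_⟩
    · simp [hs (j + 1) (by omega) (by omega), hf0 (j + 1) (by omega) (by omega), h2]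
    · simp [hs (j + 1 + 1) (by omega) (by omega), hf0 (j + 1) (by omega) (by omega), h3]
  · simp only [zero_add, hs 1 (by omega) (by omega), if_false, LinearMap.sub_apply, hu1,
      LinearMap.smul_apply, smul_eq_mul, zero_sub, ne_eq, neg_eq_zero, mul_eq_zero, inv_eq_zero,
      not_or]
    exact ⟨⟨hA1, hA⟩, hu⟩
  · simp [hs (k + 1) (by omega) (by omega), ht0, ht]

theorem exists_flip {x : E → V} {S : Set E} {u t : V}
    (hu : u ∈ Submodule.span K (x '' S)) (ht : t ∈ Submodule.span K (x '' S))
    (H : ∀ (b : ι → E) (l : ι → V →ₗ[K] K), Frame x S b l → ∀ i, l i u = 0 ∨ l i t = 0)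
    (b : ι → E) (l : ι → V →ₗ[K] K) (hF : Frame x S b l) :
    ∃ (θ : V →ₗ[K] V) (c : E → K), (∀ f, c f = 1 ∨ c f = -1) ∧
      (∀ f ∈ S, θ (x f) = c f • x f) ∧ θ u = -u ∧ θ t = t := by
  classical
  let R : Set ι := {i | ∃ (k : ℕ) (s : ℕ → ι) (f : ℕ → E),
    (∀ j < k, f j ∈ S ∧ l (s j) (x (f j)) ≠ 0 ∧ l (s (j + 1)) (x (f j)) ≠ 0) ∧
      l (s 0) u ≠ 0 ∧ s k = i}
  have hE : ∀ _i : ι, l _i u ≠ 0 → Nonempty E := fun i _ => ⟨b i⟩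
  have hR0 : ∀ i, l i u ≠ 0 → i ∈ R := fun i hi =>
    ⟨0, fun _ => i, fun _ => b i, by simp, hi, rfl⟩
  have hRt : ∀ i ∈ R, l i t = 0 := by
    rintro i ⟨k, s, f, hw, h0, rfl⟩
    by_contra hne
    exact no_walk H k b l hF s f hw h0 hne
  have hRs : ∀ i ∈ R, ∀ g ∈ S, l i (x g) ≠ 0 → ∀ j, l j (x g) ≠ 0 → j ∈ R := by
    rintro i ⟨k, s, f, hw, h0, rfl⟩ g hg hig j hj
    refine ⟨k + 1, fun m => if m ≤ k then s m else j, fun m => if m < k then f m else g, ?_, ?_, ?_⟩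
    · intro m hm
      rcases Nat.lt_or_ge m k with h | h
      · have h1 : m ≤ k := by omega
        have h2 : m + 1 ≤ k := by omega
        simpa [h, h1, h2] using hw m h
      · have : m = k := by omega
        subst this
        simp [hg, hig, hj]
    · simpa using h0
    · simp
  let sg : ι → K := fun i => if i ∈ R then -1 else 1
  let θ : V →ₗ[K] V := ∑ i, (LinearMap.toSpanSingleton K V (x (b i))).comp (sg i • l i)
  have hθ : ∀ z, θ z = ∑ i, (sg i * l i z) • x (b i) := by
    intro z; simp [θ]
  refine ⟨θ, fun f => if ∃ i ∈ R, l i (x f) ≠ 0 then -1 else 1, ?_, ?_, ?_, ?_⟩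
  · intro f
    by_cases h : ∃ i ∈ R, l i (x f) ≠ 0
    · right; simp only [h, if_true]
    · left; simp only [h, if_false]
  · intro f hf
    have hx := hF.span (x f) (Submodule.subset_span ⟨f, hf, rfl⟩)
    rw [hθ]
    conv_rhs => rw [← hx, Finset.smul_sum]
    refine Finset.sum_congr rfl fun i _ => ?_
    rw [smul_smul]
    congr 1
    by_cases hz : l i (x f) = 0
    · simp [hz]
    congr 1
    by_cases h : ∃ i ∈ R, l i (x f) ≠ 0
    · obtain ⟨j, hj, hjf⟩ := h
      have : i ∈ R := hRs j hj f hf hjf i hz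
      have h' : ∃ i ∈ R, l i (x f) ≠ 0 := ⟨j, hj, hjf⟩
      simp only [sg, this, if_true, h']
    · have : i ∉ R := fun hi => h ⟨i, hi, hz⟩
      simp only [sg, this, if_false, h]
  · have hx := hF.span u hu
    rw [hθ]
    conv_rhs => rw [← hx, ← Finset.sum_neg_distrib]
    refine Finset.sum_congr rfl fun i _ => ?_
    rw [← neg_smul]
    congr 1
    by_cases hz : l i u = 0
    · simp [hz]
    · simp [sg, hR0 i hz]
  · have hx := hF.span t ht
    rw [hθ]
    conv_rhs => rw [← hx]
    refine Finset.sum_congr rfl fun i _ => ?_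
    congr 1
    by_cases hz : i ∈ R
    · simp [hRt i hz]
    · simp [sg, hz]

/-- Dual functionals of a finite linearly independent family. -/
theorem exists_dual {z : ι → V} (hz : LinearIndependent K z) :
    ∃ l : ι → V →ₗ[K] K, ∀ i j, l i (z j) = if i = j then 1 else 0 := by
  obtain ⟨g, hg⟩ := LinearMap.exists_leftInverse_of_injective (Fintype.linearCombination K z)
    (by rw [LinearMap.ker_eq_bot]; exact LinearIndependent.fintypeLinearCombination_injective hz)
  refine ⟨fun i => (LinearMap.proj i).comp g, fun i j => ?_⟩
  have := LinearMap.congr_fun hg (Pi.single j 1)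
  simp at this
  simp [this, Pi.single_apply]

theorem li_of_dual {z : ι → V} (l : ι → V →ₗ[K] K)
    (h : ∀ i j, l i (z j) = if i = j then 1 else 0) : LinearIndependent K z := by
  rw [Fintype.linearIndependent_iff]
  intro g hg i
  have := congrArg (l i) hg
  simpa [h] using this

theorem Frame.li {x : E → V} {S : Set E} {b : ι → E} {l : ι → V →ₗ[K] K}
    (h : Frame x S b l) : LinearIndependent K (fun i => x (b i)) :=
  li_of_dual l h.dual

theorem exists_frame (x : E → V) (S : Finset E) :
    ∃ (r : ℕ) (b : Fin r → E) (l : Fin r → V →ₗ[K] K), Frame x (S : Set E) b l := by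
  classical
  have : FiniteDimensional K (Submodule.span K (x '' (S : Set E))) :=
    FiniteDimensional.span_of_finite K (S.finite_toSet.image x)
  obtain ⟨f, hf, hs, hl⟩ := Submodule.exists_fun_fin_finrank_span_eq K (x '' (S : Set E))
  choose b hb hbf using hf
  obtain ⟨l, hld⟩ := exists_dual hl
  refine ⟨_, b, l, hb, fun i j => by rw [hbf, hld], ?_⟩
  intro z hz
  rw [← hs, Submodule.mem_span_range_iff_exists_fun] at hz
  obtain ⟨c, rfl⟩ := hz
  simp [hbf, hld]

theorem li_update_iff {z : ι → V} (hz : LinearIndependent K z) (d : ι → K) (i : ι) (y : V)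
    (hy : y = ∑ j, d j • z j) : LinearIndependent K (Function.update z i y) ↔ d i ≠ 0 := by
  constructor
  · intro h h0
    rw [Fintype.linearIndependent_iff] at h
    have := h (Function.update d i (-1)) ?_ i
    · simp at this
    · rw [← Finset.add_sum_erase _ _ (Finset.mem_univ i)]
      rw [← Finset.add_sum_erase _ _ (Finset.mem_univ i), h0, zero_smul, zero_add] at hy
      simp only [Function.update_self, neg_smul, one_smul]
      rw [neg_add_eq_zero, hy]
      refine Finset.sum_congr rfl fun j hj => ?_
      have := Finset.ne_of_mem_erase hj
      simp [Function.update_of_ne this]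
  · intro h0
    refine hz.update i y ⟨1, by simp, Finsupp.equivFunOnFinite.symm d, by simpa using h0, ?_⟩
    rw [one_smul, hy, Finsupp.linearCombination_apply, Finsupp.sum_fintype _ _ (by simp)]
    simp

end Signs

section Signs2

variable {K V W E : Type*} [Field K] [CharZero K] [AddCommGroup V] [Module K V]
  [AddCommGroup W] [Module K W] [DecidableEq E]

theorem tri_of_mul {c d : K} (hc : c = 1 ∨ c = -1) (h : d * c = 0 ∨ d * c = 1 ∨ d * c = -1) :
    d = 0 ∨ d = 1 ∨ d = -1 := by
  rcases hc with rfl | rfl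
  · simpa using h
  · rcases h with h | h | h
    · left; simpa using h
    · right; right; linear_combination -h
    · right; left; linear_combination -h

theorem exists_signs (v : E → V) (w : E → W)
    (hM : ∀ (r : ℕ) (b : Fin r → E), LinearIndependent K (fun i => v (b i)) ↔
      LinearIndependent K (fun i => w (b i)))
    (hUv : ∀ (r : ℕ) (b : Fin r → E), LinearIndependent K (fun i => v (b i)) →
      ∀ (e : E) (d : Fin r → K), v e = ∑ i, d i • v (b i) → ∀ i, d i = 0 ∨ d i = 1 ∨ d i = -1)
    (hUw : ∀ (r : ℕ) (b : Fin r → E), LinearIndependent K (fun i => w (b i)) →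
      ∀ (e : E) (d : Fin r → K), w e = ∑ i, d i • w (b i) → ∀ i, d i = 0 ∨ d i = 1 ∨ d i = -1)
    (S : Finset E) :
    ∃ (c : E → K) (T : V →ₗ[K] W) (T' : W →ₗ[K] V), (∀ f, c f = 1 ∨ c f = -1) ∧
      ∀ f ∈ S, T (v f) = c f • w f ∧ T' (w f) = c f • v f := by
  induction S using Finset.induction_on with
  | empty => exact ⟨fun _ => 1, 0, 0, fun _ => Or.inl rfl, by simp⟩
  | insert e S heS ih =>
  obtain ⟨c, T, T', hc, hT⟩ := ih
  have hcc : ∀ f, c f * c f = 1 := fun f => by rcases hc f with h | h <;> simp [h]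
  obtain ⟨r, b, l, hF⟩ := exists_frame (K := K) v S
  have hTT : ∀ z ∈ Submodule.span K (v '' (S : Set E)), T z ∈ Submodule.span K (w '' (S : Set E)) ∧
      T' (T z) = z := by
    intro z hz
    induction hz using Submodule.span_induction with
    | mem z hz =>
      obtain ⟨f, hf, rfl⟩ := hz
      rw [(hT f hf).1]
      refine ⟨Submodule.smul_mem _ _ (Submodule.subset_span ⟨f, hf, rfl⟩), ?_⟩
      rw [map_smul, (hT f hf).2, smul_smul, hcc, one_smul]
    | zero => simp
    | add x y _ _ hx hy => exact ⟨by simpa using add_mem hx.1 hy.1, by simp [hx.2, hy.2]⟩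
    | smul a x _ hx => exact ⟨by simpa using Submodule.smul_mem _ a hx.1, by simp [hx.2]⟩
  have hTT' : ∀ z ∈ Submodule.span K (w '' (S : Set E)), T' z ∈ Submodule.span K (v '' (S : Set E)) ∧
      T (T' z) = z := by
    intro z hz
    induction hz using Submodule.span_induction with
    | mem z hz =>
      obtain ⟨f, hf, rfl⟩ := hz
      rw [(hT f hf).2]
      refine ⟨Submodule.smul_mem _ _ (Submodule.subset_span ⟨f, hf, rfl⟩), ?_⟩
      rw [map_smul, (hT f hf).1, smul_smul, hcc, one_smul]
    | zero => simp
    | add x y _ _ hx hy => exact ⟨by simpa using add_mem hx.1 hy.1, by simp [hx.2, hy.2]⟩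
    | smul a x _ hx => exact ⟨by simpa using Submodule.smul_mem _ a hx.1, by simp [hx.2]⟩
  have hsv : Submodule.span K (Set.range fun i => v (b i)) = Submodule.span K (v '' (S : Set E)) := by
    apply le_antisymm
    · rw [Submodule.span_le]
      rintro _ ⟨i, rfl⟩
      exact Submodule.subset_span ⟨b i, hF.mem i, rfl⟩
    · intro z hz
      rw [← hF.span z hz]
      exact Submodule.sum_mem _ fun i _ => Submodule.smul_mem _ _ (Submodule.subset_span ⟨i, rfl⟩)
  have hsw : Submodule.span K (Set.range fun i => w (b i)) = Submodule.span K (w '' (S : Set E)) := by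
    apply le_antisymm
    · rw [Submodule.span_le]
      rintro _ ⟨i, rfl⟩
      exact Submodule.subset_span ⟨b i, hF.mem i, rfl⟩
    · intro z hz
      obtain ⟨h1, h2⟩ := hTT' z hz
      rw [← h2, ← hF.span _ h1, map_sum]
      refine Submodule.sum_mem _ fun i _ => ?_
      rw [map_smul, (hT (b i) (hF.mem i)).1]
      exact Submodule.smul_mem _ _ (Submodule.smul_mem _ _ (Submodule.subset_span ⟨i, rfl⟩))
  have hliw : LinearIndependent K (fun i => w (b i)) := (hM r b).1 hF.li
  have hev : v e ∈ Submodule.span K (v '' (S : Set E)) ↔ w e ∈ Submodule.span K (w '' (S : Set E)) := by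
    have h := hM (r + 1) (Fin.cons e b)
    have e1 : (fun i => v ((Fin.cons e b : Fin (r + 1) → E) i)) = Fin.cons (v e) fun i => v (b i) := by
      funext i; refine Fin.cases ?_ (fun j => ?_) i <;> simp
    have e2 : (fun i => w ((Fin.cons e b : Fin (r + 1) → E) i)) = Fin.cons (w e) fun i => w (b i) := by
      funext i; refine Fin.cases ?_ (fun j => ?_) i <;> simp
    rw [e1, e2, linearIndependent_finCons, linearIndependent_finCons, hsv, hsw] at h
    have := hF.li
    tauto
  by_cases hve : v e ∈ Submodule.span K (v '' (S : Set E))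
  · have hwe := hev.1 hve
    obtain ⟨hy, hTy⟩ := hTT' _ hwe
    set y := T' (w e) with hydef
    obtain ⟨θ, c', hc', hθ, hθu, hθt⟩ := exists_flip (K := K) (x := v) (S := (S : Set E))
      (u := v e - y) (t := v e + y) (sub_mem hve hy) (add_mem hve hy) (by
        intro b l hF i
        have hliw : LinearIndependent K (fun i => w (b i)) := (hM r b).1 hF.li
        have h1 := (hF.span _ hve).symm
        have h2 : w e = ∑ i, (l i y * c (b i)) • w (b i) := by
          rw [← hTy]
          conv_lhs => rw [← hF.span _ hy, map_sum]
          refine Finset.sum_congr rfl fun i _ => ?_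
          rw [map_smul, (hT (b i) (hF.mem i)).1, smul_smul]
        have t1 := hUv r b hF.li e _ h1 i
        have t2 := tri_of_mul (hc (b i)) (hUw r b hliw e _ h2 i)
        have s1 := li_update_iff hF.li _ i _ h1
        have s2 := li_update_iff hliw _ i _ h2
        have hm := hM r (Function.update b i e)
        have e1 : (fun j => v (Function.update b i e j)) = Function.update (fun j => v (b j)) i (v e) := by
          funext j; by_cases hj : j = i
          · subst hj; simp
          · simp [hj]
        have e2 : (fun j => w (Function.update b i e j)) = Function.update (fun j => w (b j)) i (w e) := by
          funext j; by_cases hj : j = i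
          · subst hj; simp
          · simp [hj]
        rw [e1, e2, s1, s2] at hm
        have hcb : c (b i) ≠ 0 := by rcases hc (b i) with h | h <;> simp [h]
        have hm' : l i (v e) ≠ 0 ↔ l i y ≠ 0 := by rw [hm]; simp [hcb]
        rw [map_sub, map_add]
        by_cases hz : l i y = 0
        · have hz' : l i (v e) = 0 := by
            by_contra hne
            exact hm'.1 hne hz
          left; rw [hz, hz', sub_zero]
        · have hz' := hm'.2 hz
          have t1' := t1.resolve_left hz'
          have t2' := t2.resolve_left hz
          rcases t1' with t1 | t1 <;> rcases t2' with t2 | t2 <;> rw [t1, t2]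
          · left; ring
          · right; ring
          · right; ring
          · left; ring) b l hF
    have hve' : θ (v e) = y := by
      have h2 : (2 : K) • θ (v e) = (2 : K) • y := by
        have : θ (v e - y) + θ (v e + y) = (2 : K) • y := by
          rw [hθu, hθt, two_smul]; abel
        rw [← this, two_smul, map_sub, map_add]; abel
      exact smul_right_injective V (two_ne_zero (α := K)) h2
    have hy' : θ y = v e := by
      have := hθt
      rw [map_add, hve'] at this
      rw [add_comm (v e)] at this
      exact add_left_cancel this
    refine ⟨Function.update (fun f => c f * c' f) e 1, T.comp θ, θ.comp T', ?_, ?_⟩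
    · intro f
      by_cases hf : f = e
      · subst hf; simp
      · simp only [Function.update_of_ne hf]
        rcases hc f with h | h <;> rcases hc' f with h' | h' <;> simp [h, h']
    · intro f hf
      rcases Finset.mem_insert.1 hf with rfl | hf
      · simp [hve', hTy, ← hydef, hy']
      · have hne : f ≠ e := fun h => heS (h ▸ hf)
        simp [Function.update_of_ne hne, hθ f hf, (hT f hf).1, (hT f hf).2, smul_smul, mul_comm]
  · have hwe : w e ∉ Submodule.span K (w '' (S : Set E)) := fun h => hve (hev.2 h)
    obtain ⟨g, hg, hgk⟩ := Submodule.exists_le_ker_of_notMem hve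
    obtain ⟨g', hg', hgk'⟩ := Submodule.exists_le_ker_of_notMem hwe
    refine ⟨Function.update c e 1,
      T + (LinearMap.toSpanSingleton K W ((g (v e))⁻¹ • (w e - T (v e)))).comp g,
      T' + (LinearMap.toSpanSingleton K V ((g' (w e))⁻¹ • (v e - T' (w e)))).comp g', ?_, ?_⟩
    · intro f
      by_cases hf : f = e
      · subst hf; simp
      · simpa [Function.update_of_ne hf] using hc f
    · intro f hf
      rcases Finset.mem_insert.1 hf with rfl | hf
      · simp [smul_smul, hg, hg']
      · have hne : f ≠ e := fun h => heS (h ▸ hf)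
        have k1 : g (v f) = 0 := hgk (Submodule.subset_span ⟨f, hf, rfl⟩)
        have k2 : g' (w f) = 0 := hgk' (Submodule.subset_span ⟨f, hf, rfl⟩)
        simp [Function.update_of_ne hne, k1, k2, (hT f hf).1, (hT f hf).2]

end Signs2

end PSIso
namespace PSIso

section Graph

variable {K : Type*} [Field K] {n : ℕ} {E : Type*}

/-- The edge vector over `K`. -/
def vK (K : Type*) [Field K] {n : ℕ} {E : Type*} (a b : E → Fin n) (e : E) : Fin n → K :=
  Pi.single (a e) 1 - Pi.single (b e) 1

theorem dual_vK (a b : E → Fin n) (e : E) (l : (Fin n → K) →ₗ[K] K) :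
    l (vK K a b e) = l (Pi.single (a e) 1) - l (Pi.single (b e) 1) := by
  simp [vK]

theorem lc_vK (a b : E → Fin n) (e : E) (p : Fin n → K) :
    Fintype.linearCombination K p (vK K a b e) = p (a e) - p (b e) := by
  rw [dual_vK]; simp

theorem vK_rat (a b : E → Fin n) (e : E) : edgeVec a b e = vK ℚ a b e := by
  funext i
  simp [edgeVec, vK, Pi.single_apply, eq_comm]

theorem li_iff_surj (a b : E → Fin n) (F : Finset E) :
    LinearIndependent K (fun e : F => vK K a b e) ↔
      ∀ y : E → K, ∃ p : Fin n → K, ∀ e ∈ F, p (a e) - p (b e) = y e := by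
  classical
  constructor
  · intro h y
    obtain ⟨l, hl⟩ := exists_dual h
    refine ⟨fun j => ∑ f : F, y f * l f (Pi.single j 1), fun e he => ?_⟩
    rw [← Finset.sum_sub_distrib]
    have : ∀ f : F, y f * l f (Pi.single (a e) 1) - y f * l f (Pi.single (b e) 1)
        = if f = ⟨e, he⟩ then y e else 0 := by
      intro f
      rw [← mul_sub, ← dual_vK, hl f ⟨e, he⟩]
      by_cases hf : f = ⟨e, he⟩
      · subst hf; simp
      · simp [hf]
    rw [Finset.sum_congr rfl fun f _ => this f]
    simp
  · intro h
    choose p hp using fun e : F => h (fun f => if (e : E) = f then 1 else 0)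
    refine li_of_dual (fun e => Fintype.linearCombination K (p e)) fun i j => ?_
    rw [lc_vK, hp i j j.2]
    by_cases hij : i = j
    · simp [hij]
    · have : (i : E) ≠ j := fun h => hij (Subtype.ext h)
      simp [hij, this]

theorem isForest_iff_li [CharZero K] (a b : E → Fin n) (F : Finset E) :
    IsForest a b F ↔ LinearIndependent K (fun e : F => vK K a b e) := by
  classical
  have h0 : IsForest a b F ↔ LinearIndependent ℚ (fun e : F => vK ℚ a b e) := by
    unfold IsForest; simp only [vK_rat]
  rw [h0]
  constructor
  · intro h
    have h' := (li_iff_surj a b F).1 h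
    choose p hp using fun e : F => h' (fun f => if (e : E) = f then 1 else 0)
    refine li_of_dual (fun e => Fintype.linearCombination K (fun j => (p e j : K))) fun i j => ?_
    rw [lc_vK]
    have := congrArg (fun q : ℚ => (q : K)) (hp i j j.2)
    push_cast at this
    rw [this]
    clear this
    by_cases hij : i = j
    · simp [hij]
    · have : (i : E) ≠ j := fun h => hij (Subtype.ext h)
      simp [hij, this]
  · intro h
    rw [Fintype.linearIndependent_iff] at h ⊢
    intro g hg i
    have := h (fun e => (g e : K)) ?_ i
    · exact_mod_cast this
    · funext j
      have hj := congrArg (fun q : ℚ => (q : K)) (congrFun hg j)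
      simp only [Finset.sum_apply, Pi.smul_apply, smul_eq_mul, Pi.zero_apply, vK, Pi.sub_apply,
        Pi.single_apply] at hj ⊢
      simpa [apply_ite (fun q : ℚ => (q : K))] using hj

theorem isForest_iff_surj [CharZero K] (a b : E → Fin n) (F : Finset E) :
    IsForest a b F ↔ ∀ y : E → K, ∃ p : Fin n → K, ∀ e ∈ F, p (a e) - p (b e) = y e :=
  (isForest_iff_li a b F).trans (li_iff_surj a b F)

theorem unimodular (a b : E → Fin n) (r : ℕ) (s : Fin r → E)
    (hs : LinearIndependent K (fun i => vK K a b (s i))) (e : E) (d : Fin r → K)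
    (hd : vK K a b e = ∑ i, d i • vK K a b (s i)) (i : Fin r) : d i = 0 ∨ d i = 1 ∨ d i = -1 := by
  classical
  obtain ⟨l, hl⟩ := exists_dual hs
  let p : Fin n → K := fun j => l i (Pi.single j 1)
  have hp : ∀ j, p (a (s j)) - p (b (s j)) = if i = j then 1 else 0 := by
    intro j; rw [← hl i j, dual_vK]
  let q : Fin n → K := fun j => if p j = p (a (s i)) then 1 else 0
  have hq : ∀ j, q (a (s j)) - q (b (s j)) = if i = j then 1 else 0 := by
    intro j
    by_cases hj : i = j
    · subst hj
      have h1 := hp i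
      rw [if_pos rfl] at h1
      have h2 : p (b (s i)) ≠ p (a (s i)) := by
        intro h; rw [h] at h1; simp at h1
      simp [q, h2]
    · have h1 := hp j
      rw [if_neg hj, sub_eq_zero] at h1
      simp [q, h1, hj]
  have h := congrArg (Fintype.linearCombination K q) hd
  rw [lc_vK, map_sum] at h
  simp only [map_smul, lc_vK, hq] at h
  simp at h
  rw [← h]
  by_cases h1 : p (a e) = p (a (s i)) <;> by_cases h2 : p (b e) = p (a (s i)) <;> simp [q, h1, h2]

theorem li_fin_iff {E : Type*} {V : Type*} [AddCommGroup V] [Module K V] [DecidableEq E] (v : E → V)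
    (r : ℕ) (s : Fin r → E) : LinearIndependent K (fun i => v (s i)) ↔
      Function.Injective s ∧ LinearIndependent K (fun e : Finset.univ.image s => v e) := by
  constructor
  · intro h
    have hs : Function.Injective s := by
      intro i j hij
      exact h.injective (by simp [hij])
    refine ⟨hs, ?_⟩
    let ε : Fin r ≃ Finset.univ.image s := Equiv.ofBijective
      (fun i => ⟨s i, Finset.mem_image_of_mem _ (Finset.mem_univ i)⟩)
      ⟨fun i j h => hs (by simpa using h), by
        rintro ⟨e, he⟩
        obtain ⟨i, _, rfl⟩ := Finset.mem_image.1 he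
        exact ⟨i, rfl⟩⟩
    exact (linearIndependent_equiv ε).1 h
  · rintro ⟨hs, h⟩
    exact h.comp (fun i : Fin r => (⟨s i, Finset.mem_image_of_mem _ (Finset.mem_univ i)⟩ :
      (Finset.univ.image s : Finset E))) (fun i j h => hs (by simpa using h))

theorem exists_scaling [CharZero K] {n₁ n₂ : ℕ} {E₁ E₂ : Type*}
    [Fintype E₁] [DecidableEq E₁] [DecidableEq E₂]
    (a₁ b₁ : E₁ → Fin n₁) (a₂ b₂ : E₂ → Fin n₂) (σ : E₁ ≃ E₂)
    (hσ : ∀ F : Finset E₁, IsForest a₁ b₁ F ↔ IsForest a₂ b₂ (F.map σ.toEmbedding)) :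
    ∃ c : E₁ → K, (∀ e, c e * c e = 1) ∧
      (∀ p : Fin n₁ → K, ∃ q : Fin n₂ → K, ∀ e, q (a₂ (σ e)) - q (b₂ (σ e)) =
        c e * (p (a₁ e) - p (b₁ e))) ∧
      (∀ q : Fin n₂ → K, ∃ p : Fin n₁ → K, ∀ e, p (a₁ e) - p (b₁ e) =
        c e * (q (a₂ (σ e)) - q (b₂ (σ e)))) := by
  obtain ⟨c, T, T', hc, hT⟩ := exists_signs (K := K) (vK K a₁ b₁) (fun e => vK K a₂ b₂ (σ e))
    (by
      intro r s
      rw [li_fin_iff (vK K a₁ b₁) r s, li_fin_iff (vK K a₂ b₂) r (fun i => σ (s i)),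
        ← isForest_iff_li, ← isForest_iff_li, hσ]
      have h1 : Function.Injective (fun i => σ (s i)) ↔ Function.Injective s :=
        σ.injective.of_comp_iff s
      have h2 : (Finset.univ.image s).map σ.toEmbedding = Finset.univ.image fun i => σ (s i) := by
        ext; simp [Equiv.eq_symm_apply]
      rw [h1, h2])
    (unimodular a₁ b₁)
    (fun r s hs e d hd i => unimodular a₂ b₂ r (fun i => σ (s i)) hs (σ e) d hd i)
    Finset.univ
  refine ⟨c, fun e => by rcases hc e with h | h <;> simp [h], ?_, ?_⟩
  · intro p
    refine ⟨fun j => Fintype.linearCombination K p (T' (Pi.single j 1)), fun e => ?_⟩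
    have := dual_vK a₂ b₂ (σ e) ((Fintype.linearCombination K p).comp T')
    simp only [LinearMap.comp_apply] at this
    rw [← this, (hT e (Finset.mem_univ e)).2, map_smul, lc_vK, smul_eq_mul]
  · intro p
    refine ⟨fun j => Fintype.linearCombination K p (T (Pi.single j 1)), fun e => ?_⟩
    have := dual_vK a₁ b₁ e ((Fintype.linearCombination K p).comp T)
    simp only [LinearMap.comp_apply] at this
    rw [← this, (hT e (Finset.mem_univ e)).1, map_smul, lc_vK, smul_eq_mul]

end Graph

end PSIso
namespace PSIso

section Alg

variable {K : Type*} [Field K] {E : Type*}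

/-- The generator `φ_e`. -/
def phi (K : Type*) [Field K] {E : Type*} (e : E) : PhiAlg K E (fun _ => (0 : K)) :=
  Ideal.Quotient.mk _ (X e)

theorem phi_sq (e : E) : phi K e ^ 2 = 0 := by
  unfold phi
  rw [← map_pow, Ideal.Quotient.eq_zero_iff_mem]
  refine Ideal.subset_span ⟨e, ?_⟩
  simp

theorem relIdeal_le_ker {A : Type*} [CommRing A] [Algebra K A] (g : E → A) (hg : ∀ e, g e ^ 2 = 0)
    (p : MvPolynomial E K) (hp : p ∈ relIdeal K E (fun _ => (0 : K))) : aeval g p = 0 := by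
  have : relIdeal K E (fun _ => (0 : K)) ≤ RingHom.ker (aeval (R := K) g) := by
    unfold relIdeal
    rw [Ideal.span_le]
    rintro _ ⟨e, rfl⟩
    simp [RingHom.mem_ker, hg]
  exact this hp

/-- The universal property of `Φ`. -/
def liftPhi {A : Type*} [CommRing A] [Algebra K A] (g : E → A) (hg : ∀ e, g e ^ 2 = 0) :
    PhiAlg K E (fun _ => (0 : K)) →ₐ[K] A :=
  Ideal.Quotient.liftₐ _ (aeval g) (relIdeal_le_ker g hg)

theorem liftPhi_mk {A : Type*} [CommRing A] [Algebra K A] (g : E → A) (hg : ∀ e, g e ^ 2 = 0)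
    (p : MvPolynomial E K) : liftPhi g hg (Ideal.Quotient.mk _ p) = aeval g p := rfl

theorem liftPhi_phi {A : Type*} [CommRing A] [Algebra K A] (g : E → A) (hg : ∀ e, g e ^ 2 = 0)
    (e : E) : liftPhi g hg (phi K e) = g e := by
  rw [phi, liftPhi_mk, aeval_X]

theorem phi_hom_ext {A : Type*} [CommRing A] [Algebra K A]
    {f g : PhiAlg K E (fun _ => (0 : K)) →ₐ[K] A} (h : ∀ e, f (phi K e) = g (phi K e)) : f = g := by
  apply Ideal.Quotient.algHom_ext
  apply MvPolynomial.algHom_ext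
  intro e
  exact h e

/-- The scaling isomorphism. -/
def scaleEquiv {E₁ E₂ : Type*} (σ : E₁ ≃ E₂) (c : E₁ → K) (hc : ∀ e, c e * c e = 1) :
    PhiAlg K E₁ (fun _ => (0 : K)) ≃ₐ[K] PhiAlg K E₂ (fun _ => (0 : K)) :=
  AlgEquiv.ofAlgHom
    (liftPhi (fun e => c e • phi K (σ e)) (fun e => by rw [smul_pow, phi_sq, smul_zero]))
    (liftPhi (fun e => c (σ.symm e) • phi K (σ.symm e))
      (fun e => by rw [smul_pow, phi_sq, smul_zero]))
    (phi_hom_ext fun e => by simp [liftPhi_phi, smul_smul, hc])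
    (phi_hom_ext fun e => by simp [liftPhi_phi, smul_smul, hc])

theorem scaleEquiv_phi {E₁ E₂ : Type*} (σ : E₁ ≃ E₂) (c : E₁ → K) (hc : ∀ e, c e * c e = 1)
    (e : E₁) : scaleEquiv σ c hc (phi K e) = c e • phi K (σ e) :=
  liftPhi_phi _ (fun e => by rw [smul_pow, phi_sq, smul_zero]) e

variable {n : ℕ} [Fintype E]

/-- The linear form attached to a potential. -/
def XL (a b : E → Fin n) (p : Fin n → K) : PhiAlg K E (fun _ => (0 : K)) :=
  ∑ e, (p (a e) - p (b e)) • phi K e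

theorem XX_eq (a b : E → Fin n) (i : Fin n) : XX K a b (fun _ => (0 : K)) i = XL a b (Pi.single i 1) := by
  unfold XX XL
  rw [map_sub, map_sum, map_sum, Finset.sum_filter, Finset.sum_filter, ← Finset.sum_sub_distrib]
  refine Finset.sum_congr rfl fun e _ => ?_
  simp only [Pi.single_apply, sub_smul, ite_smul, one_smul, zero_smul]
  rfl

theorem XL_eq (a b : E → Fin n) (p : Fin n → K) :
    XL a b p = ∑ i, p i • XX K a b (fun _ => (0 : K)) i := by
  simp only [XX_eq, XL, Finset.smul_sum, smul_smul]
  rw [Finset.sum_comm]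
  refine Finset.sum_congr rfl fun e _ => ?_
  rw [← Finset.sum_smul]
  congr 1
  simp [mul_sub, Pi.single_apply]

theorem XL_mem (a b : E → Fin n) (p : Fin n → K) : XL a b p ∈ PsiAlg K a b (fun _ => (0 : K)) := by
  rw [XL_eq]
  refine Subalgebra.sum_mem _ fun i _ => Subalgebra.smul_mem _ ?_ _
  unfold PsiAlg
  exact Algebra.subset_adjoin (Set.mem_range_self i)

/-- `XL` as a linear map into `C_G`. -/
def xl (a b : E → Fin n) : (Fin n → K) →ₗ[K] PsiAlg K a b (fun _ => (0 : K)) where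
  toFun p := ⟨XL a b p, XL_mem a b p⟩
  map_add' p q := by
    apply Subtype.ext
    change XL a b (p + q) = XL a b p + XL a b q
    simp only [XL, ← Finset.sum_add_distrib, ← add_smul]
    refine Finset.sum_congr rfl fun e _ => ?_
    congr 1
    simp only [Pi.add_apply]; ring
  map_smul' r p := by
    apply Subtype.ext
    change XL a b (r • p) = r • XL a b p
    simp only [XL, Finset.smul_sum, smul_smul]
    refine Finset.sum_congr rfl fun e _ => ?_
    congr 1
    simp only [Pi.smul_apply, smul_eq_mul]; ring

theorem iso_of_scaling {n₁ n₂ : ℕ} {E₁ E₂ : Type*} [Fintype E₁] [Fintype E₂]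
    (a₁ b₁ : E₁ → Fin n₁) (a₂ b₂ : E₂ → Fin n₂) (σ : E₁ ≃ E₂) (c : E₁ → K)
    (hc : ∀ e, c e * c e = 1)
    (h1 : ∀ p : Fin n₁ → K, ∃ q : Fin n₂ → K, ∀ e, q (a₂ (σ e)) - q (b₂ (σ e)) =
        c e * (p (a₁ e) - p (b₁ e)))
    (h2 : ∀ q : Fin n₂ → K, ∃ p : Fin n₁ → K, ∀ e, p (a₁ e) - p (b₁ e) =
        c e * (q (a₂ (σ e)) - q (b₂ (σ e)))) :
    Nonempty ((PsiAlg K a₁ b₁ fun _ => (0 : K)) ≃ₐ[K] (PsiAlg K a₂ b₂ fun _ => (0 : K))) := by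
  let Θ := scaleEquiv σ c hc
  have k1 : ∀ p q, (∀ e, q (a₂ (σ e)) - q (b₂ (σ e)) = c e * (p (a₁ e) - p (b₁ e))) →
      Θ (XL a₁ b₁ p) = XL a₂ b₂ q := by
    intro p q h
    simp only [XL, map_sum, map_smul, Θ, scaleEquiv_phi, smul_smul]
    rw [← σ.sum_comp]
    refine Finset.sum_congr rfl fun e _ => ?_
    rw [h, mul_comm]
  have hmap : (PsiAlg K a₁ b₁ fun _ => (0 : K)).map (Θ : _ →ₐ[K] _) =
      PsiAlg K a₂ b₂ fun _ => (0 : K) := by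
    apply le_antisymm
    · rw [Subalgebra.map_le]
      refine Algebra.adjoin_le ?_
      rintro _ ⟨i, rfl⟩
      obtain ⟨q, hq⟩ := h1 (Pi.single i 1)
      change Θ (XX K a₁ b₁ _ i) ∈ PsiAlg K a₂ b₂ _
      rw [XX_eq, k1 _ _ hq]
      exact XL_mem _ _ _
    · refine Algebra.adjoin_le ?_
      rintro _ ⟨i, rfl⟩
      obtain ⟨p, hp⟩ := h2 (Pi.single i 1)
      refine ⟨XL a₁ b₁ p, XL_mem _ _ _, ?_⟩
      rw [XX_eq]
      refine k1 _ _ fun e => ?_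
      rw [hp, ← mul_assoc, hc, one_mul]
  exact ⟨(Θ.subalgebraMap _).trans (Subalgebra.equivOfEq _ _ hmap)⟩

end Alg

end PSIso
namespace PSIso

section Weight

open DualNumber

theorem add_pow_sq_zero {A : Type*} [CommRing A] (x y : A) (hy : y ^ 2 = 0) (m : ℕ) :
    (x + y) ^ (m + 1) = x ^ (m + 1) + (m + 1 : ℕ) * x ^ m * y := by
  induction m with
  | zero => simp
  | succ m ih =>
    rw [pow_succ, ih]
    push_cast
    linear_combination ((m + 1 : A) * x ^ m) * hy

variable {K : Type*} [Field K] {E : Type*}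

theorem sum_pow_zero (c : E → K) (S : Finset E) :
    (∑ e ∈ S, c e • phi K e) ^ (S.card + 1) = 0 := by
  classical
  induction S using Finset.induction_on with
  | empty => simp
  | insert e S he ih =>
    rw [Finset.sum_insert he, Finset.card_insert_of_notMem he, add_comm (c e • phi K e),
      add_pow_sq_zero _ _ (by rw [smul_pow, phi_sq, smul_zero]), pow_succ, ih]
    simp

/-- The tangent direction at `e`. -/
def linHom (K : Type*) [Field K] {E : Type*} [DecidableEq E] (e : E) :
    PhiAlg K E (fun _ => (0 : K)) →ₐ[K] K[ε] :=
  liftPhi (fun f => if f = e then ε else 0) (fun f => by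
    by_cases h : f = e <;> simp [h, pow_two])

theorem linHom_phi [DecidableEq E] (e f : E) : linHom K e (phi K f) = if f = e then ε else 0 :=
  liftPhi_phi _ (fun f => by by_cases h : f = e <;> simp [h, pow_two]) f

theorem linHom_mk [DecidableEq E] (e : E) (p : MvPolynomial E K) :
    (linHom K e (Ideal.Quotient.mk _ p)).fst = constantCoeff p ∧
    (linHom K e (Ideal.Quotient.mk _ p)).snd = constantCoeff (pderiv e p) := by
  have h : linHom K e (Ideal.Quotient.mk _ p) = aeval (fun f => if f = e then ε else 0) p := rfl
  rw [h]
  clear h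
  induction p using MvPolynomial.induction_on with
  | C a => simp [algebraMap_eq, TrivSqZeroExt.algebraMap_eq_inl]
  | add p q hp hq => simp [hp.1, hp.2, hq.1, hq.2]
  | mul_X p f hp =>
    by_cases hf : f = e
    · subst hf
      simp [hp.1, hp.2]
    · simp [hp.1, hp.2, hf, pderiv_X_of_ne hf]

theorem coeff_relIdeal (p : MvPolynomial E K) (hp : p ∈ relIdeal K E (fun _ => (0 : K)))
    (m : E →₀ ℕ) (hm : ∀ e, m e ≤ 1) : coeff m p = 0 := by
  have h : relIdeal K E (fun _ => (0 : K)) =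
      Ideal.span ((fun s => monomial s (1 : K)) '' Set.range fun e : E => Finsupp.single e 2) := by
    unfold relIdeal
    rw [← Set.range_comp]
    congr 2
    funext e
    simp [X_pow_eq_monomial]
  rw [h, mem_ideal_span_monomial_image] at hp
  by_contra hne
  obtain ⟨_, ⟨e, rfl⟩, hle⟩ := hp m (mem_support_iff.2 hne)
  have := hle e
  simp at this
  have := hm e
  omega

/-- Iterated partial derivative. -/
def dl : List E → MvPolynomial E K → MvPolynomial E K
  | [], p => p
  | e :: L, p => dl L (pderiv e p)

theorem dl_zero (L : List E) (hL : L.Nodup) : ∀ (p : MvPolynomial E K),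
    (∀ m : E →₀ ℕ, (∀ e ∈ L, m e = 1) → (∀ e, e ∉ L → m e = 0) → coeff m p = 0) →
    constantCoeff (dl L p) = 0 := by
  classical
  induction L with
  | nil => intro p h; exact h 0 (by simp) (by simp)
  | cons e L ih =>
    intro p h
    rw [List.nodup_cons] at hL
    refine ih hL.2 _ fun m h1 h2 => ?_
    rw [coeff_pderiv, h, zero_mul]
    · intro f hf
      by_cases hfe : f = e
      · subst hfe; simp [h2 f hL.1]
      · have : f ∈ L := by simpa [hfe] using hf
        simp [h1 f this, Ne.symm hfe]
    · intro f hf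
      simp only [List.mem_cons, not_or] at hf
      simp [h2 f hf.2, Ne.symm hf.1]

theorem dl_pow (p : MvPolynomial E K) (hp : constantCoeff p = 0) (L : List E) :
    ∀ q : MvPolynomial E K, constantCoeff (dl L (p ^ L.length * q)) =
      (L.length.factorial : K) * (L.map fun e => constantCoeff (pderiv e p)).prod *
        constantCoeff q := by
  induction L with
  | nil => intro q; simp [dl]
  | cons e L ih =>
    intro q
    have : pderiv e (p ^ (e :: L).length * q) =
        p ^ L.length * (((L.length + 1 : ℕ) : MvPolynomial E K) * pderiv e p * q + p * pderiv e q) := by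
      rw [pderiv_mul, pderiv_pow]
      simp only [List.length_cons, Nat.add_sub_cancel]
      ring
    rw [dl, this, ih]
    simp only [map_add, map_mul, hp, map_natCast, List.length_cons, Nat.factorial_succ,
      List.map_cons, List.prod_cons]
    push_cast
    ring

theorem card_lt_of_pow [CharZero K] [DecidableEq E] (z : PhiAlg K E (fun _ => (0 : K))) (k : ℕ)
    (hz : z ^ k = 0) (S : Finset E) (hS : ∀ e ∈ S, (linHom K e z).snd ≠ 0) : S.card < k := by
  by_contra hk
  push Not at hk
  obtain ⟨p, rfl⟩ := Ideal.Quotient.mk_surjective z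
  have hz' := pow_eq_zero_of_le hk hz
  rw [← map_pow, Ideal.Quotient.eq_zero_iff_mem] at hz hz'
  have h0 : constantCoeff p = 0 := by
    have := coeff_relIdeal _ hz 0 (by simp)
    rw [← constantCoeff_eq, map_pow] at this
    exact eq_zero_of_pow_eq_zero this
  have h1 := dl_zero S.toList S.nodup_toList (p ^ S.card) (by
    intro m hm1 hm2
    refine coeff_relIdeal _ hz' m fun e => ?_
    by_cases he : e ∈ S.toList
    · rw [hm1 e he]
    · rw [hm2 e he]; omega)
  have h2 := dl_pow p h0 S.toList 1
  rw [Finset.length_toList, mul_one, h1] at h2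
  simp only [map_one, mul_one] at h2
  have := (mul_eq_zero.1 h2.symm).resolve_left (by exact_mod_cast Nat.factorial_ne_zero _)
  rw [List.prod_eq_zero_iff] at this
  simp only [List.mem_map, Finset.mem_toList] at this
  obtain ⟨e, he, h3⟩ := this
  refine hS e he ?_
  rw [(linHom_mk e p).2, h3]

variable {n : ℕ} [Fintype E]

theorem linHom_XL [DecidableEq E] (a b : E → Fin n) (p : Fin n → K) (e : E) :
    (linHom K e (XL a b p)).snd = p (a e) - p (b e) := by
  unfold XL
  simp only [map_sum, map_smul, linHom_phi]
  rw [← TrivSqZeroExt.sndHom_apply K K]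
  simp [map_sum, apply_ite]

theorem XL_pow (a b : E → Fin n) (p : Fin n → K) (S : Finset E)
    (hS : ∀ e, e ∉ S → p (a e) - p (b e) = 0) : XL a b p ^ (S.card + 1) = 0 := by
  have : XL a b p = ∑ e ∈ S, (p (a e) - p (b e)) • phi K e := by
    unfold XL
    symm
    refine Finset.sum_subset (Finset.subset_univ S) fun e _ he => ?_
    rw [hS e he, zero_smul]
  rw [this, sum_pow_zero]

theorem xl_nilpotent (a b : E → Fin n) (p : Fin n → K) : IsNilpotent (xl a b p) :=
  ⟨Finset.univ.card + 1, Subtype.ext (XL_pow a b p Finset.univ (by simp))⟩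

theorem tangent (a b : E → Fin n) (z : PsiAlg K a b (fun _ => (0 : K))) :
    ∃ (c : K) (q : Fin n → K), ∀ d : PsiAlg K a b (fun _ => (0 : K)) →ₐ[K] K[ε],
      (d z).fst = c ∧ (d z).snd = (d (xl a b q)).snd := by
  obtain ⟨z, hz⟩ := z
  have hz' := hz
  unfold PsiAlg at hz'
  induction hz' using Algebra.adjoin_induction with
  | mem x hx =>
    obtain ⟨i, rfl⟩ := hx
    refine ⟨0, Pi.single i 1, fun d => ?_⟩
    have : (⟨XX K a b (fun _ => (0 : K)) i, hz⟩ : PsiAlg K a b (fun _ => (0 : K))) =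
      xl a b (Pi.single i 1) := Subtype.ext (XX_eq a b i)
    rw [this]
    refine ⟨?_, rfl⟩
    have hn := ((xl_nilpotent a b (Pi.single i 1)).map d).map (TrivSqZeroExt.fstHom K K K)
    exact hn.eq_zero
  | algebraMap r =>
    refine ⟨r, 0, fun d => ?_⟩
    have : (⟨algebraMap K _ r, hz⟩ : PsiAlg K a b (fun _ => (0 : K))) = algebraMap K _ r := rfl
    rw [this, AlgHom.commutes]
    simp [TrivSqZeroExt.algebraMap_eq_inl]
  | add x y hx hy ihx ihy =>
    obtain ⟨c, q, h⟩ := ihx hx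
    obtain ⟨c', q', h'⟩ := ihy hy
    refine ⟨c + c', q + q', fun d => ?_⟩
    have : (⟨x + y, hz⟩ : PsiAlg K a b (fun _ => (0 : K))) = ⟨x, hx⟩ + ⟨y, hy⟩ := rfl
    rw [this, map_add, map_add, map_add]
    simp only [TrivSqZeroExt.fst_add, TrivSqZeroExt.snd_add, (h d).1, (h d).2, (h' d).1, (h' d).2,
      and_self]
  | mul x y hx hy ihx ihy =>
    obtain ⟨c, q, h⟩ := ihx hx
    obtain ⟨c', q', h'⟩ := ihy hy
    refine ⟨c * c', c • q' + c' • q, fun d => ?_⟩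
    have : (⟨x * y, hz⟩ : PsiAlg K a b (fun _ => (0 : K))) = ⟨x, hx⟩ * ⟨y, hy⟩ := rfl
    rw [this, map_mul, map_add, map_smul, map_smul, map_add, map_smul, map_smul]
    simp only [TrivSqZeroExt.fst_mul, DualNumber.snd_mul, TrivSqZeroExt.snd_add,
      TrivSqZeroExt.snd_smul, (h d).1, (h d).2, (h' d).1, (h' d).2, smul_eq_mul, true_and]
    ring

end Weight

section MacWilliams

variable {K V E₁ E₂ : Type*} [Field K] [CharZero K] [AddCommGroup V] [Module K V]
  [Fintype E₁] [Fintype E₂]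

theorem ker_eq_of_le {f g : V →ₗ[K] K} (hg : g ≠ 0) (h : LinearMap.ker f ≤ LinearMap.ker g) :
    ∃ c : K, c ≠ 0 ∧ g = c • f := by
  obtain ⟨z, hz⟩ : ∃ z, g z ≠ 0 := by
    by_contra hh; push Not at hh; exact hg (LinearMap.ext hh)
  have hfz : f z ≠ 0 := fun h0 => hz (h h0)
  refine ⟨g z / f z, div_ne_zero hz hfz, LinearMap.ext fun y => ?_⟩
  have : y - (f y / f z) • z ∈ LinearMap.ker f := by simp [hfz]
  have := h this
  simp [sub_eq_zero] at this
  rw [this, LinearMap.smul_apply, smul_eq_mul]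
  field_simp

open Classical in
theorem macwilliams (f : E₁ → V →ₗ[K] K) (g : E₂ → V →ₗ[K] K) (hf : ∀ e, f e ≠ 0)
    (hg : ∀ e, g e ≠ 0)
    (h : ∀ z, (Finset.univ.filter fun e => f e z ≠ 0).card =
      (Finset.univ.filter fun e => g e z ≠ 0).card) :
    ∃ σ : E₁ ≃ E₂, ∀ e, ∃ c : K, c ≠ 0 ∧ f e = c • g (σ e) := by
  let F : E₁ ⊕ E₂ → Module.Dual K V := Sum.elim f g
  have hF : ∀ i, F i ≠ 0 := by rintro (i | i); exacts [hf i, hg i]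
  have hcard : Fintype.card E₁ = Fintype.card E₂ := by
    obtain ⟨z, hz⟩ := Module.Dual.exists_forall_ne_zero_of_forall_exists F (fun i => by
      by_contra hh; push Not at hh; exact hF i (LinearMap.ext hh))
    have := h z
    have z1 : ∀ e, f e z ≠ 0 := fun e => hz (Sum.inl e)
    have z2 : ∀ e, g e z ≠ 0 := fun e => hz (Sum.inr e)
    rw [Finset.filter_true_of_mem fun e _ => z1 e,
      Finset.filter_true_of_mem fun e _ => z2 e] at this
    exact this
  have key : ∀ H : Submodule K V, Fintype.card {e // LinearMap.ker (f e) = H} =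
      Fintype.card {e // LinearMap.ker (g e) = H} := by
    intro H
    by_cases hH : ∃ i, LinearMap.ker (F i) = H
    · obtain ⟨i₀, rfl⟩ := hH
      obtain ⟨z, hzH, hz⟩ := Module.Dual.exists_forall_mem_ne_zero_of_forall_exists
        (LinearMap.ker (F i₀))
        (fun i : {i // LinearMap.ker (F i) ≠ LinearMap.ker (F i₀)} => F i) (by
          rintro ⟨i, hi⟩
          by_contra hh
          push Not at hh
          obtain ⟨c, hc, hcF⟩ := ker_eq_of_le (hF i) (f := F i₀) (fun y hy => hh y hy)
          refine hi ?_
          rw [hcF]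
          ext y
          simp [hc])
      have hiff : ∀ i, F i z ≠ 0 ↔ LinearMap.ker (F i) ≠ LinearMap.ker (F i₀) := by
        intro i
        refine ⟨fun hne heq => hne ?_, fun hne => hz ⟨i, hne⟩⟩
        have : z ∈ LinearMap.ker (F i) := heq ▸ hzH
        exact this
      have hz1 := h z
      have e1 : (Finset.univ.filter fun e => f e z ≠ 0) =
          Finset.univ.filter fun e => ¬ (LinearMap.ker (f e) = LinearMap.ker (F i₀)) :=
        Finset.filter_congr fun e _ => hiff (Sum.inl e)
      have e2 : (Finset.univ.filter fun e => g e z ≠ 0) =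
          Finset.univ.filter fun e => ¬ (LinearMap.ker (g e) = LinearMap.ker (F i₀)) :=
        Finset.filter_congr fun e _ => hiff (Sum.inr e)
      rw [e1, e2] at hz1
      have c1 := Finset.card_filter_add_card_filter_not (s := Finset.univ)
        (fun e : E₁ => LinearMap.ker (f e) = LinearMap.ker (F i₀))
      have c2 := Finset.card_filter_add_card_filter_not (s := Finset.univ)
        (fun e : E₂ => LinearMap.ker (g e) = LinearMap.ker (F i₀))
      rw [Fintype.card_subtype, Fintype.card_subtype]
      simp only [Finset.card_univ] at c1 c2
      omega
    · push Not at hH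
      have : IsEmpty {e // LinearMap.ker (f e) = H} := ⟨fun e => hH (Sum.inl e.1) e.2⟩
      have : IsEmpty {e // LinearMap.ker (g e) = H} := ⟨fun e => hH (Sum.inr e.1) e.2⟩
      simp
  let σ : E₁ ≃ E₂ := Equiv.ofFiberEquiv (f := fun e => LinearMap.ker (f e))
    (g := fun e => LinearMap.ker (g e)) fun H => Fintype.equivOfCardEq (key H)
  refine ⟨σ, fun e => ?_⟩
  have hσ : LinearMap.ker (g (σ e)) = LinearMap.ker (f e) :=
    Equiv.ofFiberEquiv_map (f := fun e => LinearMap.ker (f e))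
      (g := fun e => LinearMap.ker (g e)) _ e
  exact ker_eq_of_le (hf e) hσ.le

end MacWilliams

section Forward

open DualNumber

variable {K : Type*} [Field K] [CharZero K] {n₁ n₂ : ℕ} {E₁ E₂ : Type*}
    [Fintype E₁] [DecidableEq E₁] [Fintype E₂] [DecidableEq E₂]

/-- Restriction of `linHom` to `C_G`. -/
def lh {n : ℕ} {E : Type*} [Fintype E] [DecidableEq E] (a b : E → Fin n) (e : E) :
    PsiAlg K a b (fun _ => (0 : K)) →ₐ[K] K[ε] :=
  (linHom K e).comp (Subalgebra.val _)

theorem lh_xl {n : ℕ} {E : Type*} [Fintype E] [DecidableEq E] (a b : E → Fin n) (e : E)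
    (p : Fin n → K) : (lh a b e (xl a b p)).snd = p (a e) - p (b e) :=
  linHom_XL a b p e

open Classical in
theorem weight_le (a₁ b₁ : E₁ → Fin n₁) (a₂ b₂ : E₂ → Fin n₂)
    (φ : (PsiAlg K a₁ b₁ fun _ => (0 : K)) →ₐ[K] (PsiAlg K a₂ b₂ fun _ => (0 : K)))
    (p : Fin n₁ → K) :
    (Finset.univ.filter fun e => (lh a₂ b₂ e (φ (xl a₁ b₁ p))).snd ≠ 0).card ≤
      (Finset.univ.filter fun e => p (a₁ e) - p (b₁ e) ≠ 0).card := by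
  have h1 : (xl a₁ b₁ p) ^ ((Finset.univ.filter fun e => p (a₁ e) - p (b₁ e) ≠ 0).card + 1) = 0 :=
    Subtype.ext (XL_pow a₁ b₁ p _ (by simp))
  have h2 := congrArg φ h1
  rw [map_pow, map_zero] at h2
  have h3 := congrArg Subtype.val h2
  have := card_lt_of_pow (K := K) ((φ (xl a₁ b₁ p)).1) _ h3
    (Finset.univ.filter fun e => (lh a₂ b₂ e (φ (xl a₁ b₁ p))).snd ≠ 0) (by
      intro e he
      exact (Finset.mem_filter.1 he).2)
  omega

theorem forest_of_iso (a₁ b₁ : E₁ → Fin n₁) (a₂ b₂ : E₂ → Fin n₂)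
    (hab₁ : ∀ e, a₁ e < b₁ e) (hab₂ : ∀ e, a₂ e < b₂ e)
    (φ : (PsiAlg K a₁ b₁ fun _ => (0 : K)) ≃ₐ[K] (PsiAlg K a₂ b₂ fun _ => (0 : K))) :
    ∃ σ : E₁ ≃ E₂, ∀ F : Finset E₁,
        IsForest a₁ b₁ F ↔ IsForest a₂ b₂ (F.map σ.toEmbedding) := by
  classical
  let φ₁ : (PsiAlg K a₁ b₁ fun _ => (0 : K)) →ₐ[K] (PsiAlg K a₂ b₂ fun _ => (0 : K)) := φ
  let φ₂ : (PsiAlg K a₂ b₂ fun _ => (0 : K)) →ₐ[K] (PsiAlg K a₁ b₁ fun _ => (0 : K)) := φ.symm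
  let f : E₁ → (Fin n₁ → K) →ₗ[K] K := fun e =>
    LinearMap.proj (R := K) (φ := fun _ : Fin n₁ => K) (a₁ e) -
      LinearMap.proj (R := K) (φ := fun _ : Fin n₁ => K) (b₁ e)
  have hf : ∀ e p, f e p = p (a₁ e) - p (b₁ e) := fun e p => rfl
  let g : E₂ → (Fin n₁ → K) →ₗ[K] K := fun e =>
    (TrivSqZeroExt.sndHom K K).comp (((lh a₂ b₂ e).comp φ₁).toLinearMap.comp (xl a₁ b₁))
  have hg : ∀ e p, g e p = (lh a₂ b₂ e (φ (xl a₁ b₁ p))).snd := fun e p => rfl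
  -- from the first graph to the second
  have hT : ∀ p, ∃ q : Fin n₂ → K, (∀ e, g e p = q (a₂ e) - q (b₂ e)) ∧
      ∀ e, (lh a₁ b₁ e (φ₂ (xl a₂ b₂ q))).snd = f e p := by
    intro p
    obtain ⟨c, q, h⟩ := tangent a₂ b₂ (φ (xl a₁ b₁ p))
    refine ⟨q, fun e => ?_, fun e => ?_⟩
    · rw [hg, (h (lh a₂ b₂ e)).2, lh_xl]
    · have := (h ((lh a₁ b₁ e).comp φ₂)).2
      rw [hf, ← lh_xl (K := K) a₁ b₁ e p]
      simp only [AlgHom.comp_apply] at this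
      rw [← this]
      simp [φ₂]
  -- surjectivity
  have hT' : ∀ q : Fin n₂ → K, ∃ p, ∀ e, g e p = q (a₂ e) - q (b₂ e) := by
    intro q
    obtain ⟨c, p, h⟩ := tangent a₁ b₁ (φ.symm (xl a₂ b₂ q))
    refine ⟨p, fun e => ?_⟩
    have := (h ((lh a₂ b₂ e).comp φ₁)).2
    rw [hg, ← lh_xl (K := K) a₂ b₂ e q]
    simp only [AlgHom.comp_apply] at this
    have h2 : φ₁ (φ.symm (xl a₂ b₂ q)) = xl a₂ b₂ q := by simp [φ₁]
    rw [h2] at this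
    exact this.symm
  obtain ⟨σ, hσ⟩ := macwilliams f g (by
      intro e h0
      have := congrArg (fun l => l (Pi.single (a₁ e) 1)) h0
      simp [hf, (hab₁ e).ne'] at this) (by
      intro e h0
      obtain ⟨p, hp⟩ := hT' (Pi.single (a₂ e) 1)
      have := hp e
      rw [h0] at this
      simp [(hab₂ e).ne'] at this) (by
      intro p
      apply le_antisymm
      · obtain ⟨q, h1, h2⟩ := hT p
        have := weight_le a₂ b₂ a₁ b₁ φ₂ q
        simp only [h2] at this
        simp only [h1]
        convert this
      · have := weight_le a₁ b₁ a₂ b₂ φ₁ p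
        exact this)
  choose c hc hcf using hσ
  refine ⟨σ, fun F => ?_⟩
  rw [isForest_iff_surj (K := K), isForest_iff_surj (K := K)]
  constructor
  · intro h y
    obtain ⟨p, hp⟩ := h (fun e => c e * y (σ e))
    obtain ⟨q, h1, _⟩ := hT p
    refine ⟨q, ?_⟩
    intro e he
    obtain ⟨e, he', rfl⟩ := Finset.mem_map.1 he
    have := hp e he'
    rw [← hf, hcf e, LinearMap.smul_apply, smul_eq_mul, h1] at this
    exact mul_left_cancel₀ (hc e) this
  · intro h y
    obtain ⟨q, hq⟩ := h (fun e => (c (σ.symm e))⁻¹ * y (σ.symm e))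
    obtain ⟨p, hp⟩ := hT' q
    refine ⟨p, fun e he => ?_⟩
    have := hq (σ e) (Finset.mem_map.2 ⟨e, he, rfl⟩)
    rw [← hf, hcf e, LinearMap.smul_apply, smul_eq_mul, hp, this]
    simp [hc e]

end Forward

end PSIso

/-- Two Postnikov–Shapiro algebras `C_{G₁}` and `C_{G₂}` are isomorphic as
`K`-algebras if and only if the graphical matroids of `G₁` and `G₂` coincide. -/
theorem iso_iff_matroids_coincide
    {K : Type*} [Field K] [CharZero K] {n₁ n₂ : ℕ} {E₁ E₂ : Type*}
    [Fintype E₁] [DecidableEq E₁] [Fintype E₂] [DecidableEq E₂]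
    (a₁ b₁ : E₁ → Fin n₁) (a₂ b₂ : E₂ → Fin n₂)
    (hab₁ : ∀ e, a₁ e < b₁ e) (hab₂ : ∀ e, a₂ e < b₂ e) :
    Nonempty ((PsiAlg K a₁ b₁ fun _ => (0 : K)) ≃ₐ[K] (PsiAlg K a₂ b₂ fun _ => (0 : K))) ↔
      ∃ σ : E₁ ≃ E₂, ∀ F : Finset E₁,
        IsForest a₁ b₁ F ↔ IsForest a₂ b₂ (F.map σ.toEmbedding) := by
  constructor
  · rintro ⟨φ⟩
    exact PSIso.forest_of_iso a₁ b₁ a₂ b₂ hab₁ hab₂ φ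
  · rintro ⟨σ, hσ⟩
    obtain ⟨c, hc, h1, h2⟩ := PSIso.exists_scaling (K := K) a₁ b₁ a₂ b₂ σ hσ
    exact PSIso.iso_of_scaling a₁ b₁ a₂ b₂ σ c hc h1 h2

end
end
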